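/- arXiv:nlin/0312042 — 3 statements merged into one kernel-verified Lean document; each statement's English description precedes it below -/
import Mathlib

section
/- For every Γ > 0, K > 0 and every prescribed velocity v > 0, there exists a force F > 0 such that the discrete sine-Gordon ring admits a travelling wave with velocity v; that is, there exist F > 0 and a twice continuously differentiable f : ℝ → ℝ with f(t + T) = f(t) + 2π for all t (where T = 2π/v) satisfying the waveform equation for that F. -/
open Real in
/-- `f` is the waveform of a travelling wave with velocity `v` of the discrete
sine-Gordon ring with `n` sites, winding number `m`, damping `Γ`, coupling `K`
and force `F`: `f` is `C²`, satisfies `f (t + T) = f t + 2π` with `T = 2π/v`,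
and the waveform equation. -/
def IsWaveform (n m : ℕ) (Γ K F v : ℝ) (f : ℝ → ℝ) : Prop :=
  ContDiff ℝ 2 f ∧
  (∀ t : ℝ, f (t + 2 * π / v) = f t + 2 * π) ∧
  (∀ t : ℝ, deriv (deriv f) t + Γ * deriv f t + Real.sin (f t)
      = F + K * (f (t + ((m : ℝ) / n) * (2 * π / v)) - 2 * f t
          + f (t - ((m : ℝ) / n) * (2 * π / v))))

open MeasureTheory Metric Set in
/-- If `g` is Lipschitz on a closed ball and vanishes on its boundary, then for large `s` the map
`x ↦ s • x + g x` sends the open ball of radius `R` bijectively onto the one of radius `s * R`. -/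
theorem bijOn_ball_smul_add {E : Type*} [NormedAddCommGroup E] [NormedSpace ℝ E] [CompleteSpace E]
    {g : E → E} {R : ℝ} {L : NNReal} (hg : LipschitzOnWith L g (closedBall 0 R))
    (hg0 : ∀ x, ‖x‖ = R → g x = 0) {s : ℝ} (hs : (L : ℝ) < s) :
    BijOn (fun x => s • x + g x) (ball 0 R) (ball 0 (s * R)) := by
  classical
  have hs0 : 0 < s := lt_of_le_of_lt L.2 hs
  set G : E → E := (closedBall 0 R).indicator g with hG
  have hmixed : ∀ x y : E, ‖x‖ ≤ R → R < ‖y‖ → ‖G x - G y‖ ≤ L * ‖x - y‖ := by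
    intro x y hx hy
    obtain ⟨z, hz, hzR⟩ : ∃ z ∈ segment ℝ x y, ‖z‖ = R := by
      have := (convex_segment (𝕜 := ℝ) x y).isPreconnected.intermediate_value
        (left_mem_segment ℝ x y) (right_mem_segment ℝ x y) continuous_norm.continuousOn
      exact this ⟨hx, hy.le⟩
    have hGx : G x = g x := indicator_of_mem (by simpa using hx) _
    have hGy : G y = 0 := indicator_of_notMem (by simpa using hy) _
    have h1 : dist (g x) (g z) ≤ L * dist x z :=
      hg.dist_le_mul x (by simpa using hx) z (by simp [hzR])
    rw [hg0 z hzR, dist_eq_norm, dist_eq_norm] at h1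
    rw [hGx, hGy]
    refine h1.trans (mul_le_mul_of_nonneg_left ?_ L.2)
    have := dist_add_dist_of_mem_segment hz
    rw [dist_eq_norm, dist_eq_norm, dist_eq_norm] at this
    linarith [norm_nonneg (z - y)]
  have hGL : ∀ x y : E, ‖G x - G y‖ ≤ L * ‖x - y‖ := by
    intro x y
    rcases le_or_gt ‖x‖ R with hx | hx <;> rcases le_or_gt ‖y‖ R with hy | hy
    · have hGx : G x = g x := indicator_of_mem (by simpa using hx) _
      have hGy : G y = g y := indicator_of_mem (by simpa using hy) _
      rw [hGx, hGy, ← dist_eq_norm, ← dist_eq_norm]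
      exact hg.dist_le_mul x (by simpa using hx) y (by simpa using hy)
    · exact hmixed x y hx hy
    · rw [norm_sub_rev, norm_sub_rev x y]
      exact hmixed y x hy hx
    · have hGx : G x = 0 := indicator_of_notMem (by simpa using hx) _
      have hGy : G y = 0 := indicator_of_notMem (by simpa using hy) _
      rw [hGx, hGy]
      simp only [sub_self, norm_zero]
      positivity
  have hGin : ∀ x, ‖x‖ ≤ R → G x = g x := fun x hx => indicator_of_mem (by simpa using hx) _
  have hGout : ∀ x, R ≤ ‖x‖ → G x = 0 := by
    intro x hx
    rcases hx.eq_or_lt with h | h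
    · rw [hGin x h.ge, hg0 x h.symm]
    · exact indicator_of_notMem (by simpa using h) _
  have hinj : Function.Injective fun x => s • x + G x := by
    intro x y hxy
    have h1 : s • (x - y) = -(G x - G y) := by
      simp only at hxy
      rw [smul_sub, neg_sub, sub_eq_sub_iff_add_eq_add, hxy, add_comm]
    have h2 := congrArg norm h1
    rw [norm_smul, norm_neg, Real.norm_of_nonneg hs0.le] at h2
    have h3 := hGL x y
    have : ‖x - y‖ = 0 := by
      by_contra hne
      have : 0 < ‖x - y‖ := lt_of_le_of_ne (norm_nonneg _) (Ne.symm hne)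
      nlinarith
    exact sub_eq_zero.1 (norm_eq_zero.1 this)
  have hsurj : Function.Surjective fun x => s • x + G x := by
    intro y
    have hc : ContractingWith (L / s.toNNReal) fun x => s⁻¹ • (y - G x) := by
      refine ⟨?_, LipschitzWith.of_dist_le_mul fun a b => ?_⟩
      · rw [div_lt_one (by simpa using hs0)]
        exact (Real.lt_toNNReal_iff_coe_lt).2 hs
      · rw [dist_eq_norm, ← smul_sub, norm_smul, norm_inv, Real.norm_of_nonneg hs0.le,
          sub_sub_sub_cancel_left, norm_sub_rev, NNReal.coe_div, Real.coe_toNNReal _ hs0.le,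
          div_mul_eq_mul_div, div_eq_inv_mul, dist_eq_norm]
        exact mul_le_mul_of_nonneg_left (hGL a b) (by positivity)
    have hfix : s⁻¹ • (y - G hc.fixedPoint) = hc.fixedPoint := hc.fixedPoint_isFixedPt
    refine ⟨hc.fixedPoint, ?_⟩
    have : s • hc.fixedPoint = y - G hc.fixedPoint := by
      conv_lhs => rw [← hfix]
      rw [smul_inv_smul₀ hs0.ne']
    simp only
    rw [this, sub_add_cancel]
  have hout : ∀ x, R ≤ ‖x‖ → s • x + G x ∉ ball (0 : E) (s * R) := by
    intro x hx
    rw [hGout x hx, add_zero, mem_ball_zero_iff, norm_smul, Real.norm_of_nonneg hs0.le, not_lt]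
    exact mul_le_mul_of_nonneg_left hx hs0.le
  have heq : EqOn (fun x => s • x + G x) (fun x => s • x + g x) (ball 0 R) := by
    intro x hx
    simp only
    rw [hGin x (mem_ball_zero_iff.1 hx).le]
  refine BijOn.congr ⟨?_, hinj.injOn, ?_⟩ heq
  · intro x hx
    by_contra hcon
    rw [mem_ball_zero_iff, not_lt] at hcon
    set z := s⁻¹ • (s • x + G x) with hz
    have hzn : R ≤ ‖z‖ := by
      rw [hz, norm_smul, norm_inv, Real.norm_of_nonneg hs0.le, le_inv_mul_iff₀ hs0]
      exact hcon
    have : z = x := by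
      apply hinj
      simp only
      rw [hGout z hzn, hz, smul_inv_smul₀ hs0.ne', add_zero]
    rw [this] at hzn
    exact absurd (mem_ball_zero_iff.1 hx) (not_lt.2 hzn)
  · intro y hy
    obtain ⟨x, rfl⟩ := hsurj y
    refine ⟨x, ?_, rfl⟩
    by_contra hcon
    rw [mem_ball_zero_iff, not_lt] at hcon
    exact hout x hcon hy

/-- A linear perturbation of a large homothety has positive determinant. -/
theorem ContinuousLinearMap.det_smul_id_add_pos {E : Type*} [NormedAddCommGroup E]
    [NormedSpace ℝ E] [FiniteDimensional ℝ E] (A : E →L[ℝ] E) {s : ℝ} (hs : ‖A‖ < s) :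
    0 < (s • ContinuousLinearMap.id ℝ E + A).det := by
  have hs0 : 0 < s := (norm_nonneg _).trans_lt hs
  have hcont : Continuous fun t : ℝ => (s • ContinuousLinearMap.id ℝ E + t • A).det :=
    ContinuousLinearMap.continuous_det.comp (by fun_prop)
  have hne : ∀ t ∈ Set.Icc (0 : ℝ) 1, (s • ContinuousLinearMap.id ℝ E + t • A).det ≠ 0 := by
    intro t ht h0
    obtain ⟨v, hv0, hv⟩ : ∃ v ≠ 0, (s • ContinuousLinearMap.id ℝ E + t • A) v = 0 := by
      have := LinearMap.bot_lt_ker_of_det_eq_zero h0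
      obtain ⟨v, hv, hv0⟩ := (Submodule.ne_bot_iff _).1 this.ne'
      exact ⟨v, hv0, hv⟩
    have h1 : s • v = -(t • A v) := by
      simpa [eq_neg_iff_add_eq_zero] using hv
    have h2 := congrArg norm h1
    rw [norm_neg, norm_smul, norm_smul, Real.norm_of_nonneg hs0.le, Real.norm_of_nonneg ht.1] at h2
    have h3 := A.le_opNorm v
    have h4 : 0 < ‖v‖ := norm_pos_iff.2 hv0
    have h5 : t * ‖A v‖ ≤ 1 * ‖A v‖ := mul_le_mul_of_nonneg_right ht.2 (norm_nonneg _)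
    nlinarith
  by_contra hcon
  have h0 : 0 < (s • ContinuousLinearMap.id ℝ E + (0 : ℝ) • A).det := by
    have : (s • ContinuousLinearMap.id ℝ E + (0 : ℝ) • A).det
        = s ^ Module.finrank ℝ E := by
      simp [ContinuousLinearMap.det, LinearMap.det_smul]
    rw [this]
    positivity
  obtain ⟨t, ht, h⟩ := intermediate_value_Icc' zero_le_one hcont.continuousOn
    (show (0 : ℝ) ∈ Set.Icc _ _ from ⟨by simpa using not_lt.1 hcon, h0.le⟩)
  exact hne t ht h

open MeasureTheory Metric Set in
/-- There is no `C¹` retraction of a closed ball onto its boundary sphere. -/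
theorem not_retraction_sphere {E : Type*} [NormedAddCommGroup E] [InnerProductSpace ℝ E]
    [FiniteDimensional ℝ E] {r : E → E} (hr : ContDiff ℝ 1 r) {R : ℝ} (hR : 0 < R)
    (hid : ∀ x, ‖x‖ = R → r x = x) (hsph : ∀ x, ‖r x‖ = R) : False := by
  borelize E
  set g : E → E := fun x => r x - x with hg
  have hgd : ContDiff ℝ 1 g := hr.sub contDiff_id
  have hfd : Continuous (fderiv ℝ g) := hgd.continuous_fderiv one_ne_zero
  obtain ⟨L, hL⟩ : ∃ L : NNReal, ∀ x ∈ closedBall (0 : E) R, ‖fderiv ℝ g x‖ ≤ L := by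
    obtain ⟨C, hC⟩ := (isCompact_closedBall (0 : E) R).exists_bound_of_continuousOn
      hfd.continuousOn
    exact ⟨C.toNNReal, fun x hx => (hC x hx).trans (Real.le_coe_toNNReal C)⟩
  have hlip : LipschitzOnWith L g (closedBall 0 R) :=
    (convex_closedBall _ _).lipschitzOnWith_of_nnnorm_fderiv_le
      (fun x _ => hgd.differentiable one_ne_zero x) fun x hx => by exact_mod_cast hL x hx
  set d := Module.finrank ℝ E with hd
  set J : ℝ → E → ℝ := fun s x => (s • ContinuousLinearMap.id ℝ E + fderiv ℝ g x).det with hJ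
  have hJc : ∀ s, Continuous (J s) := fun s =>
    ContinuousLinearMap.continuous_det.comp (continuous_const.add hfd)
  have hJi : ∀ s, IntegrableOn (J s) (ball 0 R) := fun s =>
    ((hJc s).continuousOn.integrableOn_compact (isCompact_closedBall (0 : E) R)).mono_set
      ball_subset_closedBall
  have hvol : ∀ s : ℝ, L < s → ∫ x in ball (0 : E) R, J s x = s ^ d * volume.real (ball (0 : E) R) := by
    intro s hs
    have hs0 : 0 < s := lt_of_le_of_lt L.2 hs
    have hb := bijOn_ball_smul_add hlip (fun x hx => by simp [hg, hid x hx]) hs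
    have hder : ∀ x ∈ ball (0 : E) R, HasFDerivWithinAt (fun x => s • x + g x)
        (s • ContinuousLinearMap.id ℝ E + fderiv ℝ g x) (ball 0 R) x := fun x _ =>
      (((hasFDerivAt_id x).const_smul s).add
        (hgd.differentiable one_ne_zero x).hasFDerivAt).hasFDerivWithinAt
    have := integral_image_eq_integral_abs_det_fderiv_smul volume measurableSet_ball hder hb.injOn
      (fun _ => (1 : ℝ))
    rw [hb.image_eq] at this
    simp only [smul_eq_mul, mul_one, integral_const, MeasurableSet.univ, measureReal_restrict_apply,
      univ_inter] at this
    have hball : volume.real (ball (0 : E) (s * R)) = s ^ d * volume.real (ball (0 : E) R) := by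
      rw [measureReal_def, Measure.addHaar_ball_mul_of_pos _ _ hs0, ENNReal.toReal_mul,
        ENNReal.toReal_ofReal (by positivity), measureReal_def]
    rw [← hball, this]
    refine setIntegral_congr_fun measurableSet_ball fun x hx => ?_
    exact (abs_of_pos (ContinuousLinearMap.det_smul_id_add_pos _
      ((hL x (ball_subset_closedBall hx)).trans_lt hs))).symm
  have hJ1 : ∀ x, J 1 x = 0 := by
    intro x
    by_contra hne
    have hrd : HasFDerivAt r ((1 : ℝ) • ContinuousLinearMap.id ℝ E + fderiv ℝ g x) x := by
      have h := (hasFDerivAt_id (𝕜 := ℝ) x).add (hgd.differentiable one_ne_zero x).hasFDerivAt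
      rw [one_smul]
      refine h.congr_of_eventuallyEq (Filter.Eventually.of_forall fun y => ?_)
      simp [hg]
    set A := (1 : ℝ) • ContinuousLinearMap.id ℝ E + fderiv ℝ g x with hA
    have horth : ∀ v, inner ℝ (r x) (A v) = 0 := by
      intro v
      have h1 := (hrd.inner ℝ hrd)
      have h2 : (fun t => inner ℝ (r t) (r t)) = fun _ => R ^ 2 := by
        funext t
        rw [real_inner_self_eq_norm_sq, hsph]
      rw [h2] at h1
      have h3 := h1.unique (hasFDerivAt_const (R ^ 2) x)
      have h4 := congrArg (fun B : E →L[ℝ] ℝ => B v) h3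
      simpa [real_inner_comm] using h4
    obtain ⟨v, hv⟩ : ∃ v, A v = r x := by
      have hu : LinearMap.det (A : E →ₗ[ℝ] E) ≠ 0 := hne
      exact (LinearMap.equivOfDetNeZero _ hu).surjective (r x)
    have h5 := horth v
    rw [hv, real_inner_self_eq_norm_sq, hsph] at h5
    exact absurd h5 (by positivity)
  have hLn : ∀ i : ℕ, (L : ℝ) < (L : ℝ) + 1 + i := fun i => by
    have : (0 : ℝ) ≤ i := i.cast_nonneg
    linarith
  set v : ℕ → ℝ := fun i => (L : ℝ) + 1 + i with hv
  have hvinj : Set.InjOn v (Finset.range (d + 1)) := by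
    intro i _ j _ h
    simpa [hv] using h
  have hpoly : ∀ A : E →L[ℝ] E, ∀ t : ℝ, (t • ContinuousLinearMap.id ℝ E + A).det
      = ∑ i ∈ Finset.range (d + 1), (v i • ContinuousLinearMap.id ℝ E + A).det *
        (Lagrange.basis (Finset.range (d + 1)) v i).eval t := by
    intro A t
    have hev : ∀ t : ℝ, (t • ContinuousLinearMap.id ℝ E + A).det
        = (LinearMap.charpoly (-(A : E →ₗ[ℝ] E))).eval t := by
      intro t
      rw [LinearMap.eval_charpoly, sub_neg_eq_add]
      rfl
    have hdeg : (LinearMap.charpoly (-(A : E →ₗ[ℝ] E))).degree < (Finset.range (d + 1)).card := by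
      rw [Polynomial.degree_eq_natDegree (LinearMap.charpoly_monic _).ne_zero,
        LinearMap.charpoly_natDegree, Finset.card_range]
      exact_mod_cast Nat.lt_succ_self d
    have := Lagrange.eq_interpolate hvinj hdeg
    rw [hev, this, Lagrange.interpolate_apply, Polynomial.eval_finsetSum]
    refine Finset.sum_congr rfl fun i _ => ?_
    rw [Polynomial.eval_mul, Polynomial.eval_C, hev]
  have hone : (1 : ℝ) = ∑ i ∈ Finset.range (d + 1), v i ^ d *
      (Lagrange.basis (Finset.range (d + 1)) v i).eval 1 := by
    have := hpoly 0 1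
    simpa [ContinuousLinearMap.det, LinearMap.det_smul] using this
  have hintegral : ∫ x in ball (0 : E) R, J 1 x = volume.real (ball (0 : E) R) := by
    calc ∫ x in ball (0 : E) R, J 1 x
        = ∫ x in ball (0 : E) R, ∑ i ∈ Finset.range (d + 1), J (v i) x *
            (Lagrange.basis (Finset.range (d + 1)) v i).eval 1 := by
          refine integral_congr_ae (Filter.Eventually.of_forall fun x => hpoly _ 1)
      _ = ∑ i ∈ Finset.range (d + 1), (v i ^ d * volume.real (ball (0 : E) R)) *
            (Lagrange.basis (Finset.range (d + 1)) v i).eval 1 := by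
          rw [integral_finsetSum _ fun i _ => (hJi (v i)).mul_const _]
          refine Finset.sum_congr rfl fun i _ => ?_
          rw [integral_mul_const, hvol (v i) (hLn i)]
      _ = volume.real (ball (0 : E) R) := by
          conv_rhs => rw [← one_mul (volume.real _), hone, Finset.sum_mul]
          exact Finset.sum_congr rfl fun i _ => by ring
  simp only [hJ1, integral_zero] at hintegral
  have : 0 < volume.real (ball (0 : E) R) :=
    ENNReal.toReal_pos (measure_ball_pos _ _ hR).ne' measure_ball_lt_top.ne
  linarith

/-- Brouwer's fixed point theorem for bounded `C¹` maps. -/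
theorem ContDiff.exists_fixedPoint_of_bounded {E : Type*} [NormedAddCommGroup E]
    [InnerProductSpace ℝ E] [FiniteDimensional ℝ E] {N : E → E} (hN : ContDiff ℝ 1 N) {M : ℝ}
    (hM : ∀ x, ‖N x‖ ≤ M) : ∃ x, N x = x := by
  by_contra! hne
  have hM0 : 0 ≤ M := (norm_nonneg _).trans (hM 0)
  let χ : ContDiffBump (0 : E) := ⟨M + 1, M + 2, by linarith, by linarith⟩
  set H : E → E := fun x => x - χ x • N x with hH
  have hHd : ContDiff ℝ 1 H := contDiff_id.sub (χ.contDiff.smul hN)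
  have hH0 : ∀ x, H x ≠ 0 := by
    intro x hx
    have hx' : x = χ x • N x := sub_eq_zero.1 hx
    rcases le_or_gt ‖x‖ (M + 1) with h | h
    · rw [χ.one_of_mem_closedBall (by simpa using h), one_smul] at hx'
      exact hne x hx'.symm
    · have h2 := congrArg (fun y => ‖y‖) hx'
      simp only [norm_smul, Real.norm_of_nonneg χ.nonneg] at h2
      have h3 : χ x * ‖N x‖ ≤ 1 * M := mul_le_mul χ.le_one (hM x) (norm_nonneg _) zero_le_one
      linarith
  refine not_retraction_sphere (r := fun x => ((M + 2) * ‖H x‖⁻¹) • H x) (R := M + 2) ?_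
    (by linarith) ?_ ?_
  · exact (contDiff_const.mul ((hHd.norm ℝ hH0).inv fun x => norm_ne_zero_iff.2 (hH0 x))).smul hHd
  · intro x hx
    have hHx : H x = x := by
      simp only [hH]
      rw [χ.zero_of_le_dist (by simp [χ, hx]), zero_smul, sub_zero]
    rw [hHx, hx, mul_inv_cancel₀ (by linarith), one_smul]
  · intro x
    rw [norm_smul, norm_mul, norm_inv, norm_norm, mul_assoc,
      inv_mul_cancel₀ (norm_ne_zero_iff.2 (hH0 x)), mul_one, Real.norm_of_nonneg (by linarith)]

/-- Brouwer's fixed point theorem for bounded continuous maps of a finite-dimensional space. -/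
theorem Continuous.exists_fixedPoint_of_bounded {V : Type*} [NormedAddCommGroup V]
    [NormedSpace ℝ V] [FiniteDimensional ℝ V] {N : V → V} (hN : Continuous N) {M : ℝ}
    (hM : ∀ x, ‖N x‖ ≤ M) : ∃ x, N x = x := by
  have key : ∀ ε > 0, ∃ x, ‖N x - x‖ < ε := by
    intro ε hε
    obtain ⟨g, hg, hgN, -⟩ := hN.exists_contDiff_approx 1 (ε := fun _ => ε) continuous_const
      fun _ => hε
    let e : V ≃L[ℝ] _ := toEuclidean
    obtain ⟨y, hy⟩ := ContDiff.exists_fixedPoint_of_bounded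
      (N := fun y => e (g (e.symm y))) (e.contDiff.comp (hg.comp e.symm.contDiff))
      (M := ‖e.toContinuousLinearMap‖ * (M + ε)) (by
        intro y
        refine (e.toContinuousLinearMap.le_opNorm _).trans (mul_le_mul_of_nonneg_left ?_ (norm_nonneg _))
        have h1 := hgN (e.symm y)
        rw [dist_eq_norm] at h1
        have h2 := norm_add_le (g (e.symm y) - N (e.symm y)) (N (e.symm y))
        rw [sub_add_cancel] at h2
        linarith [hM (e.symm y)])
    refine ⟨e.symm y, ?_⟩
    have h3 : g (e.symm y) = e.symm y := by
      apply e.injective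
      rw [hy, e.apply_symm_apply]
    have h1 := hgN (e.symm y)
    rw [h3, dist_comm, dist_eq_norm] at h1
    exact h1
  have hM0 : 0 ≤ M := (norm_nonneg _).trans (hM 0)
  have : ProperSpace V := FiniteDimensional.proper ℝ V
  obtain ⟨x, hx, hmin⟩ := (isCompact_closedBall (0 : V) (M + 1)).exists_isMinOn
    ⟨0, by simp; linarith⟩ (f := fun x => ‖N x - x‖) (by fun_prop)
  refine ⟨x, ?_⟩
  by_contra hne
  have hpos : 0 < ‖N x - x‖ := norm_pos_iff.2 (sub_ne_zero.2 hne)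
  obtain ⟨y, hy⟩ := key (min 1 ‖N x - x‖) (lt_min one_pos hpos)
  have hy1 : ‖y‖ ≤ M + 1 := by
    have h2 := norm_sub_le (N y) (N y - y)
    rw [sub_sub_cancel] at h2
    linarith [hM y, hy.le.trans (min_le_left _ _)]
  have h := hmin (a := y) (by simpa using hy1)
  simp only [Set.mem_ofPred_eq] at h
  linarith [hy.trans_le (min_le_right _ _)]

/-- A continuous self-map of a product of discs has a fixed point. -/
theorem exists_fixedPoint_pi_closedBall {ι : Type*} {a : ι → ℝ} (ha : ∀ i, 0 ≤ a i)
    {Φ : (ι → ℂ) → ι → ℂ}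
    (hΦ : ContinuousOn Φ (Set.univ.pi fun i => Metric.closedBall (0 : ℂ) (a i)))
    (hmaps : ∀ z i, ‖Φ z i‖ ≤ a i) :
    ∃ z, (∀ i, ‖z i‖ ≤ a i) ∧ Φ z = z := by
  classical
  have hproj : ∀ i, ∃ p : ℂ → ℂ, Continuous p ∧ (∀ w, ‖p w‖ ≤ a i) ∧
      ∀ w, ‖w‖ ≤ a i → p w = w := by
    intro i
    rcases (ha i).eq_or_lt with h | h
    · refine ⟨fun _ => 0, continuous_const, fun w => by simpa using ha i, fun w hw => ?_⟩
      exact (norm_le_zero_iff.1 (hw.trans h.ge)).symm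
    · have hm : ∀ w : ℂ, 0 < max (a i) ‖w‖ := fun w => lt_max_of_lt_left h
      refine ⟨fun w => (a i / max (a i) ‖w‖) • w, ?_, fun w => ?_, fun w hw => ?_⟩
      · exact (continuous_const.div (continuous_const.max continuous_norm)
          fun w => (hm w).ne').smul continuous_id
      · rw [norm_smul, Real.norm_of_nonneg (by have := hm w; positivity), div_mul_eq_mul_div,
          div_le_iff₀ (hm w)]
        exact mul_le_mul_of_nonneg_left (le_max_right _ _) h.le
      · simp only
        rw [max_eq_left hw, div_self h.ne', one_smul]
  choose p hpc hpa hpid using hproj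
  let clamp : (ι → ℂ) → ι → ℂ := fun z i => p i (z i)
  have hclamp : Continuous clamp := continuous_pi fun i => (hpc i).comp (continuous_apply i)
  have hΨ : Continuous fun z => Φ (clamp z) :=
    hΦ.comp_continuous hclamp fun z i _ => by simpa using hpa i (z i)
  let ext : ∀ s : Finset ι, (s → ℂ) → ι → ℂ := fun s y i => if h : i ∈ s then y ⟨i, h⟩ else 0
  have hext : ∀ s, Continuous (ext s) := by
    intro s
    refine continuous_pi fun i => ?_
    by_cases h : i ∈ s
    · simpa [ext, h] using continuous_apply _
    · simpa [ext, h] using continuous_const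
  have hfin : ∀ s : Finset ι, ∃ z : ι → ℂ, (∀ i, ‖z i‖ ≤ a i) ∧ ∀ i ∈ s, Φ z i = z i := by
    intro s
    obtain ⟨y, hy⟩ := Continuous.exists_fixedPoint_of_bounded
      (N := fun (y : s → ℂ) (i : s) => Φ (clamp (ext s y)) i)
      (continuous_pi fun i => (continuous_apply (i : ι)).comp (hΨ.comp (hext s)))
      (M := ∑ i : s, a i) (fun y => by
        rw [pi_norm_le_iff_of_nonneg (Finset.sum_nonneg fun (i : s) _ => ha i)]
        intro i
        exact (hmaps _ _).trans
          (Finset.single_le_sum (f := fun i : s => a i) (fun i _ => ha i) (Finset.mem_univ i)))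
    have hya : ∀ i, ‖ext s y i‖ ≤ a i := by
      intro i
      by_cases h : i ∈ s
      · have h1 : ext s y i = y ⟨i, h⟩ := by simp [ext, h]
        rw [h1, ← hy]
        exact hmaps _ _
      · simpa [ext, h] using ha i
    have hcl : clamp (ext s y) = ext s y := funext fun i => hpid i _ (hya i)
    refine ⟨ext s y, hya, fun i hi => ?_⟩
    have h1 : ext s y i = y ⟨i, hi⟩ := by simp [ext, hi]
    rw [h1]
    conv_rhs => rw [← hy]
    simp only
    rw [hcl]
  choose z hza hz using hfin
  let U : Ultrafilter (Finset ι) := Ultrafilter.of Filter.atTop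
  have hU : (U : Filter (Finset ι)) ≤ Filter.atTop := Ultrafilter.of_le _
  have hcomp : IsCompact (Set.univ.pi fun i => Metric.closedBall (0 : ℂ) (a i)) :=
    isCompact_univ_pi fun i => isCompact_closedBall _ _
  obtain ⟨w, hw, hlim⟩ := hcomp.ultrafilter_le_nhds (U.map z)
    (Filter.tendsto_principal.2 (Filter.Eventually.of_forall fun s i _ => by simpa using hza s i))
  have hlim' : Filter.Tendsto z U (nhds w) := hlim
  have hwa : ∀ i, ‖w i‖ ≤ a i := fun i => by simpa using hw i (Set.mem_univ i)
  refine ⟨w, hwa, funext fun i => ?_⟩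
  have h1 : Filter.Tendsto (fun s => Φ (clamp (z s)) i) U (nhds (Φ (clamp w) i)) :=
    (((continuous_apply i).comp hΨ).tendsto w).comp hlim'
  have h2 : Filter.Tendsto (fun s => z s i) U (nhds (w i)) :=
    ((continuous_apply i).tendsto w).comp hlim'
  have hcw : clamp w = w := funext fun i => hpid i _ (hwa i)
  rw [hcw] at h1
  refine tendsto_nhds_unique (h1.congr' ?_) h2
  filter_upwards [hU (Filter.eventually_ge_atTop {i})] with s hs
  have hcs : clamp (z s) = z s := funext fun i => hpid i _ (hza s i)
  rw [hcs, hz s i (hs (Finset.mem_singleton_self i))]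

open Complex in
/-- The Fourier mode `θ ↦ e^{ikθ}`. -/
noncomputable def expMode (k : ℤ) (θ : ℝ) : ℂ := exp (k * θ * I)

open Real in
/-- The unnormalised `k`-th Fourier coefficient over a period `2π`. -/
noncomputable def modeCoeff (q : ℝ → ℂ) (k : ℤ) : ℂ := ∫ θ in 0..2 * π, expMode (-k) θ * q θ

section Modes

open Complex Real

theorem continuous_expMode (k : ℤ) : Continuous (expMode k) := by
  unfold expMode
  fun_prop

theorem norm_expMode (k : ℤ) (θ : ℝ) : ‖expMode k θ‖ = 1 := by
  have : (k : ℂ) * θ * I = ((k * θ : ℝ) : ℂ) * I := by push_cast; ring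
  rw [expMode, this, norm_exp_ofReal_mul_I]

theorem expMode_zero_left (θ : ℝ) : expMode 0 θ = 1 := by simp [expMode]

theorem expMode_add_right (k : ℤ) (θ δ : ℝ) : expMode k (θ + δ) = expMode k θ * expMode k δ := by
  rw [expMode, expMode, expMode, ← Complex.exp_add]
  push_cast
  ring_nf

theorem expMode_mul (j k : ℤ) (θ : ℝ) : expMode j θ * expMode k θ = expMode (j + k) θ := by
  rw [expMode, expMode, expMode, ← Complex.exp_add]
  push_cast
  ring_nf

theorem expMode_periodic (k : ℤ) : Function.Periodic (expMode k) (2 * π) := by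
  intro θ
  have : expMode k (2 * π) = 1 := by
    rw [expMode, ← Complex.exp_int_mul_two_pi_mul_I k]
    push_cast
    ring_nf
  rw [expMode_add_right, this, mul_one]

theorem expMode_add_expMode_neg (k : ℤ) (δ : ℝ) :
    expMode k δ + expMode k (-δ) = ((2 * Real.cos (k * δ) : ℝ) : ℂ) := by
  rw [expMode, expMode]
  push_cast
  rw [Complex.two_cos]
  ring_nf

theorem hasDerivAt_expMode (k : ℤ) (θ : ℝ) :
    HasDerivAt (expMode k) (k * I * expMode k θ) θ := by
  have h1 : HasDerivAt (fun t : ℝ => (k : ℂ) * t * I) (k * 1 * I) θ :=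
    ((hasDerivAt_id θ).ofReal_comp.const_mul (k : ℂ)).mul_const I
  have h2 := h1.cexp
  refine h2.congr_deriv ?_
  rw [expMode]
  ring

theorem integral_expMode (k : ℤ) :
    ∫ θ in 0..2 * π, expMode k θ = if k = 0 then (2 * π : ℂ) else 0 := by
  split_ifs with h
  · subst h
    simp [expMode_zero_left]
  · have hk : (k : ℂ) * I ≠ 0 := mul_ne_zero (by exact_mod_cast h) I_ne_zero
    have := intervalIntegral.integral_eq_sub_of_hasDerivAt (a := 0) (b := 2 * π)
      (fun θ _ => hasDerivAt_expMode k θ)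
      ((continuous_const.mul (continuous_expMode k)).intervalIntegrable _ _)
    rw [intervalIntegral.integral_const_mul, (expMode_periodic k).eq, sub_self] at this
    exact (mul_eq_zero.1 this).resolve_left hk

theorem modeCoeff_deriv {p p' : ℝ → ℂ} (hper : Function.Periodic p (2 * π))
    (hp : ∀ θ, HasDerivAt p (p' θ) θ) (hp' : Continuous p') (k : ℤ) :
    modeCoeff p' k = k * I * modeCoeff p k := by
  have hpc : Continuous p := continuous_iff_continuousAt.2 fun θ => (hp θ).continuousAt
  have hc := continuous_expMode (-k)
  have := intervalIntegral.integral_eq_sub_of_hasDerivAt (a := 0) (b := 2 * π)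
    (fun θ _ => (hasDerivAt_expMode (-k) θ).mul (hp θ))
    (Continuous.intervalIntegrable (by fun_prop) _ _)
  rw [intervalIntegral.integral_add (Continuous.intervalIntegrable (by fun_prop) _ _)
    (Continuous.intervalIntegrable (by fun_prop) _ _)] at this
  simp only [Pi.mul_apply, (expMode_periodic (-k)).eq, hper.eq, sub_self, mul_assoc,
    intervalIntegral.integral_const_mul] at this
  rw [modeCoeff, modeCoeff]
  push_cast at this
  linear_combination this

theorem modeCoeff_tsum {z : ℤ → ℂ} (hz : Summable fun k => ‖z k‖) (k : ℤ) :
    modeCoeff (fun θ => ∑' j, z j * expMode j θ) k = 2 * π * z k := by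
  have h := intervalIntegral.tsum_intervalIntegral_eq_of_summable_norm (a := 0) (b := 2 * π)
    (f := fun j : ℤ => (⟨fun θ => z j * expMode (j - k) θ,
      continuous_const.mul (continuous_expMode _)⟩ : C(ℝ, ℂ))) (by
      refine hz.of_nonneg_of_le (fun j => norm_nonneg _) fun j => ?_
      refine (ContinuousMap.norm_le _ (norm_nonneg _)).2 fun θ => ?_
      simp [norm_expMode])
  have h1 : modeCoeff (fun θ => ∑' j, z j * expMode j θ) k
      = ∫ θ in 0..2 * π, ∑' j, z j * expMode (j - k) θ := by
    rw [modeCoeff]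
    refine intervalIntegral.integral_congr fun θ _ => ?_
    rw [← tsum_mul_left]
    refine tsum_congr fun j => ?_
    rw [sub_eq_add_neg, ← expMode_mul]
    ring
  rw [h1]
  simp only [ContinuousMap.coe_mk] at h
  rw [← h]
  simp only [intervalIntegral.integral_const_mul, integral_expMode, sub_eq_zero]
  rw [tsum_eq_single k (fun j hj => by simp [hj])]
  simp [mul_comm]

theorem eq_const_of_modeCoeff_eq_zero {d : ℝ → ℂ} (hd : Continuous d)
    (hper : Function.Periodic d (2 * π)) (h : ∀ k ≠ 0, modeCoeff d k = 0) (θ : ℝ) : d θ = d 0 := by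
  have : Fact (0 < 2 * π) := ⟨Real.two_pi_pos⟩
  let D : C(AddCircle (2 * π), ℂ) := ⟨hper.lift, continuous_quot_lift _ hd⟩
  have hD : ∀ x : ℝ, D (x : AddCircle (2 * π)) = d x := fun x => hper.lift_coe x
  have hcoeff : ∀ k ≠ 0, fourierCoeff D k = 0 := by
    intro k hk
    rw [fourierCoeff_eq_intervalIntegral _ _ 0, zero_add]
    have : ∫ x in 0..2 * π, fourier (-k) (x : AddCircle (2 * π)) • D x = modeCoeff d k := by
      refine intervalIntegral.integral_congr fun x _ => ?_
      rw [hD, fourier_coe_apply, expMode, smul_eq_mul]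
      congr 2
      have : (π : ℂ) ≠ 0 := by exact_mod_cast Real.pi_ne_zero
      push_cast
      field_simp
    rw [this, h k hk, smul_zero]
  have hsum : Summable (fourierCoeff D) :=
    summable_of_ne_finset_zero (s := {0}) fun k hk => hcoeff k (by simpa using hk)
  have hval : ∀ x : ℝ, d x = fourierCoeff D 0 := by
    intro x
    have h1 := has_pointwise_sum_fourier_series_of_summable hsum (x : AddCircle (2 * π))
    have h2 := hasSum_single (f := fun i => fourierCoeff D i • fourier i (x : AddCircle (2 * π))) 0
      fun k hk => by simp [hcoeff k hk]
    rw [← hD, h1.unique h2]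
    simp
  rw [hval, hval 0]

/-- A damped linear first-order equation with periodic forcing has a periodic solution. -/
theorem exists_periodic_hasDerivAt_sub_mul {α T : ℝ} (hα : 0 < α) (hT : 0 < T) {q : ℝ → ℂ}
    (hq : Continuous q) (hper : Function.Periodic q T) :
    ∃ u : ℝ → ℂ, Function.Periodic u T ∧ ∀ θ, HasDerivAt u (q θ - α * u θ) θ := by
  set J : ℝ → ℂ := fun θ => ∫ s in 0..θ, cexp (α * s) * q s with hJ
  have hc : Continuous fun s : ℝ => cexp (α * s) * q s := by fun_prop
  have hJd : ∀ θ : ℝ, HasDerivAt J (cexp (α * θ) * q θ) θ := fun θ =>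
    (hc.integral_hasStrictDerivAt 0 θ).hasDerivAt
  have hne : cexp (α * T) - 1 ≠ 0 := by
    rw [sub_ne_zero]
    have h1 : (1 : ℝ) < Real.exp (α * T) := Real.one_lt_exp_iff.2 (by positivity)
    exact_mod_cast h1.ne'
  have hJT : ∀ θ, J (θ + T) = J T + cexp (α * T) * J θ := by
    intro θ
    have h1 : ∫ s in T..θ + T, cexp (α * s) * q s = cexp (α * T) * J θ := by
      have h2 := intervalIntegral.integral_comp_add_right (a := 0) (b := θ)
        (fun s : ℝ => cexp (α * s) * q s) T
      rw [zero_add] at h2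
      rw [← h2, hJ, ← intervalIntegral.integral_const_mul]
      refine intervalIntegral.integral_congr fun s _ => ?_
      rw [hper s, ← mul_assoc, ← Complex.exp_add]
      push_cast
      ring_nf
    rw [← h1]
    exact (intervalIntegral.integral_add_adjacent_intervals (hc.intervalIntegrable _ _)
      (hc.intervalIntegrable _ _)).symm
  set c : ℂ := J T / (cexp (α * T) - 1) with hcdef
  have hcT : c + J T = cexp (α * T) * c := by
    have : c * (cexp (α * T) - 1) = J T := div_mul_cancel₀ _ hne
    linear_combination -this
  refine ⟨fun θ => cexp (-(α * θ)) * (c + J θ), fun θ => ?_, fun θ => ?_⟩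
  · simp only
    have h1 : cexp (-(α * ((θ + T : ℝ) : ℂ))) * cexp (α * T) = cexp (-(α * θ)) := by
      rw [← Complex.exp_add]
      push_cast
      ring_nf
    rw [hJT, ← h1]
    linear_combination cexp (-(α * ((θ + T : ℝ) : ℂ))) * hcT
  · have h1 : HasDerivAt (fun t : ℝ => -((α : ℂ) * t)) (-(α * 1)) θ :=
      ((hasDerivAt_id θ).ofReal_comp.const_mul (α : ℂ)).neg
    have h2 := h1.cexp.mul ((hJd θ).const_add c)
    refine h2.congr_deriv ?_
    have h3 : cexp (-(α * θ)) * cexp (α * θ) = 1 := by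
      rw [← Complex.exp_add, neg_add_cancel, Complex.exp_zero]
    linear_combination q θ * h3

/-- A damped linear second-order equation with periodic mean-zero forcing has a periodic
solution. -/
theorem exists_periodic_second_order {α : ℝ} (hα : 0 < α) {h : ℝ → ℂ} (hh : Continuous h)
    (hper : Function.Periodic h (2 * π)) (hmean : modeCoeff h 0 = 0) :
    ∃ u u' : ℝ → ℂ, Function.Periodic u (2 * π) ∧ Function.Periodic u' (2 * π) ∧
      (∀ θ, HasDerivAt u (u' θ) θ) ∧ ∀ θ, HasDerivAt u' (h θ - α * u' θ) θ := by
  set P : ℝ → ℂ := fun θ => ∫ s in 0..θ, h s with hP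
  have hPd : ∀ θ, HasDerivAt P (h θ) θ := fun θ =>
    (hh.integral_hasStrictDerivAt 0 θ).hasDerivAt
  have hPc : Continuous P := continuous_iff_continuousAt.2 fun θ => (hPd θ).continuousAt
  have hPper : Function.Periodic P (2 * π) := by
    intro θ
    have h0 : ∫ s in 0..2 * π, h s = 0 := by
      simpa [modeCoeff, expMode_zero_left] using hmean
    have h1 : ∫ s in θ..θ + 2 * π, h s = 0 := by
      rw [hper.intervalIntegral_add_eq θ 0, zero_add, h0]
    simp only [hP]
    rw [← intervalIntegral.integral_add_adjacent_intervals (hh.intervalIntegrable 0 θ)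
      (hh.intervalIntegrable _ _), h1, add_zero]
  obtain ⟨u, huper, hu⟩ := exists_periodic_hasDerivAt_sub_mul hα Real.two_pi_pos hPc hPper
  refine ⟨u, fun θ => P θ - α * u θ, huper, fun θ => ?_, hu, fun θ => ?_⟩
  · simp only
    rw [hPper, huper]
  · exact (hPd θ).sub ((hu θ).const_mul (α : ℂ))

end Modes

section Existence

open Complex Real

/-- The symbol of `v² ∂² + Γ v ∂ - K Δ_δ` on the Fourier mode `e^{ikθ}`. -/
noncomputable def modeSymbol (Γ K v δ : ℝ) (k : ℤ) : ℂ :=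
  (-(v ^ 2 * k ^ 2) + 2 * K * (1 - Real.cos (k * δ)) : ℝ) + (Γ * v * k : ℝ) * I

theorem exists_inv_norm_modeSymbol_le {Γ K v : ℝ} (hΓ : 0 < Γ) (hK : 0 < K) (hv : 0 < v) (δ : ℝ) :
    ∃ C : ℝ, ∀ k : ℤ, k ≠ 0 →
      modeSymbol Γ K v δ k ≠ 0 ∧ ‖modeSymbol Γ K v δ k‖⁻¹ ≤ C * (1 / (k : ℝ) ^ 2) := by
  refine ⟨(1 + 4 * K / (Γ * v)) / v ^ 2, fun k hk => ?_⟩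
  have hre : (modeSymbol Γ K v δ k).re = -(v ^ 2 * k ^ 2) + 2 * K * (1 - Real.cos (k * δ)) := by
    simp only [modeSymbol, add_re, ofReal_re, re_ofReal_mul, I_re, mul_zero, add_zero]
  have him : (modeSymbol Γ K v δ k).im = Γ * v * k := by
    simp only [modeSymbol, add_im, ofReal_im, im_ofReal_mul, I_im, mul_one, zero_add]
  set l := modeSymbol Γ K v δ k
  have hk1 : (1 : ℝ) ≤ |(k : ℝ)| := by exact_mod_cast Int.one_le_abs hk
  have hΓv : 0 < Γ * v := mul_pos hΓ hv
  have h1 : Γ * v ≤ ‖l‖ := by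
    have := abs_im_le_norm l
    rw [him, abs_mul, abs_of_pos hΓv] at this
    nlinarith
  have h2 : v ^ 2 * (k : ℝ) ^ 2 ≤ ‖l‖ + 4 * K := by
    have h3 := (abs_le.1 (abs_re_le_norm l)).1
    rw [hre] at h3
    nlinarith [Real.neg_one_le_cos (k * δ)]
  have hl : 0 < ‖l‖ := hΓv.trans_le h1
  refine ⟨norm_pos_iff.1 hl, ?_⟩
  have hk2 : (0 : ℝ) < (k : ℝ) ^ 2 := by positivity
  have h4 : 4 * K ≤ 4 * K / (Γ * v) * ‖l‖ := by
    rw [div_mul_eq_mul_div, le_div_iff₀ hΓv]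
    exact mul_le_mul_of_nonneg_left h1 (by positivity)
  rw [div_mul_div_comm, mul_one, inv_eq_one_div, div_le_div_iff₀ hl (by positivity)]
  linarith

theorem modeSymbol_zero (Γ K v δ : ℝ) : modeSymbol Γ K v δ 0 = 0 := by simp [modeSymbol]

theorem summable_inv_norm_modeSymbol {Γ K v : ℝ} (hΓ : 0 < Γ) (hK : 0 < K) (hv : 0 < v) (δ : ℝ) :
    Summable fun k => ‖modeSymbol Γ K v δ k‖⁻¹ := by
  obtain ⟨C, hC⟩ := exists_inv_norm_modeSymbol_le hΓ hK hv δ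
  refine Summable.of_nonneg_of_le (fun k => by positivity) (fun k => ?_)
    (((Real.summable_one_div_int_pow (p := 2)).2 one_lt_two).mul_left C)
  by_cases hk : k = 0
  · simp [hk, modeSymbol_zero]
  · exact (hC k hk).2

/-- Existence of Fourier coefficients solving the waveform equation mode by mode. -/
theorem exists_fourier_solution {Γ K v : ℝ} (hΓ : 0 < Γ) (hK : 0 < K) (hv : 0 < v) (δ : ℝ) :
    ∃ z : ℤ → ℂ, (Summable fun k => ‖z k‖) ∧ z 0 = 0 ∧ ∀ k ≠ 0,
      2 * π * (modeSymbol Γ K v δ k * z k) =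
        -modeCoeff (fun θ => (Real.sin (θ + (∑' j, z j * expMode j θ).re) : ℂ)) k := by
  set a : ℤ → ℝ := fun k => ‖modeSymbol Γ K v δ k‖⁻¹ with ha
  have hsum : Summable a := summable_inv_norm_modeSymbol hΓ hK hv δ
  set S : (ℤ → ℂ) → ℝ → ℂ :=
    fun z θ => (Real.sin (θ + (∑' j, z j * expMode j θ).re) : ℂ) with hS
  have hS1 : ∀ z θ, ‖S z θ‖ ≤ 1 := fun z θ => by
    rw [hS, norm_real]
    exact Real.abs_sin_le_one _
  have hintegrand : ∀ z k θ, ‖expMode (-k) θ * S z θ‖ ≤ 1 := fun z k θ => by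
    rw [norm_mul, norm_expMode, one_mul]
    exact hS1 z θ
  set B : Set (ℤ → ℂ) := Set.univ.pi fun i => Metric.closedBall (0 : ℂ) (a i) with hB
  have hBle : ∀ z ∈ B, ∀ j, ‖z j‖ ≤ a j := fun z hz j => by simpa using hz j (Set.mem_univ j)
  have hterm : ∀ z ∈ B, ∀ j θ, ‖z j * expMode j θ‖ ≤ a j := fun z hz j θ => by
    rw [norm_mul, norm_expMode, mul_one]
    exact hBle z hz j
  have hSθ : ∀ z ∈ B, Continuous (S z) := by
    intro z hz
    have : Continuous fun θ => ∑' j, z j * expMode j θ :=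
      continuous_tsum (fun j => continuous_const.mul (continuous_expMode j)) hsum
        fun j θ => hterm z hz j θ
    simp only [hS]
    fun_prop
  have hSz : ∀ θ, ContinuousOn (fun z => S z θ) B := by
    intro θ
    have : ContinuousOn (fun z : ℤ → ℂ => ∑' j, z j * expMode j θ) B :=
      continuousOn_tsum (fun j => by fun_prop) hsum fun j z hz => hterm z hz j θ
    simp only [hS]
    fun_prop
  have hcoeff : ∀ k, ContinuousOn (fun z => modeCoeff (S z) k) B := by
    intro k
    simp only [modeCoeff, intervalIntegral.integral_of_le Real.two_pi_pos.le]
    refine MeasureTheory.continuousOn_of_dominated (bound := fun _ => 1) (fun z hz => ?_)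
      (fun z _ => Filter.Eventually.of_forall (hintegrand z k)) (MeasureTheory.integrable_const _)
      (Filter.Eventually.of_forall fun θ => continuousOn_const.mul (hSz θ))
    exact ((continuous_expMode _).mul (hSθ z hz)).aestronglyMeasurable
  obtain ⟨z, hza, hz⟩ := exists_fixedPoint_pi_closedBall (a := a) (fun k => by positivity)
    (Φ := fun z k => -(modeCoeff (S z) k / (2 * π)) * (modeSymbol Γ K v δ k)⁻¹)
    (continuousOn_pi.2 fun k => (((hcoeff k).div_const _).neg).mul continuousOn_const) (by
      intro z k
      rw [norm_mul, norm_inv, norm_neg, norm_div]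
      refine mul_le_of_le_one_left (by positivity) ?_
      have h1 : ‖modeCoeff (S z) k‖ ≤ 1 * |2 * π - 0| :=
        intervalIntegral.norm_integral_le_of_norm_le_const fun θ _ => hintegrand z k θ
      have h2 : ‖(2 * π : ℂ)‖ = 2 * π := by
        have : (2 * π : ℂ) = ((2 * π : ℝ) : ℂ) := by push_cast; rfl
        rw [this, norm_real, Real.norm_of_nonneg Real.two_pi_pos.le]
      rw [h2, div_le_one Real.two_pi_pos]
      rwa [sub_zero, one_mul, abs_of_pos Real.two_pi_pos] at h1)
  refine ⟨z, hsum.of_nonneg_of_le (fun _ => norm_nonneg _) hza, ?_, fun k hk => ?_⟩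
  · simpa [ha, modeSymbol_zero] using hza 0
  · obtain ⟨C, hC⟩ := exists_inv_norm_modeSymbol_le hΓ hK hv δ
    have h0 := (hC k hk).1
    have h1 := congrFun hz k
    have hπ : (π : ℂ) ≠ 0 := by exact_mod_cast Real.pi_ne_zero
    have h2 : modeSymbol Γ K v δ k * z k = -(modeCoeff (S z) k / (2 * π)) := by
      rw [← h1]
      field_simp
    rw [h2]
    field_simp
    rfl

/-- The complex form of the periodic part of the waveform equation has a classical solution. -/
theorem exists_complex_profile {Γ K v : ℝ} (hΓ : 0 < Γ) (hK : 0 < K) (hv : 0 < v) (δ : ℝ) :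
    ∃ (μ : ℝ) (g g' g'' : ℝ → ℂ), Function.Periodic g (2 * π) ∧ Function.Periodic g' (2 * π) ∧
      Continuous g'' ∧ (∀ θ, HasDerivAt g (g' θ) θ) ∧ (∀ θ, HasDerivAt g' (g'' θ) θ) ∧
      ∀ θ, v ^ 2 * g'' θ + Γ * v * g' θ + (Real.sin (θ + (g θ).re) : ℂ)
        = μ + K * (g (θ + δ) - 2 * g θ + g (θ - δ)) := by
  obtain ⟨z, hzs, hz0, hz⟩ := exists_fourier_solution hΓ hK hv δ
  set g : ℝ → ℂ := fun θ => ∑' j, z j * expMode j θ with hg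
  have hgc : Continuous g :=
    continuous_tsum (fun j => continuous_const.mul (continuous_expMode j)) hzs
      fun j θ => by rw [norm_mul, norm_expMode, mul_one]
  have hgper : Function.Periodic g (2 * π) := fun θ => by
    simp only [hg, (expMode_periodic _) θ]
  set S : ℝ → ℝ := fun θ => Real.sin (θ + (g θ).re) with hS
  have hSc : Continuous S := by fun_prop
  have hSper : Function.Periodic S (2 * π) := fun θ => by
    simp only [hS]
    rw [hgper, add_right_comm, Real.sin_add_two_pi]
  set μ : ℝ := (∫ θ in 0..2 * π, S θ) / (2 * π) with hμ
  have hshift : ∀ η θ, g (θ + η) = ∑' j, (z j * expMode j η) * expMode j θ := by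
    intro η θ
    simp only [hg, expMode_add_right]
    exact tsum_congr fun j => by ring
  have hcshift : ∀ η k, modeCoeff (fun θ => g (θ + η)) k = 2 * π * (z k * expMode k η) := by
    intro η k
    have : (fun θ => g (θ + η)) = fun θ => ∑' j, (z j * expMode j η) * expMode j θ :=
      funext (hshift η)
    rw [this]
    exact modeCoeff_tsum (by simpa [norm_expMode] using hzs) k
  have hcg : ∀ k, modeCoeff g k = 2 * π * z k := modeCoeff_tsum hzs
  set h : ℝ → ℂ := fun θ => K * (g (θ + δ) - 2 * g θ + g (θ + -δ)) - (S θ - μ) with hh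
  have hhc : Continuous h := by fun_prop
  have hhper : Function.Periodic h (2 * π) := fun θ => by
    simp only [hh]
    rw [add_right_comm θ (2 * π) δ, add_right_comm θ (2 * π) (-δ), hgper, hgper, hgper, hSper]
  have hch : ∀ k, modeCoeff h k = K * (2 * π * (z k * expMode k δ) - 2 * (2 * π * z k)
      + 2 * π * (z k * expMode k (-δ))) - (modeCoeff (fun θ => (S θ : ℂ)) k
      - μ * ∫ θ in 0..2 * π, expMode (-k) θ) := by
    intro k
    rw [← hcshift, ← hcshift, ← hcg]
    simp only [modeCoeff]
    have hc := continuous_expMode (-k)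
    simp only [← intervalIntegral.integral_const_mul]
    rw [← intervalIntegral.integral_sub, ← intervalIntegral.integral_add,
      ← intervalIntegral.integral_sub, ← intervalIntegral.integral_const_mul,
      ← intervalIntegral.integral_sub]
    · refine intervalIntegral.integral_congr fun θ _ => ?_
      simp only [hh]
      ring
    all_goals exact Continuous.intervalIntegrable (by fun_prop) _ _
  have hπ : (π : ℂ) ≠ 0 := by exact_mod_cast Real.pi_ne_zero
  have hch0 : modeCoeff h 0 = 0 := by
    have h1 : modeCoeff (fun θ => (S θ : ℂ)) 0 = 2 * π * μ := by
      simp only [modeCoeff, neg_zero, expMode_zero_left, one_mul, intervalIntegral.integral_ofReal]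
      rw [hμ]
      push_cast
      field_simp
    rw [hch, h1, hz0, integral_expMode]
    simp
    ring
  have hchk : ∀ k ≠ 0, modeCoeff h k
      = 2 * π * z k * (-(v ^ 2 * k ^ 2) + Γ * v * k * I) := by
    intro k hk
    have h1 := hz k hk
    have h2 := expMode_add_expMode_neg k δ
    rw [hch, integral_expMode, if_neg (neg_ne_zero.2 hk)]
    have h3 : modeCoeff (fun θ => (S θ : ℂ)) k = -(2 * π * (modeSymbol Γ K v δ k * z k)) := by
      rw [h1, neg_neg]
    rw [h3, modeSymbol]
    push_cast at h2 ⊢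
    linear_combination (2 * π * z k * K) * h2
  have hv2 : (v : ℂ) ≠ 0 := by exact_mod_cast hv.ne'
  obtain ⟨u, u', huper, hu'per, hu, hu'⟩ := exists_periodic_second_order (α := Γ / v)
    (div_pos hΓ hv) (h := fun θ => ((v : ℂ) ^ 2)⁻¹ * h θ) (by fun_prop)
    (fun θ => by simp only [hhper θ]) (by
      have : modeCoeff (fun θ => ((v : ℂ) ^ 2)⁻¹ * h θ) 0 = ((v : ℂ) ^ 2)⁻¹ * modeCoeff h 0 := by
        simp only [modeCoeff, neg_zero, expMode_zero_left, one_mul,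
          intervalIntegral.integral_const_mul]
      rw [this, hch0, mul_zero])
  set u'' : ℝ → ℂ := fun θ => ((v : ℂ) ^ 2)⁻¹ * h θ - (Γ / v : ℝ) * u' θ with hu''
  have huc : Continuous u := continuous_iff_continuousAt.2 fun θ => (hu θ).continuousAt
  have hu'c : Continuous u' := continuous_iff_continuousAt.2 fun θ => (hu' θ).continuousAt
  have hu''c : Continuous u'' := by fun_prop
  have heq : ∀ θ, v ^ 2 * u'' θ + Γ * v * u' θ = h θ := by
    intro θ
    simp only [hu'']
    push_cast
    field_simp
    ring
  have hcu : ∀ k ≠ 0, modeCoeff u k = 2 * π * z k := by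
    intro k hk
    have h1 := modeCoeff_deriv huper hu hu'c k
    have h2 := modeCoeff_deriv hu'per hu' hu''c k
    have h3 : modeCoeff h k = v ^ 2 * modeCoeff u'' k + Γ * v * modeCoeff u' k := by
      have hc := continuous_expMode (-k)
      simp only [modeCoeff, ← intervalIntegral.integral_const_mul]
      rw [← intervalIntegral.integral_add]
      · refine intervalIntegral.integral_congr fun θ _ => ?_
        simp only [← heq]
        ring
      all_goals exact Continuous.intervalIntegrable (by fun_prop) _ _
    rw [hchk k hk, h2, h1] at h3
    have h4 : (-(v ^ 2 * k ^ 2) + Γ * v * k * I : ℂ) ≠ 0 := by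
      intro h0
      have := congrArg Complex.im h0
      have h5 : (-(v ^ 2 * k ^ 2) + Γ * v * k * I : ℂ)
          = ((-(v ^ 2 * k ^ 2) : ℝ) : ℂ) + ((Γ * v * k : ℝ) : ℂ) * I := by push_cast; ring
      rw [h5] at this
      simp only [add_im, ofReal_im, im_ofReal_mul, I_im, mul_one, zero_add, zero_im] at this
      have hk' : (k : ℝ) ≠ 0 := by exact_mod_cast hk
      exact (mul_ne_zero (mul_ne_zero hΓ.ne' hv.ne') hk') this
    refine mul_right_cancel₀ h4 ?_
    rw [h3]
    linear_combination (-(v ^ 2 * k ^ 2 * modeCoeff u k : ℂ)) * I_sq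
  have hgu : ∀ θ, g θ = u θ + (g 0 - u 0) := by
    intro θ
    have := eq_const_of_modeCoeff_eq_zero (d := fun θ => g θ - u θ) (hgc.sub huc)
      (hgper.sub huper) (fun k hk => by
        have h1 : modeCoeff (fun θ => g θ - u θ) k = modeCoeff g k - modeCoeff u k := by
          have hc := continuous_expMode (-k)
          simp only [modeCoeff, mul_sub]
          exact intervalIntegral.integral_sub
            (Continuous.intervalIntegrable (by fun_prop) _ _)
            (Continuous.intervalIntegrable (by fun_prop) _ _)
        rw [h1, hcg, hcu k hk, sub_self]) θ
    linear_combination this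
  refine ⟨μ, g, u', u'', hgper, hu'per, hu''c, fun θ => ?_, hu', fun θ => ?_⟩
  · exact ((hu θ).add_const (g 0 - u 0)).congr_of_eventuallyEq (Filter.Eventually.of_forall hgu)
  · rw [heq]
    simp only [hh, hS, ← sub_eq_add_neg]
    ring

theorem exists_real_profile {Γ K v : ℝ} (hΓ : 0 < Γ) (hK : 0 < K) (hv : 0 < v) (δ : ℝ) :
    ∃ (μ : ℝ) (G G' G'' : ℝ → ℝ), Function.Periodic G (2 * π) ∧ Function.Periodic G' (2 * π) ∧
      Continuous G'' ∧ (∀ θ, HasDerivAt G (G' θ) θ) ∧ (∀ θ, HasDerivAt G' (G'' θ) θ) ∧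
      ∀ θ, v ^ 2 * G'' θ + Γ * v * G' θ + Real.sin (θ + G θ)
        = μ + K * (G (θ + δ) - 2 * G θ + G (θ - δ)) := by
  obtain ⟨μ, g, g', g'', h1, h2, h3, h4, h5, h6⟩ := exists_complex_profile hΓ hK hv δ
  have hre : ∀ {p : ℝ → ℂ} {p' : ℂ} {θ : ℝ}, HasDerivAt p p' θ →
      HasDerivAt (fun t => (p t).re) p'.re θ := fun hp =>
    (reCLM.hasFDerivAt.comp_hasDerivAt _ hp)
  refine ⟨μ, fun θ => (g θ).re, fun θ => (g' θ).re, fun θ => (g'' θ).re,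
    fun θ => congrArg re (h1 θ), fun θ => congrArg re (h2 θ), continuous_re.comp h3,
    fun θ => hre (h4 θ), fun θ => hre (h5 θ), fun θ => ?_⟩
  have := congrArg re (h6 θ)
  rw [← ofReal_pow, mul_assoc (Γ : ℂ)] at this
  simp only [add_re, sub_re, re_ofReal_mul, ofReal_re] at this
  have h2re : (2 * g θ).re = 2 * (g θ).re := by simp
  rw [h2re] at this
  linarith

/-- Energy balance: the mean force exerted by the substrate is nonnegative. -/
theorem substrate_force_nonneg {Γ K v δ μ : ℝ} (hΓ : 0 < Γ) (hv : 0 < v) {G G' G'' : ℝ → ℝ}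
    (hper : Function.Periodic G (2 * π)) (hper' : Function.Periodic G' (2 * π))
    (hc'' : Continuous G'') (hG : ∀ θ, HasDerivAt G (G' θ) θ)
    (hG' : ∀ θ, HasDerivAt G' (G'' θ) θ)
    (heq : ∀ θ, v ^ 2 * G'' θ + Γ * v * G' θ + Real.sin (θ + G θ)
        = μ + K * (G (θ + δ) - 2 * G θ + G (θ - δ))) : 0 ≤ μ := by
  have hc : Continuous G := continuous_iff_continuousAt.2 fun θ => (hG θ).continuousAt
  have hc' : Continuous G' := continuous_iff_continuousAt.2 fun θ => (hG' θ).continuousAt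
  have hshift : ∀ {q : ℝ → ℝ}, Function.Periodic q (2 * π) → ∀ η : ℝ,
      ∫ θ in 0..2 * π, q (θ + η) = ∫ θ in 0..2 * π, q θ := by
    intro q hq η
    rw [intervalIntegral.integral_comp_add_right, zero_add, add_comm (2 * π) η,
      hq.intervalIntegral_add_eq η 0, zero_add]
  -- The potential part is an exact derivative up to the reversed shift.
  set W : ℝ → ℝ := fun θ => v ^ 2 * (G' θ + G' θ ^ 2 / 2) + Γ * v * G θ - Real.cos (θ + G θ)
    - μ * (θ + G θ) + K * G θ ^ 2 - K * (G θ * G (θ + δ)) with hW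
  set R : ℝ → ℝ := fun θ => G θ * G' (θ + δ) with hR
  have hRper : Function.Periodic R (2 * π) := fun θ => by
    simp only [hR]
    rw [add_right_comm, hper, hper']
  have hWd : ∀ θ, HasDerivAt W (-(Γ * v * G' θ ^ 2) + K * (G (θ + δ) - G θ)
      + K * (G (θ + -δ) - G θ) + K * (R (θ + -δ) - R θ)) θ := by
    intro θ
    have h1 := ((hG' θ).add (((hG' θ).pow 2).div_const 2)).const_mul (v ^ 2)
    have h2 := (hG θ).const_mul (Γ * v)
    have h3 := ((hasDerivAt_id θ).add (hG θ)).cos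
    have h4 := ((hasDerivAt_id θ).add (hG θ)).const_mul μ
    have h5 := ((hG θ).pow 2).const_mul K
    have h6 := ((hG θ).mul ((hG (θ + δ)).comp_add_const θ δ)).const_mul K
    refine (((((h1.add h2).sub h3).sub h4).add h5).sub h6).congr_deriv ?_
    have h7 := heq θ
    simp only [hR, neg_add_cancel_right, sub_eq_add_neg, id_eq, Pi.add_apply] at h7 ⊢
    push_cast
    linear_combination (1 + G' θ) * h7
  have hintegral := intervalIntegral.integral_eq_sub_of_hasDerivAt (a := 0) (b := 2 * π)
    (fun θ _ => hWd θ) (Continuous.intervalIntegrable (by fun_prop) _ _)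
  have hWdiff : W (2 * π) - W 0 = -(μ * (2 * π)) := by
    simp only [hW]
    have h1 : G (2 * π + δ) = G (0 + δ) := by rw [add_comm (2 * π), hper, zero_add]
    rw [h1, hper.eq, hper'.eq, add_comm (2 * π) (G 0), Real.cos_add_two_pi, zero_add]
    ring_nf
  have hval : ∫ θ in 0..2 * π, (-(Γ * v * G' θ ^ 2) + K * (G (θ + δ) - G θ)
      + K * (G (θ + -δ) - G θ) + K * (R (θ + -δ) - R θ))
      = -(Γ * v * ∫ θ in 0..2 * π, G' θ ^ 2) := by
    rw [intervalIntegral.integral_add, intervalIntegral.integral_add,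
      intervalIntegral.integral_add, intervalIntegral.integral_neg]
    · simp only [intervalIntegral.integral_const_mul]
      rw [intervalIntegral.integral_sub, intervalIntegral.integral_sub,
        intervalIntegral.integral_sub, hshift hper, hshift hper, hshift hRper]
      · ring
      all_goals exact Continuous.intervalIntegrable (by fun_prop) _ _
    all_goals exact Continuous.intervalIntegrable (by fun_prop) _ _
  have hnn : 0 ≤ ∫ θ in 0..2 * π, G' θ ^ 2 :=
    intervalIntegral.integral_nonneg Real.two_pi_pos.le fun θ _ => sq_nonneg _
  rw [hval, hWdiff] at hintegral
  have h8 : 0 ≤ Γ * v * ∫ θ in 0..2 * π, G' θ ^ 2 := by positivity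
  have h9 : 0 ≤ μ * (2 * π) := by linarith
  exact nonneg_of_mul_nonneg_left h9 Real.two_pi_pos

end Existence

/-- For every `Γ > 0`, `K > 0` and every prescribed velocity `v > 0`, there exists a
force `F > 0` such that the discrete sine-Gordon ring admits a travelling wave with
velocity `v`. -/
theorem exists_force_of_velocity (n m : ℕ) (hn : 1 ≤ n) (hm : 1 ≤ m)
    (Γ K v : ℝ) (hΓ : 0 < Γ) (hK : 0 < K) (hv : 0 < v) :
    ∃ F : ℝ, 0 < F ∧ ∃ f : ℝ → ℝ, IsWaveform n m Γ K F v f := by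
  obtain ⟨μ, G, G', G'', hper, hper', hc'', hG, hG', heq⟩ :=
    exists_real_profile hΓ hK hv ((m : ℝ) / n * (2 * Real.pi))
  have hμ := substrate_force_nonneg hΓ hv hper hper' hc'' hG hG' heq
  have hlin : ∀ t : ℝ, HasDerivAt (fun t : ℝ => v * t) v t := fun t => by
    simpa using (hasDerivAt_id t).const_mul v
  have hf : ∀ t, HasDerivAt (fun t => v * t + G (v * t)) (v + v * G' (v * t)) t := fun t =>
    ((hlin t).add ((hG (v * t)).comp t (hlin t))).congr_deriv (by ring)
  have hf' : ∀ t, HasDerivAt (fun t => v + v * G' (v * t)) (v ^ 2 * G'' (v * t)) t := fun t =>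
    ((((hG' (v * t)).comp t (hlin t)).const_mul v).const_add v).congr_deriv (by ring)
  have hd : deriv (fun t => v * t + G (v * t)) = fun t => v + v * G' (v * t) :=
    funext fun t => (hf t).deriv
  have hd' : deriv (fun t => v + v * G' (v * t)) = fun t => v ^ 2 * G'' (v * t) :=
    funext fun t => (hf' t).deriv
  refine ⟨Γ * v + μ, by positivity, fun t => v * t + G (v * t), ?_, fun t => ?_, fun t => ?_⟩
  · rw [show (2 : WithTop ℕ∞) = 1 + 1 from one_add_one_eq_two.symm, contDiff_succ_iff_deriv, hd,
      contDiff_one_iff_deriv, hd']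
    refine ⟨fun t => (hf t).differentiableAt, by simp, fun t => (hf' t).differentiableAt, ?_⟩
    fun_prop
  · have h1 : v * (t + 2 * Real.pi / v) = v * t + 2 * Real.pi := by field_simp
    simp only [h1, hper (v * t)]
    ring
  · rw [hd, hd']
    have h1 : v * (t + (m : ℝ) / n * (2 * Real.pi / v))
        = v * t + (m : ℝ) / n * (2 * Real.pi) := by field_simp
    have h2 : v * (t - (m : ℝ) / n * (2 * Real.pi / v))
        = v * t - (m : ℝ) / n * (2 * Real.pi) := by field_simp
    simp only [h1, h2]
    linear_combination heq (v * t)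
end

section
/- For every Γ > 0, K > 0 and every F > 1, there exists a travelling wave of the discrete sine-Gordon ring; that is, there exist a velocity v > 0 and a waveform f satisfying the defining conditions of a travelling wave with this F. -/
section FixedPointTheorems
open Finset

section Scarf
variable {V I α : Type*} [LinearOrder α]

/-- Every point is, for some index `i`, below all points of `A` in the `i`-th order. -/
def Dominates (r : I → V → α) (A : Finset V) : Prop :=
  ∀ t, ∃ i, ∀ a ∈ A, r i t ≤ r i a

theorem Dominates.mono {r : I → V → α} {A B : Finset V} (h : Dominates r B) (hAB : A ⊆ B) :
    Dominates r A := fun t => (h t).imp fun _ hi a ha => hi a (hAB ha)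

variable [DecidableEq V] [Fintype I] [DecidableEq I]

theorem even_card_erase_image_eq (c : V → I) {B : Finset V} (hB : #B = Fintype.card I)
    (hc : B.image c ≠ univ) (i₀ : I) :
    Even #{x ∈ B | (B.erase x).image c = univ.erase i₀} := by
  rcases ({x ∈ B | (B.erase x).image c = univ.erase i₀} : Finset V).eq_empty_or_nonempty
    with h | ⟨x, hx⟩
  · simp [h]
  simp only [mem_filter] at hx
  obtain ⟨hxB, hx⟩ := hx
  have hinj : ∀ z ∈ B, (B.erase z).image c = univ.erase i₀ →
      Set.InjOn c (B.erase z : Finset V) := by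
    intro z hz h
    apply injOn_of_card_image_eq
    rw [h, card_erase_of_mem (mem_univ _), card_erase_of_mem hz, card_univ, hB]
  have hcx : c x ≠ i₀ := by
    rintro rfl
    apply hc
    rw [← insert_erase hxB, image_insert, hx, insert_erase (mem_univ _)]
  obtain ⟨y, hy, hyx⟩ : ∃ y ∈ B.erase x, c y = c x := by
    rw [← mem_image, hx]; simpa using hcx
  have hyx' := ne_of_mem_erase hy
  have hyB := mem_of_mem_erase hy
  suffices ({x ∈ B | (B.erase x).image c = univ.erase i₀} : Finset V) = {x, y} by
    rw [this, card_pair hyx'.symm]; exact even_two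
  ext z
  simp only [mem_filter, mem_insert, mem_singleton]
  constructor
  · rintro ⟨hz, hzi⟩
    by_contra! hne
    exact hyx' (hinj z hz hzi (by simp [hyB, hne.2.symm]) (by simp [hxB, hne.1.symm]) hyx)
  · rintro (rfl | rfl)
    · exact ⟨hxB, hx⟩
    · refine ⟨hyB, hx ▸ ?_⟩
      ext i
      simp only [mem_image, mem_erase]
      constructor
      · rintro ⟨w, ⟨hw, hwB⟩, rfl⟩
        by_cases hwx : w = x
        · exact ⟨z, ⟨hyx', hyB⟩, hwx ▸ hyx⟩
        · exact ⟨w, ⟨hwx, hwB⟩, rfl⟩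
      · rintro ⟨w, ⟨hw, hwB⟩, rfl⟩
        by_cases hwx : w = z
        · exact ⟨x, ⟨hyx'.symm, hxB⟩, hwx ▸ hyx.symm⟩
        · exact ⟨w, ⟨hwx, hwB⟩, rfl⟩

variable [Fintype V]

open Classical in
theorem card_dominates_insert_eq_two {r : I → V → α} (hr : ∀ i, Function.Injective (r i))
    {A : Finset V} (hA : A.Nonempty) (hcard : #A + 1 = Fintype.card I) (hdom : Dominates r A)
    (hne : ∀ k, ∃ t, ∀ i, i ≠ k → ∃ a ∈ A, r i a < r i t) :
    #{x | x ∉ A ∧ Dominates r (insert x A)} = 2 := by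
  choose m hmA hm using fun i => exists_min_image A (r i) hA
  have hsurj : ∀ a ∈ A, ∃ i, m i = a := fun a ha => by
    obtain ⟨i, hi⟩ := hdom a
    exact ⟨i, hr i (le_antisymm (hm i a ha) (hi _ (hmA i)))⟩
  obtain ⟨i₁, -, i₂, -, hne12, heq⟩ : ∃ i ∈ (univ : Finset I),
      ∃ j ∈ (univ : Finset I), i ≠ j ∧ m i = m j :=
    exists_ne_map_eq_of_card_lt_of_maps_to (t := A) (by rw [card_univ]; omega)
      (fun i _ => hmA i)
  -- away from either of the two colliding indices, `m` is a bijection onto `A`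
  have hbij : ∀ k k', k ≠ k' → m k = m k' →
      (∀ a ∈ A, ∃ i, i ≠ k ∧ m i = a) ∧ (∀ i j, i ≠ k → j ≠ k → m i = m j → i = j) := by
    intro k k' hkk hmk
    have hs : ∀ a ∈ A, ∃ i, i ≠ k ∧ m i = a := by
      intro a ha
      obtain ⟨i, hi⟩ := hsurj a ha
      by_cases hik : i = k
      · exact ⟨k', hkk.symm, by rw [← hmk, ← hik, hi]⟩
      · exact ⟨i, hik, hi⟩
    refine ⟨hs, fun i j hi hj hij => ?_⟩
    have himg : (univ.erase k).image m = A := by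
      ext a
      simp only [mem_image, mem_erase, mem_univ, and_true]
      exact ⟨by rintro ⟨i, -, rfl⟩; exact hmA i, fun ha => hs a ha⟩
    have hinj : Set.InjOn m (univ.erase k : Finset I) := by
      apply injOn_of_card_image_eq
      rw [himg, card_erase_of_mem (mem_univ k), card_univ]; omega
    exact hinj (by simp [hi]) (by simp [hj]) hij
  have key : ∀ k, ∃ x, (∀ i, i ≠ k → r i (m i) < r i x) ∧
      ∀ t, (∀ i, i ≠ k → r i (m i) < r i t) → r k t ≤ r k x := by
    intro k
    obtain ⟨x, hx, hmax⟩ := exists_max_image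
      ({t | ∀ i, i ≠ k → r i (m i) < r i t} : Finset V) (r k) (by
        obtain ⟨t, ht⟩ := hne k
        refine ⟨t, mem_filter.2 ⟨mem_univ _, fun i hi => ?_⟩⟩
        obtain ⟨a, ha, hat⟩ := ht i hi
        exact (hm i a ha).trans_lt hat)
    simp only [mem_filter, mem_univ, true_and] at hx hmax
    exact ⟨x, hx, hmax⟩
  have hback : ∀ k k' x, k ≠ k' → m k = m k' → (∀ i, i ≠ k → r i (m i) < r i x) →
      (∀ t, (∀ i, i ≠ k → r i (m i) < r i t) → r k t ≤ r k x) →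
      x ∉ A ∧ Dominates r (insert x A) ∧ r k x ≤ r k (m k) := by
    intro k k' x hkk hmk hx hmax
    have hxk : r k x ≤ r k (m k) := by
      obtain ⟨i, hi⟩ := hdom x
      by_cases hik : i = k
      · exact hik ▸ hi _ (hmA i)
      · exact absurd (hi _ (hmA i)) (hx i hik).not_ge
    refine ⟨fun hxA => ?_, fun t => ?_, hxk⟩
    · obtain ⟨i, hik, rfl⟩ := (hbij k k' hkk hmk).1 x hxA
      exact lt_irrefl _ (hx i hik)
    · by_cases ht : ∀ i, i ≠ k → r i (m i) < r i t
      · refine ⟨k, fun a ha => ?_⟩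
        rcases mem_insert.1 ha with rfl | ha
        · exact hmax t ht
        · exact (hmax t ht).trans (hxk.trans (hm k a ha))
      · push Not at ht
        obtain ⟨i, hik, hi⟩ := ht
        refine ⟨i, fun a ha => ?_⟩
        rcases mem_insert.1 ha with rfl | ha
        · exact hi.trans (hx i hik).le
        · exact hi.trans (hm i a ha)
  obtain ⟨x₁, hx₁, hmax₁⟩ := key i₁
  obtain ⟨x₂, hx₂, hmax₂⟩ := key i₂
  obtain ⟨hA₁, hd₁, -⟩ := hback i₁ i₂ x₁ hne12 heq hx₁ hmax₁
  obtain ⟨hA₂, hd₂, hle₂⟩ := hback i₂ i₁ x₂ hne12.symm heq.symm hx₂ hmax₂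
  rw [card_eq_two]
  refine ⟨x₁, x₂, ?_, ?_⟩
  · rintro rfl
    exact (hx₁ i₂ hne12.symm).not_ge hle₂
  ext x
  simp only [mem_filter, mem_univ, true_and, mem_insert, mem_singleton]
  refine ⟨fun ⟨hxA, hd⟩ => ?_, by rintro (rfl | rfl); exacts [⟨hA₁, hd₁⟩, ⟨hA₂, hd₂⟩]⟩
  obtain ⟨k, hk⟩ := hd x
  have hidx : ∀ a ∈ A, ∃ i, i ≠ k ∧ m i = a ∧ r i a < r i x := by
    intro a ha
    obtain ⟨i, hi⟩ := hd a
    have hlt : r i a < r i x := lt_of_le_of_ne (hi x (mem_insert_self _ _))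
      fun h => hxA (hr i h ▸ ha)
    refine ⟨i, ?_, hr i (le_antisymm (hm i a ha) (hi _ (mem_insert_of_mem (hmA i)))), hlt⟩
    rintro rfl
    exact hlt.not_ge (hk a (mem_insert_of_mem ha))
  have hkcase : k = i₁ ∨ k = i₂ := by
    by_contra! hk12
    obtain ⟨i, hik, him, -⟩ := hidx (m k) (hmA k)
    have e₁ : i = i₁ := by
      by_contra h
      exact hik ((hbij i₁ i₂ hne12 heq).2 i k h hk12.1 him)
    have e₂ : i = i₂ := by
      by_contra h
      exact hik ((hbij i₂ i₁ hne12.symm heq.symm).2 i k h hk12.2 him)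
    exact hne12 (e₁ ▸ e₂)
  have huniq : ∀ k' y, k ≠ k' → m k = m k' → (∀ i, i ≠ k → r i (m i) < r i y) →
      (∀ t, (∀ i, i ≠ k → r i (m i) < r i t) → r k t ≤ r k y) → x = y := by
    intro k' y hkk hmk hy hmax
    have hxM : ∀ i, i ≠ k → r i (m i) < r i x := by
      intro i hik
      obtain ⟨j, hjk, hj, hlt⟩ := hidx (m i) (hmA i)
      exact (hbij k k' hkk hmk).2 j i hjk hik hj ▸ hlt
    refine hr k (le_antisymm (hmax x hxM) ?_)
    obtain ⟨i, hi⟩ := hd y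
    by_cases hik : i = k
    · exact hik ▸ hi x (mem_insert_self _ _)
    · exact absurd (hi _ (mem_insert_of_mem (hmA i))) (hy i hik).not_ge
  rcases hkcase with rfl | rfl
  · exact Or.inl (huniq i₂ x₁ hne12 heq hx₁ hmax₁)
  · exact Or.inr (huniq i₁ x₂ hne12.symm heq.symm hx₂ hmax₂)

open Classical in
theorem card_dominates_insert_slack_eq_one {r : I → V → α} (hr : ∀ i, Function.Injective (r i))
    {S : I → V} (hmin : ∀ i v, r i (S i) ≤ r i v)
    (hlt : ∀ i j v, i ≠ j → v ∉ Set.range S → r i v < r i (S j))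
    (hT : ∃ v, v ∉ Set.range S) (i₀ : I) :
    #{x | x ∉ (univ.erase i₀).image S ∧ Dominates r (insert x ((univ.erase i₀).image S))} = 1 := by
  have hSlt : ∀ i v, v ∉ Set.range S → r i (S i) < r i v := fun i v hv =>
    lt_of_le_of_ne (hmin i v) fun h => hv ⟨i, hr i h⟩
  obtain ⟨v₀, hv₀⟩ := hT
  obtain ⟨x₀, hx₀, hmax⟩ := exists_max_image ({v | v ∉ Set.range S} : Finset V) (r i₀)
    ⟨v₀, by simpa using hv₀⟩
  simp only [mem_filter, mem_univ, true_and] at hx₀ hmax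
  rw [card_eq_one]
  refine ⟨x₀, ?_⟩
  ext x
  simp only [mem_filter, mem_univ, true_and, mem_singleton]
  constructor
  · rintro ⟨hxA, hd⟩
    have hle : ∀ t, t ∉ Set.range S → r i₀ t ≤ r i₀ x := by
      intro t ht
      obtain ⟨i, hi⟩ := hd t
      by_cases hii : i = i₀
      · exact hii ▸ hi x (mem_insert_self _ _)
      · refine absurd (hi (S i) (mem_insert_of_mem (mem_image_of_mem _ (by simp [hii])))) ?_
        exact (hSlt i t ht).not_ge
    have hxS : x ∉ Set.range S := by
      rintro ⟨j, rfl⟩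
      have : j = i₀ := by
        by_contra h
        exact hxA (mem_image_of_mem _ (by simp [h]))
      subst this
      exact (hSlt j v₀ hv₀).not_ge (hle v₀ hv₀)
    exact hr i₀ (le_antisymm (hmax x hxS) (hle x₀ hx₀))
  · rintro rfl
    refine ⟨fun h => ?_, fun t => ?_⟩
    · obtain ⟨j, -, rfl⟩ := mem_image.1 h
      exact hx₀ ⟨j, rfl⟩
    · by_cases ht : t ∈ Set.range S
      · obtain ⟨j, rfl⟩ := ht
        exact ⟨j, fun a _ => hmin j a⟩
      · refine ⟨i₀, fun a ha => ?_⟩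
        rcases mem_insert.1 ha with rfl | ha
        · exact hmax t ht
        · obtain ⟨j, hj, rfl⟩ := mem_image.1 ha
          exact (hlt i₀ j t (Ne.symm (by simpa using hj)) ht).le

/-- Scarf's lemma, in the form with slack points. -/
theorem exists_dominates_image_eq_univ [Nonempty I] {r : I → V → α}
    (hr : ∀ i, Function.Injective (r i))
    {S : I → V} (hmin : ∀ i v, r i (S i) ≤ r i v)
    (hlt : ∀ i j v, i ≠ j → v ∉ Set.range S → r i v < r i (S j))
    (hT : ∃ v, v ∉ Set.range S) (c : V → I) (hc : ∀ i, c (S i) = i) :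
    ∃ B, Dominates r B ∧ B.image c = univ := by
  classical
  by_contra! hcon
  obtain ⟨i₀⟩ := ‹Nonempty I›
  have hI : 0 < Fintype.card I := Fintype.card_pos_iff.2 ⟨i₀⟩
  let D : Finset (Finset V) :=
    {A | Dominates r A ∧ #A + 1 = Fintype.card I ∧ A.image c = univ.erase i₀}
  let R : Finset (Finset V) := {B | Dominates r B ∧ #B = Fintype.card I}
  have hcount := sum_card_bipartiteAbove_eq_sum_card_bipartiteBelow
    (s := D) (t := R) (fun A B : Finset V => A ⊆ B)
  have hR : Even (∑ B ∈ R, #(D.bipartiteBelow (fun A B : Finset V => A ⊆ B) B)) := by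
    refine even_sum _ fun B hB => ?_
    simp only [R, mem_filter, mem_univ, true_and] at hB
    have : D.bipartiteBelow (fun A B : Finset V => A ⊆ B) B =
        ({x ∈ B | (B.erase x).image c = univ.erase i₀} : Finset V).image (B.erase ·) := by
      ext A
      simp only [mem_bipartiteBelow, D, mem_filter, mem_univ, true_and, mem_image]
      constructor
      · rintro ⟨⟨hA, hAc, hAi⟩, hAB⟩
        obtain ⟨x, hx⟩ : ∃ x, B \ A = {x} := by
          rw [← card_eq_one, card_sdiff_of_subset hAB]; omega
        have hAe : B.erase x = A := by
          rw [erase_eq, ← hx, Finset.sdiff_sdiff_eq_self hAB]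
        have hxB : x ∈ B := (mem_sdiff.1 (hx ▸ mem_singleton_self x : x ∈ B \ A)).1
        exact ⟨x, ⟨hxB, hAe ▸ hAi⟩, hAe⟩
      · rintro ⟨x, ⟨hxB, hx⟩, rfl⟩
        exact ⟨⟨hB.1.mono (erase_subset _ _), by rw [card_erase_of_mem hxB]; omega, hx⟩,
          erase_subset _ _⟩
    rw [this, card_image_of_injOn]
    · exact even_card_erase_image_eq c hB.2 (hcon B hB.1) i₀
    · exact (erase_injOn B).mono fun x hx => (mem_filter.1 hx).1
  have hAbove : ∀ A ∈ D, #(R.bipartiteAbove (fun A B : Finset V => A ⊆ B) A) =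
      #{x | x ∉ A ∧ Dominates r (insert x A)} := by
    intro A hA
    simp only [D, mem_filter, mem_univ, true_and] at hA
    have : R.bipartiteAbove (fun A B : Finset V => A ⊆ B) A =
        ({x | x ∉ A ∧ Dominates r (insert x A)} : Finset V).image (insert · A) := by
      ext B
      simp only [mem_bipartiteAbove, R, mem_filter, mem_univ, true_and, mem_image]
      constructor
      · rintro ⟨⟨hB, hBc⟩, hAB⟩
        obtain ⟨x, hx⟩ : ∃ x, B \ A = {x} := by
          rw [← card_eq_one, card_sdiff_of_subset hAB]; omega
        have hxA : x ∉ A := (mem_sdiff.1 (hx ▸ mem_singleton_self x : x ∈ B \ A)).2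
        have hAe : insert x A = B := by
          rw [insert_eq, ← hx, sdiff_union_of_subset hAB]
        exact ⟨x, ⟨hxA, hAe ▸ hB⟩, hAe⟩
      · rintro ⟨x, ⟨hxA, hx⟩, rfl⟩
        exact ⟨⟨hx, by rw [card_insert_of_notMem hxA]; omega⟩, subset_insert _ _⟩
    rw [this, card_image_of_injOn]
    intro x hx y hy hxy
    simp only [coe_filter, mem_univ, true_and, Set.mem_ofPred_eq] at hx hy
    have : x ∈ insert y A := by
      rw [← show insert x A = insert y A from hxy]
      exact mem_insert_self _ _
    exact (mem_insert.1 this).resolve_right hx.1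
  have hSinj : Function.Injective S := fun i j h => by rw [← hc i, h, hc]
  have hA₀ : (univ.erase i₀).image S ∈ D := by
    simp only [D, mem_filter, mem_univ, true_and]
    refine ⟨?_, ?_, ?_⟩
    · obtain ⟨x, hx⟩ := card_pos.1 ((card_dominates_insert_slack_eq_one hr hmin hlt hT i₀).symm ▸
        Nat.one_pos)
      exact (mem_filter.1 hx).2.2.mono (subset_insert _ _)
    · rw [card_image_of_injective _ hSinj, card_erase_of_mem (mem_univ _), card_univ]; omega
    · rw [image_image, show c ∘ S = id from funext hc, image_id]
  have hD : ¬ Even (∑ A ∈ D, #(R.bipartiteAbove (fun A B : Finset V => A ⊆ B) A)) := by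
    rw [← add_sum_erase D _ hA₀, hAbove _ hA₀,
      card_dominates_insert_slack_eq_one hr hmin hlt hT i₀, add_comm, Nat.even_add_one, not_not]
    refine even_sum _ fun A hA => ?_
    obtain ⟨hA0, hAD⟩ := mem_erase.1 hA
    rw [hAbove A hAD]
    simp only [D, mem_filter, mem_univ, true_and] at hAD
    obtain ⟨hdom, hcard, himg⟩ := hAD
    obtain ⟨a, ha, haS⟩ : ∃ a ∈ A, a ∉ Set.range S := by
      by_contra! hall
      refine hA0 (eq_of_subset_of_card_le (fun a ha => ?_) ?_)
      · obtain ⟨j, rfl⟩ := hall a ha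
        have : c (S j) ∈ univ.erase i₀ := himg ▸ mem_image_of_mem c ha
        exact mem_image_of_mem _ (by rwa [hc] at this)
      · rw [card_image_of_injective _ hSinj, card_erase_of_mem (mem_univ _), card_univ]; omega
    rw [card_dominates_insert_eq_two hr ⟨a, ha⟩ hcard hdom
      fun k => ⟨S k, fun i hi => ⟨a, ha, hlt i k a hi haS⟩⟩]
    exact even_two
  exact hD (hcount ▸ hR)

end Scarf

/-- Scarf's lemma for finitely many coloured points with real coordinates. -/
theorem exists_rainbow_dominating {T I : Type*} [Finite T] [Nonempty T] [Finite I] [Nonempty I]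
    (x : T → I → ℝ) (c : T → I) :
    ∃ C : Finset I, ∃ s : I → T, (∀ i ∈ C, c (s i) = i) ∧
      ∀ t, ∃ i ∈ C, ∀ j ∈ C, x t i ≤ x (s j) i := by
  classical
  have := Fintype.ofFinite T
  have := Fintype.ofFinite I
  let r : I → T ⊕ I → ℕ ×ₗ ℝ ×ₗ ℕ := fun i v => v.elim
    (fun t => toLex (1, toLex (x t i, (Fintype.equivFin T t : ℕ))))
    (fun j => if j = i then toLex (0, toLex (0, 0))
      else toLex (2, toLex (0, (Fintype.equivFin I j : ℕ))))
  have hr : ∀ i, Function.Injective (r i) := by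
    rintro i (t | j) (t' | j') h
    · simp only [r, Sum.elim_inl, EmbeddingLike.apply_eq_iff_eq, Prod.mk.injEq] at h
      exact congrArg _ ((Fintype.equivFin T).injective (Fin.ext h.2.2))
    · simp only [r, Sum.elim_inl, Sum.elim_inr] at h
      split_ifs at h <;> simp at h
    · simp only [r, Sum.elim_inl, Sum.elim_inr] at h
      split_ifs at h <;> simp at h
    · simp only [r, Sum.elim_inr] at h
      split_ifs at h with h₁ h₂ h₂
      · rw [h₁, h₂]
      · simp at h
      · simp at h
      · simp only [EmbeddingLike.apply_eq_iff_eq, Prod.mk.injEq] at h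
        exact congrArg _ ((Fintype.equivFin I).injective (Fin.ext h.2.2))
  have hslack : ∀ i v, r i (Sum.inr i) ≤ r i v := by
    rintro i (t | j)
    · simp [r, Prod.Lex.toLex_le_toLex]
    · simp only [r, Sum.elim_inr, if_true]
      split_ifs
      · exact le_rfl
      · simp [Prod.Lex.toLex_le_toLex]
  have hlt : ∀ i j v, i ≠ j → v ∉ Set.range (Sum.inr : I → T ⊕ I) →
      r i v < r i (Sum.inr j) := by
    rintro i j (t | k) hij hv
    · simp [r, hij.symm, Prod.Lex.toLex_lt_toLex]
    · exact absurd ⟨k, rfl⟩ hv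
  have hle : ∀ i t t', r i (Sum.inl t) ≤ r i (Sum.inl t') → x t i ≤ x t' i := by
    intro i t t' h
    simp only [r, Sum.elim_inl, Prod.Lex.toLex_le_toLex, lt_irrefl, false_or, true_and] at h
    exact h.elim le_of_lt fun h => h.1.le
  obtain ⟨B, hB, hBc⟩ := exists_dominates_image_eq_univ hr hslack hlt
    ⟨Sum.inl (Classical.arbitrary T), by simp⟩ (Sum.elim c id) fun _ => rfl
  have hs : ∀ i, ∃ t, Sum.inr i ∉ B → Sum.inl t ∈ B ∧ c t = i := by
    intro i
    by_cases hi : Sum.inr i ∈ B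
    · exact ⟨Classical.arbitrary T, fun h => absurd hi h⟩
    obtain ⟨t | j, hv, hvi⟩ := mem_image.1 (hBc ▸ mem_univ i)
    · exact ⟨t, fun _ => ⟨hv, hvi⟩⟩
    · obtain rfl : j = i := hvi
      exact absurd hv hi
  choose s hs using hs
  refine ⟨({i | Sum.inr i ∉ B} : Finset I), s, fun i hi => (hs i (by simpa using hi)).2,
    fun t => ?_⟩
  obtain ⟨i, hi⟩ := hB (Sum.inl t)
  refine ⟨i, mem_filter.2 ⟨mem_univ _, fun hiB => ?_⟩, fun j hj => hle _ _ _ (hi _ (hs j ?_).1)⟩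
  · have h := hi _ hiB
    simp [r, Prod.Lex.toLex_le_toLex] at h
  · simpa using hj

section FixedPoint

/-- **Brouwer's fixed point theorem** for the standard simplex. -/
theorem exists_isFixedPt_stdSimplex {ι : Type*} [Fintype ι] [Nonempty ι]
    {f : stdSimplex ℝ ι → stdSimplex ℝ ι} (hf : Continuous f) : ∃ x, f x = x := by
  classical
  let g : stdSimplex ℝ ι → ℝ := fun x => ∑ i, |f x i - x i|
  have hcoe : ∀ i, Continuous fun x : stdSimplex ℝ ι => x i := fun i =>
    (continuous_apply i).comp continuous_subtype_val
  have hg : Continuous g := continuous_finsetSum _ fun i _ =>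
    (((hcoe i).comp hf).sub (hcoe i)).abs
  have hcpt : CompactSpace (stdSimplex ℝ ι) := inferInstance
  have hne : Nonempty (stdSimplex ℝ ι) := inferInstance
  obtain ⟨p, -, hp⟩ := isCompact_univ.exists_isMinOn (Set.univ_nonempty) hg.continuousOn
  suffices h : ∀ η > 0, ∃ x, g x ≤ η by
    have h0 : g p ≤ 0 := le_of_forall_pos_le_add fun η hη => by
      obtain ⟨x, hx⟩ := h η hη
      have : g p ≤ g x := hp (Set.mem_univ x)
      linarith
    refine ⟨p, Subtype.ext (funext fun i => ?_)⟩
    have h1 : |f p i - p i| ≤ g p :=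
      single_le_sum (f := fun i => |f p i - p i|) (fun _ _ => abs_nonneg _) (mem_univ i)
    exact sub_eq_zero.1 (abs_eq_zero.1 (le_antisymm (h1.trans h0) (abs_nonneg _)))
  have hsum : ∀ x : stdSimplex ℝ ι, ∑ i, x i = 1 := fun x => x.2.2
  have hnn : ∀ (x : stdSimplex ℝ ι) i, 0 ≤ x i := fun x => x.2.1
  have hcol : ∀ x : stdSimplex ℝ ι, ∃ i, x i ≤ f x i := by
    intro x
    by_contra! h
    have := sum_lt_sum_of_nonempty univ_nonempty fun i _ => h i
    rw [hsum, hsum] at this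
    exact lt_irrefl _ this
  choose c hc using hcol
  intro η hη
  set n : ℝ := (Fintype.card ι : ℝ) with hn
  have hn1 : 1 ≤ n := Nat.one_le_cast.2 (Nat.succ_le_of_lt (Fintype.card_pos (α := ι)))
  -- a bound on `x i - f x i` from above suffices
  suffices h : ∃ x : stdSimplex ℝ ι, ∀ i, x i - f x i ≤ η / (2 * n) by
    obtain ⟨x, hx⟩ := h
    refine ⟨x, ?_⟩
    have h1 : ∀ i, |f x i - x i| ≤ (f x i - x i) + 2 * (η / (2 * n)) := by
      intro i
      have h0 : 0 ≤ η / (2 * n) := by positivity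
      rw [abs_le]; constructor <;> linarith [hx i]
    calc g x ≤ ∑ i, ((f x i - x i) + 2 * (η / (2 * n))) := sum_le_sum fun i _ => h1 i
      _ = η := by
        rw [sum_add_distrib, sum_sub_distrib, hsum, hsum, sum_const, card_univ, nsmul_eq_mul, ← hn]
        field_simp
        ring
  set η' := η / (2 * n) with hη'
  have hη'0 : 0 < η' := by positivity
  obtain ⟨δ, hδ, hδf⟩ := Metric.uniformContinuous_iff.1
    (CompactSpace.uniformContinuous_of_continuous hf) (η' / 2) (by positivity)
  have hdist : ∀ (x y : stdSimplex ℝ ι) i, |x i - y i| ≤ dist x y := fun x y i => by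
    rw [← Real.dist_eq]; exact dist_le_pi_dist (x : ι → ℝ) y i
  obtain ⟨ε, hε, hεδ, hεη⟩ : ∃ ε : ℝ, 0 < ε ∧ 2 * ε < δ ∧ 2 * ε ≤ η' / 2 :=
    ⟨min (δ / 4) (η' / 4), by positivity, by linarith [min_le_left (δ / 4) (η' / 4)],
      by linarith [min_le_right (δ / 4) (η' / 4)]⟩
  obtain ⟨t, -, htfin, ht⟩ := (isCompact_univ (X := stdSimplex ℝ ι)).finite_cover_balls
    (show 0 < ε / n by positivity)
  have hnear : ∀ x, ∃ y ∈ t, dist x y < ε / n := fun x => by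
    simpa using ht (Set.mem_univ x)
  have : Finite t := htfin
  have : Nonempty t := by
    obtain ⟨y, hy, -⟩ := hnear (Classical.arbitrary _)
    exact ⟨⟨y, hy⟩⟩
  obtain ⟨C, s, hs, hdom⟩ := exists_rainbow_dominating (fun (y : t) i => y.1 i) fun y => c y.1
  obtain ⟨i₀, hi₀, -⟩ := hdom (Classical.arbitrary t)
  have hμ : ∀ i, ∃ μ : ℝ, (∀ j ∈ C, μ ≤ (s j).1 i) ∧ (i ∈ C → ∃ j ∈ C, μ = (s j).1 i) ∧
      0 ≤ μ ∧ (i ∉ C → μ = 0) := by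
    intro i
    by_cases hi : i ∈ C
    · obtain ⟨j, hj, hmin⟩ := exists_min_image C (fun j => (s j).1 i) ⟨i, hi⟩
      exact ⟨_, hmin, fun _ => ⟨j, hj, rfl⟩, hnn _ _, fun h => absurd hi h⟩
    · exact ⟨0, fun j _ => hnn _ _, fun h => absurd h hi, le_rfl, fun _ => rfl⟩
  choose μ hμle hμeq hμ0 hμC using hμ
  have hμ1 : ∑ i, μ i ≤ 1 := (hsum (s i₀).1) ▸ sum_le_sum fun i _ => hμle i i₀ hi₀
  have hμε : 1 - ε < ∑ i, μ i := by
    by_contra! hle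
    obtain ⟨y, hy, hyd⟩ := hnear ⟨fun i => μ i + (1 - ∑ i, μ i) / n,
      fun i => add_nonneg (hμ0 i) (div_nonneg (by linarith) (by linarith)), by
        rw [sum_add_distrib, sum_const, card_univ, nsmul_eq_mul, ← hn]
        field_simp
        ring⟩
    obtain ⟨i, hiC, hi⟩ := hdom ⟨y, hy⟩
    obtain ⟨j, hj, hji⟩ := hμeq i hiC
    have h1 := (hdist _ y i).trans_lt hyd
    have h2 : ε / n ≤ (1 - ∑ i, μ i) / n := by gcongr; linarith
    have h3 := (abs_lt.1 h1).2
    have h4 : μ i + (1 - ∑ i, μ i) / n - y i < ε / n := h3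
    have h5 := hi j hj
    simp only at h5
    linarith
  have hsμ : ∀ j ∈ C, ∀ i, (s j).1 i ≤ μ i + ε := by
    intro j hj i
    have h1 : (s j).1 i - μ i ≤ ∑ i, ((s j).1 i - μ i) :=
      single_le_sum (f := fun i => (s j).1 i - μ i) (fun i _ => sub_nonneg.2 (hμle i j hj))
        (mem_univ i)
    rw [sum_sub_distrib, hsum] at h1
    linarith
  refine ⟨(s i₀).1, fun i => ?_⟩
  by_cases hi : i ∈ C
  · have hd : dist (s i).1 (s i₀).1 < δ := by
      refine lt_of_le_of_lt ((dist_pi_le_iff hε.le).2 fun k => ?_) (by linarith : ε < δ)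
      rw [Real.dist_eq, abs_le]
      have h1 := hsμ i hi k
      have h2 := hsμ i₀ hi₀ k
      have h3 := hμle k i hi
      have h4 := hμle k i₀ hi₀
      constructor
      · change -ε ≤ (s i).1 k - (s i₀).1 k
        linarith
      · change (s i).1 k - (s i₀).1 k ≤ ε
        linarith
    have h1 := (abs_lt.1 ((hdist _ _ i).trans_lt (hδf hd))).2
    have h2 := hc (s i).1
    rw [hs i hi] at h2
    linarith [hsμ i₀ hi₀ i, hμle i i hi]
  · have h1 := hsμ i₀ hi₀ i
    rw [hμC i hi] at h1
    linarith [hnn (f (s i₀).1) i]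

/-- **Schauder's fixed point theorem** for compact convex sets. -/
theorem IsCompact.exists_isFixedPt_of_convex {E : Type*} [NormedAddCommGroup E] [NormedSpace ℝ E]
    {K : Set E} (hK : IsCompact K) (hconv : Convex ℝ K) (hne : K.Nonempty) {f : E → E}
    (hf : ContinuousOn f K) (hmaps : Set.MapsTo f K K) : ∃ x ∈ K, f x = x := by
  obtain ⟨p, hpK, hp⟩ := hK.exists_isMinOn hne
    (f := fun x => dist (f x) x) (continuous_dist.comp_continuousOn (hf.prodMk continuousOn_id))
  refine ⟨p, hpK, dist_le_zero.1 (le_of_forall_pos_le_add fun ε hε => ?_)⟩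
  suffices h : ∃ x ∈ K, dist (f x) x ≤ ε by
    obtain ⟨x, hxK, hx⟩ := h
    have : dist (f p) p ≤ dist (f x) x := hp hxK
    linarith
  obtain ⟨t, htK, htfin, ht⟩ := hK.finite_cover_balls hε
  have := htfin.fintype
  have hnear : ∀ x ∈ K, ∃ y : t, dist x y < ε := fun x hx => by
    simpa using ht hx
  have : Nonempty t := (hnear _ hne.some_mem).nonempty
  have hφpos : ∀ x ∈ K, 0 < ∑ y : t, max 0 (ε - dist x y) := by
    intro x hx
    obtain ⟨y, hy⟩ := hnear x hx
    exact sum_pos' (fun _ _ => le_max_left _ _) ⟨y, mem_univ _, lt_max_of_lt_right (by linarith)⟩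
  let e : stdSimplex ℝ t → E := fun w => ∑ y : t, w y • (y : E)
  have heK : ∀ w, e w ∈ K := fun w =>
    hconv.sum_mem (fun y _ => w.2.1 y) w.2.2 fun y _ => htK y.2
  have hcoe : ∀ y, Continuous fun w : stdSimplex ℝ t => w y := fun y =>
    (continuous_apply y).comp continuous_subtype_val
  have he : Continuous e := continuous_finsetSum _ fun y _ => (hcoe y).smul continuous_const
  have hfe : Continuous fun w => f (e w) := hf.comp_continuous he heK
  have hfeK : ∀ w, f (e w) ∈ K := fun w => hmaps (heK w)
  let g : stdSimplex ℝ t → stdSimplex ℝ t := fun w =>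
    ⟨fun y => max 0 (ε - dist (f (e w)) y) / ∑ y : t, max 0 (ε - dist (f (e w)) y),
      fun y => div_nonneg (le_max_left _ _) (hφpos _ (hfeK w)).le, by
        rw [← sum_div, div_self (hφpos _ (hfeK w)).ne']⟩
  have hφ : ∀ y : t, Continuous fun w => max 0 (ε - dist (f (e w)) y) := fun y =>
    continuous_const.max (continuous_const.sub (hfe.dist continuous_const))
  have hg : Continuous g := Continuous.subtype_mk (continuous_pi fun y =>
    (hφ y).div (continuous_finsetSum _ fun y _ => hφ y) fun w => (hφpos _ (hfeK w)).ne') _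
  obtain ⟨w, hw⟩ := exists_isFixedPt_stdSimplex hg
  refine ⟨e w, heK w, ?_⟩
  have hball : e w ∈ Metric.closedBall (f (e w)) ε := by
    have hew : ∑ y : t with w y ≠ 0, w y • (y : E) = e w :=
      sum_filter_of_ne fun y _ h hy => h (by rw [hy, zero_smul])
    rw [← hew]
    refine (convex_closedBall _ _).sum_mem (fun y _ => w.2.1 y) ?_ fun y hy => ?_
    · rw [sum_filter_ne_zero]; exact w.2.2
    · have hwy : w y ≠ 0 := (mem_filter.1 hy).2
      rw [← hw] at hwy
      have hmax : max 0 (ε - dist (f (e w)) y) ≠ 0 := fun h => hwy (by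
        change max 0 (ε - dist (f (e w)) y) / _ = 0
        rw [h, zero_div])
      rw [Metric.mem_closedBall, dist_comm]
      rw [hew]
      by_contra! hlt
      exact hmax (max_eq_left (by linarith))
  rwa [Metric.mem_closedBall, dist_comm] at hball

end FixedPoint

end FixedPointTheorems

section CircleFunSection
open Real MeasureTheory intervalIntegral

instance fact_two_pi_pos : Fact (0 < 2 * π) := ⟨two_pi_pos⟩

/-- Continuous real functions on the circle `ℝ / 2πℤ`, with the sup norm. -/
abbrev CircleFun := BoundedContinuousFunction (AddCircle (2 * π)) ℝ

namespace CircleFun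

theorem continuous_comp_coe (q : CircleFun) : Continuous fun x : ℝ => q x :=
  q.continuous.comp (AddCircle.continuous_mk' _)

theorem periodic (q : CircleFun) : Function.Periodic (fun x : ℝ => q x) (2 * π) := fun x => by
  simp

theorem intervalIntegrable (q : CircleFun) (a b : ℝ) :
    IntervalIntegrable (fun x : ℝ => q x) volume a b :=
  q.continuous_comp_coe.intervalIntegrable a b

/-- The function on the circle induced by a continuous periodic function. -/
noncomputable def ofPeriodic (h : ℝ → ℝ) (hc : Continuous h) (hp : Function.Periodic h (2 * π)) :
    CircleFun :=
  BoundedContinuousFunction.mkOfCompact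
    ⟨hp.lift, continuous_quot_lift _ hc⟩

theorem norm_le_of_forall_coe {q : CircleFun} {C : ℝ} (hC : 0 ≤ C) (h : ∀ x : ℝ, |q x| ≤ C) :
    ‖q‖ ≤ C := by
  refine (BoundedContinuousFunction.norm_le hC).2 fun x => ?_
  induction x using QuotientAddGroup.induction_on with
  | H x => exact h x

theorem abs_apply_le (q : CircleFun) (x : AddCircle (2 * π)) : |q x| ≤ ‖q‖ :=
  q.norm_coe_le_norm x

theorem abs_integral_div_le (q : CircleFun) :
    |(∫ x in 0..2 * π, q (x : ℝ)) / (2 * π)| ≤ ‖q‖ := by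
  have h := norm_integral_le_of_norm_le_const (a := 0) (b := 2 * π) (f := fun x : ℝ => q x)
    (C := ‖q‖) fun x _ => q.abs_apply_le x
  rw [sub_zero, abs_of_pos two_pi_pos] at h
  rw [abs_div, abs_of_pos two_pi_pos]
  exact (div_le_iff₀ two_pi_pos).2 h

/-- The mean value. -/
noncomputable def mean : CircleFun →L[ℝ] ℝ :=
  LinearMap.mkContinuous
    { toFun := fun q => (∫ x in 0..2 * π, q (x : ℝ)) / (2 * π)
      map_add' := fun p q => by
        simp only [BoundedContinuousFunction.add_apply]
        rw [integral_add (p.intervalIntegrable _ _) (q.intervalIntegrable _ _), add_div]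
      map_smul' := fun c q => by
        simp [mul_div_assoc] } 1 fun q => by
    rw [one_mul]; exact q.abs_integral_div_le

theorem mean_apply (q : CircleFun) : mean q = (∫ x in 0..2 * π, q (x : ℝ)) / (2 * π) := rfl

theorem abs_mean_le (q : CircleFun) : |mean q| ≤ ‖q‖ := q.abs_integral_div_le

theorem abs_sub_mean_le (q : CircleFun) (x : ℝ) : |q x - mean q| ≤ 2 * ‖q‖ := by
  have h₁ := abs_le.1 (q.abs_apply_le x)
  have h₂ := abs_le.1 q.abs_mean_le
  rw [abs_le]; constructor <;> linarith

theorem continuous_sub_mean (q : CircleFun) : Continuous fun x : ℝ => q x - mean q :=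
  q.continuous_comp_coe.sub continuous_const

theorem integral_sub_mean (q : CircleFun) : ∫ x in 0..2 * π, (q (x : ℝ) - mean q) = 0 := by
  rw [integral_sub (q.intervalIntegrable _ _) (by simp), intervalIntegral.integral_const,
    mean_apply, sub_zero,
    smul_eq_mul, mul_div_cancel₀ _ two_pi_pos.ne', sub_self]

/-- The primitive, vanishing at `0`, of `q` minus its mean value. -/
noncomputable def primFun (q : CircleFun) : CircleFun :=
  ofPeriodic (fun x => ∫ s in 0..x, (q (s : ℝ) - mean q))
    (continuous_primitive (fun a b => q.continuous_sub_mean.intervalIntegrable a b) 0) fun x => by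
      beta_reduce
      rw [← integral_add_adjacent_intervals (q.continuous_sub_mean.intervalIntegrable 0 x)
        (q.continuous_sub_mean.intervalIntegrable x _)]
      have hper : Function.Periodic (fun s : ℝ => q s - mean q) (2 * π) := fun s => by simp
      rw [hper.intervalIntegral_add_eq x 0, zero_add, integral_sub_mean, add_zero]

theorem primFun_apply (q : CircleFun) (x : ℝ) :
    primFun q x = ∫ s in 0..x, (q (s : ℝ) - mean q) := rfl

theorem hasDerivAt_primFun (q : CircleFun) (x : ℝ) :
    HasDerivAt (fun x : ℝ => primFun q x) (q x - mean q) x :=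
  q.continuous_sub_mean.integral_hasStrictDerivAt 0 x |>.hasDerivAt

theorem primFun_zero (q : CircleFun) : primFun q (0 : ℝ) = 0 := by
  rw [primFun_apply, integral_same]

theorem abs_primFun_sub_le (q : CircleFun) (x y : ℝ) :
    |primFun q x - primFun q y| ≤ 2 * ‖q‖ * |x - y| := by
  rw [primFun_apply, primFun_apply, integral_interval_sub_left
    (q.continuous_sub_mean.intervalIntegrable _ _) (q.continuous_sub_mean.intervalIntegrable _ _)]
  rw [← Real.norm_eq_abs]
  exact norm_integral_le_of_norm_le_const fun s _ => q.abs_sub_mean_le s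

theorem norm_primFun_le (q : CircleFun) : ‖primFun q‖ ≤ 4 * π * ‖q‖ := by
  refine norm_le_of_forall_coe (by positivity) fun x => ?_
  obtain ⟨y, ⟨hy₀, hy⟩, hxy⟩ := (primFun q).periodic.exists_mem_Ico₀ two_pi_pos x
  have h := abs_primFun_sub_le q y 0
  rw [primFun_zero, sub_zero, sub_zero, abs_of_nonneg hy₀, ← hxy] at h
  nlinarith [norm_nonneg q]

/-- `primFun` as a continuous linear map. -/
noncomputable def prim : CircleFun →L[ℝ] CircleFun :=
  LinearMap.mkContinuous
    { toFun := primFun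
      map_add' := fun p q => by
        ext x
        induction x using QuotientAddGroup.induction_on with
        | H x =>
          change primFun (p + q) (x : ℝ) = primFun p (x : ℝ) + primFun q (x : ℝ)
          rw [primFun_apply, primFun_apply, primFun_apply,
            ← integral_add (p.continuous_sub_mean.intervalIntegrable _ _)
              (q.continuous_sub_mean.intervalIntegrable _ _)]
          refine integral_congr fun s _ => ?_
          simp only [BoundedContinuousFunction.add_apply, map_add]
          ring
      map_smul' := fun c q => by
        ext x
        induction x using QuotientAddGroup.induction_on with
        | H x =>
          change primFun (c • q) (x : ℝ) = c * primFun q (x : ℝ)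
          rw [primFun_apply, primFun_apply, ← intervalIntegral.integral_const_mul]
          refine integral_congr fun s _ => ?_
          simp only [BoundedContinuousFunction.smul_apply, map_smul, smul_eq_mul]
          ring }
    (4 * π) norm_primFun_le

theorem prim_apply (q : CircleFun) : prim q = primFun q := rfl

/-- The nonlinearity `x ↦ sin (x + u x)`. -/
noncomputable def sinShift (u : CircleFun) : CircleFun :=
  BoundedContinuousFunction.mkOfCompact
    ⟨fun x : AddCircle (2 * π) => Angle.sin ((show Angle from x) + (u x : Angle)),
      Angle.continuous_sin.comp
        (continuous_id.add (Angle.continuous_coe.comp u.continuous))⟩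

theorem sinShift_apply (u : CircleFun) (x : ℝ) : sinShift u x = sin (x + u x) := by
  change Angle.sin ((x : Angle) + (u x : Angle)) = _
  rw [← Angle.coe_add, Angle.sin_coe]

theorem norm_sinShift_le (u : CircleFun) : ‖sinShift u‖ ≤ 1 :=
  norm_le_of_forall_coe zero_le_one fun x => by
    rw [sinShift_apply]; exact abs_sin_le_one _

theorem continuous_sinShift : Continuous sinShift := by
  refine (LipschitzWith.of_dist_le_mul (K := 1) fun u w => ?_).continuous
  rw [NNReal.coe_one, one_mul, dist_eq_norm]
  refine norm_le_of_forall_coe dist_nonneg fun x => ?_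
  rw [BoundedContinuousFunction.sub_apply, sinShift_apply, sinShift_apply]
  refine (abs_sin_sub_sin_le _ _).trans ?_
  rw [add_sub_add_left_eq_sub, ← Real.dist_eq]
  exact BoundedContinuousFunction.dist_coe_le_dist _

/-- The shift `u ↦ u (· + a)`. -/
noncomputable def shift (a : ℝ) (u : CircleFun) : CircleFun :=
  u.compContinuous ⟨fun x => x + (a : AddCircle (2 * π)), by fun_prop⟩

theorem shift_apply (a : ℝ) (u : CircleFun) (x : ℝ) :
    shift a u x = u ((x + a : ℝ) : AddCircle (2 * π)) := by
  rw [AddCircle.coe_add]; rfl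

theorem continuous_shift (a : ℝ) : Continuous (shift a) :=
  BoundedContinuousFunction.continuous_compContinuous _

theorem norm_shift_le (a : ℝ) (u : CircleFun) : ‖shift a u‖ ≤ ‖u‖ :=
  BoundedContinuousFunction.norm_compContinuous_le _ _

theorem isCompact_lipschitz (R L : ℝ) :
    IsCompact {u : CircleFun | ‖u‖ ≤ R ∧ ∀ x y : ℝ, |u x - u y| ≤ L * |x - y|} := by
  refine BoundedContinuousFunction.arzela_ascoli₂ (Metric.closedBall 0 R)
    (isCompact_closedBall 0 R) _ ?_ (fun u x hu => ?_) fun x => ?_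
  · have hev : ∀ x : ℝ, Continuous fun u : CircleFun => u x := fun x =>
      continuous_eval_const _
    simp only [Set.ofPred_and, Set.ofPred_forall]
    exact (isClosed_le continuous_norm continuous_const).inter
      (isClosed_iInter fun x => isClosed_iInter fun y =>
        isClosed_le ((hev x).sub (hev y)).abs continuous_const)
  · rw [mem_closedBall_zero_iff]
    exact (u.norm_coe_le_norm x).trans hu.1
  · induction x using QuotientAddGroup.induction_on with
    | H x =>
    rw [Metric.equicontinuousAt_iff_right]
    intro ε hε
    rw [QuotientAddGroup.nhds_eq, Filter.eventually_map]
    have hlim : Filter.Tendsto (fun y : ℝ => L * |x - y|) (nhds x) (nhds 0) :=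
      Continuous.tendsto' (by fun_prop) _ _ (by simp)
    filter_upwards [hlim.eventually (gt_mem_nhds hε)] with y hy u
    exact (u.2.2 x y).trans_lt hy

/-- A Schaefer-type fixed point theorem for `u = prim (G u)`. -/
theorem exists_eq_prim {G : CircleFun → CircleFun} (hG : Continuous G)
    (hbdd : ∀ R, ∃ B, ∀ u, ‖u‖ ≤ R → ‖G u‖ ≤ B) {C : ℝ}
    (hC : ∀ u : CircleFun, ∀ lam : ℝ, 0 < lam → lam ≤ 1 → u = lam • prim (G u) → ‖u‖ ≤ C) :
    ∃ u, u = prim (G u) := by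
  set R := max C 0 + 1 with hR
  have hR0 : 0 < R := by positivity
  have hCR : C < R := by linarith [le_max_left C 0]
  obtain ⟨B, hB⟩ := hbdd R
  have hB0 : 0 ≤ B := (norm_nonneg _).trans (hB 0 (by simpa using hR0.le))
  let lam : CircleFun → ℝ := fun u => R / max R ‖prim (G u)‖
  have hmax : ∀ u, 0 < max R ‖prim (G u)‖ := fun u => lt_max_of_lt_left hR0
  have hlam0 : ∀ u, 0 < lam u := fun u => div_pos hR0 (hmax u)
  have hlam1 : ∀ u, lam u ≤ 1 := fun u => div_le_one_of_le₀ (le_max_left _ _) (hmax u).le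
  have hPG : Continuous fun u => prim (G u) := prim.continuous.comp hG
  have hΨ : Continuous fun u => lam u • prim (G u) :=
    (continuous_const.div (continuous_const.max hPG.norm) fun u => (hmax u).ne').smul hPG
  let K : Set CircleFun := {u : CircleFun | ‖u‖ ≤ R ∧ ∀ x y : ℝ, |u x - u y| ≤ 2 * B * |x - y|}
  have hconv : Convex ℝ K := by
    intro u hu w hw s t hs ht hst
    refine ⟨?_, fun x y => ?_⟩
    · calc ‖s • u + t • w‖ ≤ s * ‖u‖ + t * ‖w‖ := by
            refine (norm_add_le _ _).trans ?_
            rw [norm_smul, norm_smul, Real.norm_of_nonneg hs, Real.norm_of_nonneg ht]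
        _ ≤ s * R + t * R := by gcongr; exacts [hu.1, hw.1]
        _ = R := by rw [← add_mul, hst, one_mul]
    · simp only [BoundedContinuousFunction.add_apply, BoundedContinuousFunction.smul_apply,
        smul_eq_mul]
      calc |s * u x + t * w x - (s * u y + t * w y)|
          = |s * (u x - u y) + t * (w x - w y)| := by ring_nf
        _ ≤ s * |u x - u y| + t * |w x - w y| := by
            refine (abs_add_le _ _).trans ?_
            rw [abs_mul, abs_mul, abs_of_nonneg hs, abs_of_nonneg ht]
        _ ≤ s * (2 * B * |x - y|) + t * (2 * B * |x - y|) := by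
            gcongr; exacts [hu.2 x y, hw.2 x y]
        _ = 2 * B * |x - y| := by rw [← add_mul, hst, one_mul]
  have hzero : (0 : CircleFun) ∈ K := by
    refine ⟨by simpa using hR0.le, fun x y => ?_⟩
    simp only [BoundedContinuousFunction.coe_zero, Pi.zero_apply, sub_zero, abs_zero]
    positivity
  have hmaps : Set.MapsTo (fun u => lam u • prim (G u)) K K := by
    intro u hu
    refine ⟨?_, fun x y => ?_⟩
    · simp only [norm_smul, Real.norm_of_nonneg (hlam0 u).le, lam]
      rw [div_mul_eq_mul_div]
      exact div_le_of_le_mul₀ (hmax u).le hR0.le (by gcongr; exact le_max_right _ _)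
    · simp only [BoundedContinuousFunction.smul_apply, smul_eq_mul, prim_apply]
      rw [← mul_sub, abs_mul, abs_of_pos (hlam0 u)]
      calc lam u * |primFun (G u) x - primFun (G u) y|
          ≤ 1 * (2 * ‖G u‖ * |x - y|) := by
            gcongr; exacts [hlam1 u, abs_primFun_sub_le _ _ _]
        _ ≤ 2 * B * |x - y| := by
            rw [one_mul]; gcongr; exact hB u hu.1
  obtain ⟨u, hu, hfix⟩ := (isCompact_lipschitz R (2 * B)).exists_isFixedPt_of_convex
    hconv ⟨0, hzero⟩ hΨ.continuousOn hmaps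
  have huC := hC u (lam u) (hlam0 u) (hlam1 u) hfix.symm
  suffices h : lam u = 1 by
    refine ⟨u, ?_⟩
    nth_rewrite 1 [← hfix]
    simp only [h, one_smul]
  have hle : ‖prim (G u)‖ ≤ R := by
    by_contra! hlt
    have hn : ‖u‖ = R := by
      nth_rewrite 1 [← hfix]
      simp only [norm_smul, lam, max_eq_right hlt.le]
      rw [Real.norm_of_nonneg (by positivity), div_mul_cancel₀ _ (hR0.trans hlt).ne']
    linarith
  simp only [lam, max_eq_left hle, div_self hR0.ne']

end CircleFun

/-- Energy estimate for periodic solutions of a damped pendulum equation with symmetric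
nonlocal coupling. -/
theorem abs_le_of_periodic_solution {u p p' : ℝ → ℝ} (hu : ∀ x, HasDerivAt u (p x) x)
    (hp : ∀ x, HasDerivAt p (p' x) x) (hper : Function.Periodic u (2 * π)) (hu₀ : u 0 = 0)
    {γ k v lam a b d : ℝ} (hlam : lam ≠ 0) (hd : 0 < d) (hγ : d ≤ γ)
    (heq : ∀ x, v * p' x = lam * (-γ * p x + k * (u (x + a) - 2 * u x + u (x - a))
      - sin (x + u x) + b)) (x : ℝ) : |u x| ≤ π + π / d := by
  have hpp : Function.Periodic p (2 * π) := fun x => by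
    have h := (hu (x + 2 * π)).comp_add_const x (2 * π)
    simp only [hper _] at h
    exact h.unique (hu x)
  have huc : Continuous u := continuous_iff_continuousAt.2 fun x => (hu x).continuousAt
  have hpc : Continuous p := continuous_iff_continuousAt.2 fun x => (hp x).continuousAt
  have hII : ∀ {f : ℝ → ℝ}, Continuous f → ∀ s t, IntervalIntegrable f volume s t :=
    fun hf s t => hf.intervalIntegrable s t
  have hshift : ∫ x in 0..2 * π, (p x * u (x - a) - p (x + a) * u x) = 0 := by
    have hP : Function.Periodic (fun x => p x * u (x - a)) (2 * π) := fun x => by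
      simp only [hpp x]
      rw [show x + 2 * π - a = x - a + 2 * π by ring, hper]
    have h := hP.intervalIntegral_add_eq a 0
    rw [zero_add, add_comm a] at h
    have h' := integral_comp_add_right (a := 0) (b := 2 * π) (fun x => p x * u (x - a)) a
    simp only [add_sub_cancel_right, zero_add] at h'
    rw [integral_sub (hII (by fun_prop) _ _) (hII (by fun_prop) _ _), h', h, sub_self]
  have hmain : ∫ x in 0..2 * π, (γ * p x ^ 2 - sin (x + u x)
      - k * (p x * u (x - a) - p (x + a) * u x)) = 0 := by
    rw [integral_eq_sub_of_hasDerivAt (f := fun x => -(v / lam) * (p x ^ 2 / 2)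
      + k * (u x * u (x + a)) - k * u x ^ 2 + cos (x + u x) + b * u x) (fun x _ => ?_)
      (hII (by fun_prop) _ _)]
    · have h1 := hper 0
      have h2 := hpp 0
      have h3 := hper a
      rw [zero_add] at h1 h2
      rw [add_comm] at h3
      simp only [h1, h2, h3, zero_add, hu₀, add_zero, cos_two_pi, cos_zero, sub_self]
    · have hua := (hu (x + a)).comp_add_const x a
      have h := (((((((hp x).pow 2).div_const 2).const_mul (-(v / lam))).add
        (((hu x).mul hua).const_mul k)).sub (((hu x).pow 2).const_mul k)).add
        ((hasDerivAt_id x).add (hu x)).cos).add ((hu x).const_mul b)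
      convert! h using 1
      have e : v / lam * p' x = -γ * p x + k * (u (x + a) - 2 * u x + u (x - a))
          - sin (x + u x) + b := by
        rw [div_mul_eq_mul_div, heq, mul_div_cancel_left₀ _ hlam]
      simp only [Pi.add_apply, id]
      linear_combination p x * e
  have hsq : d * ∫ x in 0..2 * π, p x ^ 2 ≤ 2 * π := by
    have hnn : 0 ≤ ∫ x in 0..2 * π, p x ^ 2 :=
      integral_nonneg two_pi_pos.le fun x _ => sq_nonneg _
    rw [integral_sub (hII (by fun_prop) _ _) (hII (by fun_prop) _ _),
      integral_sub (hII (by fun_prop) _ _) (hII (by fun_prop) _ _),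
      intervalIntegral.integral_const_mul, intervalIntegral.integral_const_mul, hshift] at hmain
    have hsin : ∫ x in 0..2 * π, sin (x + u x) ≤ ∫ x in 0..2 * π, (1 : ℝ) :=
      integral_mono two_pi_pos.le (hII (by fun_prop) _ _) (by simp) fun x => sin_le_one _
    rw [intervalIntegral.integral_const, smul_eq_mul, sub_zero, mul_one] at hsin
    nlinarith
  have key : ∀ y ∈ Set.Ico 0 (2 * π), |u y| ≤ π + π / d := by
    intro y ⟨hy₀, hy⟩
    have h1 : ∫ x in 0..y, p x = u y := by
      rw [integral_eq_sub_of_hasDerivAt (fun x _ => hu x) (hII hpc _ _), hu₀, sub_zero]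
    have hq : Continuous fun x => (1 + p x ^ 2) / 2 := by fun_prop
    have hpq : ∀ x, |p x| ≤ (1 + p x ^ 2) / 2 := fun x => by
      nlinarith [sq_nonneg (|p x| - 1), sq_abs (p x)]
    calc |u y| ≤ ∫ x in 0..y, |p x| := h1 ▸ abs_integral_le_integral_abs hy₀
      _ ≤ ∫ x in 0..y, (1 + p x ^ 2) / 2 :=
        integral_mono hy₀ (hII hpc.abs _ _) (hII hq _ _) hpq
      _ ≤ ∫ x in 0..2 * π, (1 + p x ^ 2) / 2 := by
        rw [← integral_add_adjacent_intervals (hII hq 0 y) (hII hq y (2 * π))]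
        have : 0 ≤ ∫ x in y..2 * π, (1 + p x ^ 2) / 2 :=
          integral_nonneg hy.le fun x _ => by positivity
        linarith
      _ = π + (∫ x in 0..2 * π, p x ^ 2) / 2 := by
        rw [intervalIntegral.integral_div, integral_add (by simp) (hII (by fun_prop) _ _),
          intervalIntegral.integral_const, smul_eq_mul]
        ring
      _ ≤ π + π / d := by
        rw [add_le_add_iff_left, div_le_iff₀ two_pos, div_mul_eq_mul_div, le_div_iff₀ hd]
        linarith
  obtain ⟨y, hy, hxy⟩ := hper.exists_mem_Ico₀ two_pi_pos x
  exact hxy ▸ key y hy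

namespace CircleFun

theorem mean_shift (a : ℝ) (u : CircleFun) : mean (shift a u) = mean u := by
  rw [mean_apply, mean_apply]
  simp only [shift_apply]
  rw [integral_comp_add_right (fun x : ℝ => u x) a, zero_add, add_comm,
    u.periodic.intervalIntegral_add_eq a 0, zero_add]

/-- The coupling and pinning terms of the wave equation with shift `a`. -/
noncomputable def coupling (K a : ℝ) (u : CircleFun) : CircleFun :=
  K • (shift a u - (2 : ℝ) • u + shift (-a) u) - sinShift u

theorem coupling_apply (K a : ℝ) (u : CircleFun) (x : ℝ) :
    coupling K a u x = K * (u ((x + a : ℝ) : AddCircle (2 * π)) - 2 * u x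
      + u ((x - a : ℝ) : AddCircle (2 * π))) - sin (x + u x) := by
  simp only [coupling, BoundedContinuousFunction.sub_apply, BoundedContinuousFunction.add_apply,
    BoundedContinuousFunction.smul_apply, smul_eq_mul, shift_apply, sinShift_apply,
    ← sub_eq_add_neg]

theorem mean_coupling (K a : ℝ) (u : CircleFun) :
    mean (coupling K a u) = -mean (sinShift u) := by
  simp only [coupling, map_sub, map_smul, map_add, mean_shift, smul_eq_mul]
  ring

theorem continuous_coupling (K a : ℝ) : Continuous (coupling K a) :=
  ((((continuous_shift a).sub (continuous_id.const_smul (2 : ℝ))).add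
    (continuous_shift (-a))).const_smul K).sub continuous_sinShift

theorem norm_coupling_le {K : ℝ} (hK : 0 ≤ K) (a : ℝ) (u : CircleFun) :
    ‖coupling K a u‖ ≤ 4 * K * ‖u‖ + 1 := by
  have h₂ : ‖(2 : ℝ) • u‖ = 2 * ‖u‖ := by rw [norm_smul, Real.norm_of_nonneg zero_le_two]
  have h : ‖shift a u - (2 : ℝ) • u + shift (-a) u‖ ≤ 4 * ‖u‖ := by
    linarith [norm_add_le (shift a u - (2 : ℝ) • u) (shift (-a) u),
      norm_sub_le (shift a u) ((2 : ℝ) • u), norm_shift_le a u, norm_shift_le (-a) u]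
  calc ‖coupling K a u‖ ≤ ‖K • (shift a u - (2 : ℝ) • u + shift (-a) u)‖ + ‖sinShift u‖ :=
        norm_sub_le _ _
    _ ≤ K * (4 * ‖u‖) + 1 := by
        rw [norm_smul, Real.norm_of_nonneg hK]
        gcongr
        exact norm_sinShift_le u
    _ = 4 * K * ‖u‖ + 1 := by ring

/-- Existence of a periodic profile together with its velocity. -/
theorem exists_periodic_profile {Γ K F : ℝ} (hΓ : 0 < Γ) (hK : 0 ≤ K) (hF : 1 < F) (a : ℝ) :
    ∃ v : ℝ, 0 < v ∧ ∃ u p p' : ℝ → ℝ, (∀ x, HasDerivAt u (p x) x) ∧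
      (∀ x, HasDerivAt p (p' x) x) ∧ Continuous p' ∧ Function.Periodic u (2 * π) ∧
      ∀ x, v ^ 2 * p' x + Γ * (v * (1 + p x)) + sin (x + u x)
        = F + K * (u (x + a) - 2 * u x + u (x - a)) := by
  let ω : CircleFun → ℝ := fun u => F - mean (sinShift u)
  have hmean : ∀ u, |mean (sinShift u)| ≤ 1 := fun u =>
    (abs_mean_le _).trans (norm_sinShift_le u)
  have hω₁ : ∀ u, F - 1 ≤ ω u := fun u => by
    simp only [ω]; linarith [(abs_le.1 (hmean u)).2]
  have hω₂ : ∀ u, ω u ≤ F + 1 := fun u => by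
    simp only [ω]; linarith [(abs_le.1 (hmean u)).1]
  have hω₀ : ∀ u, 0 < ω u := fun u => by linarith [hω₁ u]
  have hωc : Continuous ω := continuous_const.sub (mean.continuous.comp continuous_sinShift)
  have hv₀ : ∀ u, 0 < ω u / Γ := fun u => div_pos (hω₀ u) hΓ
  let G : CircleFun → CircleFun := fun u =>
    ((ω u / Γ) ^ 2)⁻¹ • (prim (coupling K a u) - ω u • u)
  have hG : Continuous G :=
    (((hωc.div_const Γ).pow 2).inv₀ fun u => (pow_pos (hv₀ u) 2).ne').smul
      ((prim.continuous.comp (continuous_coupling K a)).sub (hωc.smul continuous_id))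
  have hbdd : ∀ R, ∃ B, ∀ u, ‖u‖ ≤ R → ‖G u‖ ≤ B := by
    intro R
    refine ⟨(((F - 1) / Γ) ^ 2)⁻¹ * (4 * π * (4 * K * R + 1) + (F + 1) * R), fun u hu => ?_⟩
    have hF₁ : 0 < (F - 1) / Γ := div_pos (by linarith) hΓ
    have h₁ : ‖prim (coupling K a u)‖ ≤ 4 * π * (4 * K * R + 1) := by
      refine (norm_primFun_le _).trans ?_
      gcongr
      refine (norm_coupling_le hK a u).trans ?_
      gcongr
    have h₂ : ‖ω u • u‖ ≤ (F + 1) * R := by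
      rw [norm_smul, Real.norm_of_nonneg (hω₀ u).le]
      gcongr
      exact hω₂ u
    simp only [G, norm_smul, norm_inv, norm_pow, Real.norm_of_nonneg (hv₀ u).le]
    gcongr
    · exact hω₁ u
    · exact (norm_sub_le _ _).trans (add_le_add h₁ h₂)
  -- the equation satisfied by `u = lam • prim (G u)`
  have hode : ∀ (u : CircleFun) (lam : ℝ), u = lam • prim (G u) → u (0 : ℝ) = 0 ∧
      ∃ p p' : ℝ → ℝ, (∀ x, HasDerivAt (fun x : ℝ => u x) (p x) x) ∧
        (∀ x, HasDerivAt p (p' x) x) ∧ Continuous p' ∧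
        ∀ x, (ω u / Γ) ^ 2 * p' x =
          lam * (coupling K a u x + mean (sinShift u) - ω u * p x) := by
    intro u lam hu
    have hux : ∀ x : ℝ, u x = lam * primFun (G u) x := fun x => by
      conv_lhs => rw [hu]
      rfl
    have hd : ∀ x : ℝ, HasDerivAt (fun x : ℝ => u x) (lam * (G u x - mean (G u))) x := fun x => by
      simp only [hux]
      exact (hasDerivAt_primFun (G u) x).const_mul lam
    have hd' : ∀ x : ℝ, HasDerivAt (fun x : ℝ => lam * (G u x - mean (G u)))
        (lam * (((ω u / Γ) ^ 2)⁻¹ * (coupling K a u x - mean (coupling K a u)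
          - ω u * (lam * (G u x - mean (G u)))))) x := fun x =>
      ((((hasDerivAt_primFun (coupling K a u) x).sub ((hd x).const_mul (ω u))).const_mul
        ((ω u / Γ) ^ 2)⁻¹).sub_const _).const_mul lam
    refine ⟨by rw [hux, primFun_zero, mul_zero], _, _, hd, hd', ?_, fun x => ?_⟩
    · have h₁ := (G u).continuous_comp_coe
      have h₂ := (coupling K a u).continuous_comp_coe
      fun_prop
    · have := (pow_pos (hv₀ u) 2).ne'
      rw [mean_coupling, mul_left_comm, mul_inv_cancel_left₀ this]
      ring
  obtain ⟨u, hu⟩ := exists_eq_prim hG hbdd (C := π + π / (F - 1)) fun u lam hlam _ hu => by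
    obtain ⟨hu₀, p, p', hp, hp', -, heq⟩ := hode u lam hu
    have hF₁ : 0 < F - 1 := by linarith
    refine norm_le_of_forall_coe (by positivity) fun x => ?_
    refine abs_le_of_periodic_solution hp hp' u.periodic hu₀ hlam.ne' hF₁ (hω₁ u)
      (v := (ω u / Γ) ^ 2) (a := a) (k := K) (b := mean (sinShift u)) (fun x => ?_) x
    rw [heq, coupling_apply]
    ring
  obtain ⟨-, p, p', hp, hp', hc, heq⟩ := hode u 1 (by rwa [one_smul])
  refine ⟨ω u / Γ, hv₀ u, _, p, p', hp, hp', hc, u.periodic, fun x => ?_⟩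
  have hΓv : Γ * (ω u / Γ) = F - mean (sinShift u) := mul_div_cancel₀ _ hΓ.ne'
  rw [heq, coupling_apply, ← mul_assoc, hΓv]
  ring

end CircleFun

end CircleFunSection

/-- For every `Γ > 0`, `K > 0` and every `F > 1`, there exists a travelling wave of
the discrete sine-Gordon ring. -/
theorem exists_travellingWave_of_one_lt_force (n m : ℕ) (hn : 1 ≤ n) (hm : 1 ≤ m)
    (Γ K F : ℝ) (hΓ : 0 < Γ) (hK : 0 < K) (hF : 1 < F) :
    ∃ v : ℝ, 0 < v ∧ ∃ f : ℝ → ℝ, IsWaveform n m Γ K F v f := by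
  obtain ⟨v, hv, u, p, p', hu, hp, hc, hper, heq⟩ :=
    CircleFun.exists_periodic_profile hΓ hK.le hF ((m : ℝ) / n * (2 * Real.pi))
  have hvt : ∀ t, HasDerivAt (fun t : ℝ => v * t) v t := fun t => by
    simpa using (hasDerivAt_id t).const_mul v
  have hf : ∀ t, HasDerivAt (fun t => v * t + u (v * t)) (v * (1 + p (v * t))) t := fun t => by
    convert! (hvt t).add ((hu (v * t)).comp t (hvt t)) using 1
    ring
  have hf' : ∀ t, HasDerivAt (fun t => v * (1 + p (v * t))) (v ^ 2 * p' (v * t)) t := fun t => by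
    convert! (((hp (v * t)).comp t (hvt t)).const_add 1).const_mul v using 1
    ring
  have hdf := deriv_eq hf
  have hddf := deriv_eq hf'
  refine ⟨v, hv, fun t => v * t + u (v * t), ?_, fun t => ?_, fun t => ?_⟩
  · rw [show (2 : WithTop ℕ∞) = 1 + 1 from one_add_one_eq_two.symm, contDiff_succ_iff_deriv]
    refine ⟨fun t => (hf t).differentiableAt, by simp, ?_⟩
    rw [hdf, contDiff_one_iff_deriv, hddf]
    exact ⟨fun t => (hf' t).differentiableAt, by fun_prop⟩
  · simp only [mul_add, mul_div_cancel₀ _ hv.ne', hper (v * t)]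
    ring
  · have hshift : v * ((m : ℝ) / n * (2 * Real.pi / v)) = (m : ℝ) / n * (2 * Real.pi) := by
      field_simp
    rw [hdf, hddf]
    simp only [mul_add v, mul_sub v, hshift]
    linear_combination heq (v * t)
end

section
/- Assume n does not divide m. Fix any F̃ > 0 and Γ̃ > 0. Then there exists K₀ > 0 such that for all K ≥ K₀, all F ≥ F̃ and all Γ ≥ Γ̃, the discrete sine-Gordon ring admits a travelling wave; that is, there exist a velocity v > 0 and a waveform f satisfying the defining conditions of a travelling wave with these parameters. -/
namespace SineGordonRing

open Real MeasureTheory Topology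

/-- The circle of phases. -/
abbrev PhaseCircle : Type := AddCircle (2 * π)

instance fact_two_pi_pos : Fact (0 < 2 * π) := ⟨Real.two_pi_pos⟩

/-- Complex Fourier coefficients of a real continuous function on the circle. -/
noncomputable def coeff (h : C(PhaseCircle, ℝ)) (k : ℤ) : ℂ :=
  fourierCoeff (fun x => (h x : ℂ)) k

/-- Real part of the Fourier series with coefficients `c`. -/
noncomputable def synth (c : ℤ → ℂ) : C(PhaseCircle, ℝ) where
  toFun x := ((∑' k, c k • fourier k : C(PhaseCircle, ℂ)) x).re
  continuous_toFun := by fun_prop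

lemma fourier_apply_coe (k : ℤ) (x : ℝ) :
    fourier k (x : PhaseCircle) = Complex.exp (Complex.I * k * x) := by
  rw [fourier_coe_apply]
  congr 1
  have : (π : ℂ) ≠ 0 := by exact_mod_cast Real.pi_ne_zero
  push_cast
  field_simp

lemma norm_fourier_apply (k : ℤ) (x : PhaseCircle) : ‖fourier k x‖ = 1 := by
  rw [fourier_apply]; exact Circle.norm_coe _

lemma hasSum_synth {c : ℤ → ℂ} (hc : Summable fun k => ‖c k‖) (x : PhaseCircle) :
    HasSum (fun k => (c k * fourier k x).re) (synth c x) := by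
  have h1 : Summable fun k => (c k • fourier k : C(PhaseCircle, ℂ)) := by
    refine Summable.of_norm ?_
    simpa [norm_smul, fourier_norm] using hc
  have h2 := ContinuousMap.hasSum_apply h1.hasSum x
  exact Complex.hasSum_re h2

lemma norm_synth_le {c : ℤ → ℂ} (hc : Summable fun k => ‖c k‖) : ‖synth c‖ ≤ ∑' k, ‖c k‖ := by
  rw [ContinuousMap.norm_le _ (tsum_nonneg fun k => norm_nonneg _)]
  intro x
  refine (hasSum_synth hc x).norm_le_of_bounded hc.hasSum fun k => ?_
  refine (Complex.abs_re_le_norm _).trans ?_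
  rw [norm_mul, norm_fourier_apply, mul_one]

lemma synth_sub {c d : ℤ → ℂ} (hc : Summable fun k => ‖c k‖) (hd : Summable fun k => ‖d k‖) :
    synth c - synth d = synth (fun k => c k - d k) := by
  ext x
  have hcd : Summable fun k => ‖c k - d k‖ :=
    .of_nonneg_of_le (fun _ => norm_nonneg _) (fun k => norm_sub_le _ _) (hc.add hd)
  refine ((hasSum_synth hc x).sub (hasSum_synth hd x)).unique ?_
  simpa only [← Complex.sub_re, ← sub_mul] using hasSum_synth hcd x

lemma integrable_ofReal (h : C(PhaseCircle, ℝ)) :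
    Integrable (fun x => (h x : ℂ)) (AddCircle.haarAddCircle (T := 2 * π)) := by
  have : Continuous fun x => (h x : ℂ) := by fun_prop
  exact this.integrable_of_hasCompactSupport (HasCompactSupport.of_compactSpace _)

lemma coeff_sub (g h : C(PhaseCircle, ℝ)) (k : ℤ) :
    coeff (g - h) k = coeff g k - coeff h k := by
  have h1 := fourierCoeff.add (integrable_ofReal (g - h)) (integrable_ofReal h)
  have h2 : ((fun x => ((g - h) x : ℂ)) + fun x => (h x : ℂ)) = fun x => (g x : ℂ) := by
    ext x; simp
  rw [h2] at h1
  have := congrFun h1 k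
  simp only [coeff, this, Pi.add_apply, add_sub_cancel_right]

lemma hasSum_sq_coeff (h : C(PhaseCircle, ℝ)) :
    HasSum (fun k => ‖coeff h k‖ ^ 2)
      (∫ x, ‖(h x : ℂ)‖ ^ 2 ∂(AddCircle.haarAddCircle (T := 2 * π))) := by
  let u : C(PhaseCircle, ℂ) := ⟨fun x => (h x : ℂ), by fun_prop⟩
  set w := ContinuousMap.toLp (E := ℂ) 2 (AddCircle.haarAddCircle (T := 2 * π)) ℂ u with hw
  have hcoeff : ∀ k, fourierCoeff w k = coeff h k := fourierCoeff_toLp (f := u)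
  have hintegral : ∫ x, ‖(h x : ℂ)‖ ^ 2 ∂(AddCircle.haarAddCircle (T := 2 * π)) =
      ∫ x, ‖w x‖ ^ 2 ∂(AddCircle.haarAddCircle (T := 2 * π)) := by
    refine integral_congr_ae ?_
    filter_upwards [ContinuousMap.coeFn_toLp (E := ℂ) (p := 2) (𝕜 := ℂ)
      (AddCircle.haarAddCircle (T := 2 * π)) u] with x hx
    rw [hw, hx]; rfl
  rw [hintegral]
  simpa only [hcoeff] using hasSum_sq_fourierCoeff w

lemma summable_sq_coeff (h : C(PhaseCircle, ℝ)) : Summable fun k => ‖coeff h k‖ ^ 2 :=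
  (hasSum_sq_coeff h).summable

lemma tsum_sq_coeff_le (h : C(PhaseCircle, ℝ)) : ∑' k, ‖coeff h k‖ ^ 2 ≤ ‖h‖ ^ 2 := by
  rw [(hasSum_sq_coeff h).tsum_eq]
  have : ∫ x, ‖(h x : ℂ)‖ ^ 2 ∂(AddCircle.haarAddCircle (T := 2 * π)) ≤
      ∫ _x, ‖h‖ ^ 2 ∂(AddCircle.haarAddCircle (T := 2 * π)) := by
    refine integral_mono ?_ (integrable_const _) fun x => ?_
    · have : Continuous fun x => ‖(h x : ℂ)‖ ^ 2 := by fun_prop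
      exact this.integrable_of_hasCompactSupport (HasCompactSupport.of_compactSpace _)
    · have := h.norm_coe_le_norm x
      simp only [Complex.norm_real]
      gcongr
  simpa using this

lemma norm_coeff_le (h : C(PhaseCircle, ℝ)) (k : ℤ) : ‖coeff h k‖ ≤ ‖h‖ := by
  have h1 := (summable_sq_coeff h).le_tsum k fun _ _ => by positivity
  exact le_of_sq_le_sq (h1.trans (tsum_sq_coeff_le h)) (norm_nonneg _)

/-- The Fourier multiplier with symbol `p`, followed by taking the real part. -/
noncomputable def multiplier (p : ℤ → ℂ) (h : C(PhaseCircle, ℝ)) : C(PhaseCircle, ℝ) :=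
  synth fun k => p k * coeff h k

lemma norm_mul_coeff_le {p : ℤ → ℂ} {q : ℤ → ℝ} (hp : ∀ k, ‖p k‖ ^ 2 ≤ q k)
    (h : C(PhaseCircle, ℝ)) (k : ℤ) : ‖p k * coeff h k‖ ≤ q k + ‖coeff h k‖ ^ 2 := by
  rw [norm_mul]
  nlinarith [hp k, sq_nonneg (‖p k‖ - ‖coeff h k‖), sq_nonneg (‖p k‖), sq_nonneg ‖coeff h k‖]

lemma summable_norm_mul_coeff {p : ℤ → ℂ} {q : ℤ → ℝ} (hp : ∀ k, ‖p k‖ ^ 2 ≤ q k)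
    (hq : Summable q) (h : C(PhaseCircle, ℝ)) : Summable fun k => ‖p k * coeff h k‖ :=
  .of_nonneg_of_le (fun _ => norm_nonneg _) (norm_mul_coeff_le hp h)
    (hq.add (summable_sq_coeff h))

lemma norm_multiplier_le {p : ℤ → ℂ} {q : ℤ → ℝ} (hp : ∀ k, ‖p k‖ ^ 2 ≤ q k)
    (hq : Summable q) (h : C(PhaseCircle, ℝ)) : ‖multiplier p h‖ ≤ √(∑' k, q k) * ‖h‖ := by
  have hp' : Summable fun k => ‖p k‖ ^ 2 := .of_nonneg_of_le (fun _ => by positivity) hp hq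
  refine (norm_synth_le (summable_norm_mul_coeff hp hq h)).trans ?_
  have := Real.inner_le_Lp_mul_Lq_tsum_of_nonneg (p := 2) (q := 2) Real.HolderConjugate.two_two
    (f := fun k => ‖p k‖) (g := fun k => ‖coeff h k‖) (fun _ => norm_nonneg _)
    (fun _ => norm_nonneg _) (by simpa using hp') (by simpa using summable_sq_coeff h)
  simp only [Real.rpow_ofNat] at this
  simp only [norm_mul]
  refine this.trans ?_
  rw [← Real.sqrt_eq_rpow, ← Real.sqrt_eq_rpow]
  refine mul_le_mul (Real.sqrt_le_sqrt (hp'.tsum_le_tsum hp hq)) ?_ (by positivity) (by positivity)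
  exact Real.sqrt_le_iff.2 ⟨norm_nonneg _, tsum_sq_coeff_le h⟩

lemma multiplier_sub {p : ℤ → ℂ} {q : ℤ → ℝ} (hp : ∀ k, ‖p k‖ ^ 2 ≤ q k)
    (hq : Summable q) (g h : C(PhaseCircle, ℝ)) :
    multiplier p g - multiplier p h = multiplier p (g - h) := by
  rw [multiplier, multiplier, synth_sub (summable_norm_mul_coeff hp hq g)
    (summable_norm_mul_coeff hp hq h), multiplier]
  congr 1; ext k; rw [coeff_sub]; ring

lemma continuousOn_multiplier {p : ℝ → ℤ → ℂ} {q : ℤ → ℝ} {s : Set ℝ}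
    (hp : ∀ v ∈ s, ∀ k, ‖p v k‖ ^ 2 ≤ q k) (hq : Summable q)
    (hcont : ∀ k, ContinuousOn (fun v => p v k) s) (h : C(PhaseCircle, ℝ)) :
    ContinuousOn (fun v => multiplier (p v) h) s := by
  have h1 : ContinuousOn
      (fun v => (∑' k, (p v k * coeff h k) • fourier k : C(PhaseCircle, ℂ))) s := by
    refine continuousOn_tsum (u := fun k => q k + ‖coeff h k‖ ^ 2)
      (fun k => ((hcont k).mul continuousOn_const).smul continuousOn_const)
      (hq.add (summable_sq_coeff h)) fun k v hv => ?_
    rw [norm_smul, fourier_norm, mul_one]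
    exact norm_mul_coeff_le (hp v hv) h k
  have h2 : Continuous fun u : C(PhaseCircle, ℂ) =>
      (⟨Complex.re, Complex.continuous_re⟩ : C(ℂ, ℝ)).comp u := by fun_prop
  exact h2.comp_continuousOn h1

/-- The nonlinearity `x ↦ sin (x + g x)` on the circle. -/
noncomputable def phaseSin (g : C(PhaseCircle, ℝ)) : C(PhaseCircle, ℝ) where
  toFun x := (fourier 1 x).im * cos (g x) + (fourier 1 x).re * sin (g x)
  continuous_toFun := by fun_prop

lemma phaseSin_apply_coe (g : C(PhaseCircle, ℝ)) (x : ℝ) :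
    phaseSin g (x : PhaseCircle) = sin (x + g x) := by
  have h : fourier 1 (x : PhaseCircle) = Complex.exp (x * Complex.I) := by
    rw [fourier_apply_coe]; congr 1; push_cast; ring
  change (fourier 1 (x : PhaseCircle)).im * cos (g x) + (fourier 1 (x : PhaseCircle)).re * sin (g x)
    = _
  rw [h, Complex.exp_ofReal_mul_I_re, Complex.exp_ofReal_mul_I_im, sin_add]

lemma norm_phaseSin_le (g : C(PhaseCircle, ℝ)) : ‖phaseSin g‖ ≤ 1 := by
  rw [ContinuousMap.norm_le _ zero_le_one]
  intro x
  induction x using QuotientAddGroup.induction_on with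
  | H x => rw [phaseSin_apply_coe]; exact abs_sin_le_one _

lemma norm_phaseSin_sub_le (g h : C(PhaseCircle, ℝ)) :
    ‖phaseSin g - phaseSin h‖ ≤ ‖g - h‖ := by
  rw [ContinuousMap.norm_le _ (norm_nonneg _)]
  intro x
  refine le_trans ?_ ((g - h).norm_coe_le_norm x)
  induction x using QuotientAddGroup.induction_on with
  | H x =>
    simp only [ContinuousMap.sub_apply, phaseSin_apply_coe, Real.norm_eq_abs]
    have := Real.lipschitzWith_sin.dist_le_mul (x + g x) (x + h x)
    simpa [Real.dist_eq] using this

lemma continuous_phaseSin : Continuous phaseSin := by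
  refine LipschitzWith.continuous (K := 1) (LipschitzWith.of_dist_le_mul fun g h => ?_)
  simpa [dist_eq_norm] using norm_phaseSin_sub_le g h

lemma abs_sin_second_difference_le (a u w : ℝ) :
    |(sin (u + a) - sin u) - (sin (w + a) - sin w)| ≤ |a| * |u - w| := by
  have h1 : (sin (u + a) - sin u) - (sin (w + a) - sin w) =
      2 * sin (a / 2) * (cos (u + a / 2) - cos (w + a / 2)) := by
    rw [Real.sin_sub_sin, Real.sin_sub_sin]
    ring_nf
  have h2 := Real.lipschitzWith_cos.dist_le_mul (u + a / 2) (w + a / 2)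
  have h3 : |sin (a / 2)| ≤ |a / 2| := abs_sin_le_abs
  rw [Real.dist_eq, Real.dist_eq] at h2
  simp only [NNReal.coe_one, one_mul, add_sub_add_right_eq_sub] at h2
  rw [h1, abs_mul, abs_mul, abs_two]
  rw [abs_div, abs_two] at h3
  have h4 : 2 * |sin (a / 2)| ≤ |a| := by linarith
  gcongr

lemma norm_phaseSin_second_difference_le (a g h : C(PhaseCircle, ℝ)) :
    ‖(phaseSin (a + g) - phaseSin g) - (phaseSin (a + h) - phaseSin h)‖ ≤ ‖a‖ * ‖g - h‖ := by
  rw [ContinuousMap.norm_le _ (by positivity)]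
  intro x
  refine le_trans ?_ (mul_le_mul (a.norm_coe_le_norm x) ((g - h).norm_coe_le_norm x)
    (norm_nonneg _) (norm_nonneg _))
  induction x using QuotientAddGroup.induction_on with
  | H x =>
    simp only [ContinuousMap.sub_apply, phaseSin_apply_coe, Real.norm_eq_abs,
      ContinuousMap.add_apply]
    have := abs_sin_second_difference_le (a x) (x + g x) (x + h x)
    rw [add_sub_add_left_eq_sub, add_right_comm, add_right_comm x (h x), add_assoc x, add_assoc x]
      at this
    exact this

lemma continuousOn_multiplier_comp {p : ℝ → ℤ → ℂ} {q : ℤ → ℝ} {s : Set ℝ}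
    (hp : ∀ v ∈ s, ∀ k, ‖p v k‖ ^ 2 ≤ q k) (hq : Summable q)
    (hcont : ∀ k, ContinuousOn (fun v => p v k) s) {h : ℝ → C(PhaseCircle, ℝ)}
    (hh : ContinuousOn h s) : ContinuousOn (fun v => multiplier (p v) (h v)) s := by
  intro v hv
  have h1 := continuousOn_multiplier hp hq hcont (h v) v hv
  have h2 : Filter.Tendsto (fun w => multiplier (p w) (h w) - multiplier (p w) (h v)) (𝓝[s] v)
      (𝓝 0) := by
    refine squeeze_zero_norm' (a := fun w => √(∑' k, q k) * ‖h w - h v‖) ?_ ?_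
    · filter_upwards [self_mem_nhdsWithin] with w hw
      rw [multiplier_sub (hp w hw) hq]
      exact norm_multiplier_le (hp w hw) hq _
    · have := (tendsto_iff_norm_sub_tendsto_zero.1 (hh v hv)).const_mul (√(∑' k, q k))
      simpa using this
  have := h2.add h1
  simpa [ContinuousWithinAt] using this

/-- One step of the Lyapunov-Schmidt iteration: the non-resonant part is updated first, and its
new value is used in the update of the resonant part. -/
noncomputable def iterationMap (pA pB : ℤ → ℂ) (z : C(PhaseCircle, ℝ) × C(PhaseCircle, ℝ)) :
    C(PhaseCircle, ℝ) × C(PhaseCircle, ℝ) :=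
  (multiplier pA (phaseSin (z.1 + z.2)),
    multiplier pB (phaseSin (multiplier pA (phaseSin (z.1 + z.2)) + z.2) - phaseSin z.2))

lemma contractingWith_iterationMap {pA pB : ℤ → ℂ} {qA qB : ℤ → ℝ} {ε β : ℝ}
    (hpA : ∀ k, ‖pA k‖ ^ 2 ≤ qA k) (hqA : Summable qA) (hpB : ∀ k, ‖pB k‖ ^ 2 ≤ qB k)
    (hqB : Summable qB) (hε : √(∑' k, qA k) ≤ ε) (hβ : √(∑' k, qB k) ≤ β)
    (hε4 : ε ≤ 1 / 4) (hβε : β * ε ≤ 1 / 6) :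
    ContractingWith (1 / 2) (iterationMap pA pB) := by
  have hε0 : 0 ≤ ε := (Real.sqrt_nonneg _).trans hε
  have hβ0 : 0 ≤ β := (Real.sqrt_nonneg _).trans hβ
  refine ⟨by norm_num, LipschitzWith.of_dist_le_mul fun z w => ?_⟩
  have hd1 : ‖z.1 - w.1‖ ≤ ‖z - w‖ := norm_fst_le (z - w)
  have hd2 : ‖z.2 - w.2‖ ≤ ‖z - w‖ := norm_snd_le (z - w)
  have hA : ∀ h, ‖multiplier pA h‖ ≤ ε * ‖h‖ := fun h =>
    (norm_multiplier_le hpA hqA h).trans (by gcongr)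
  have hB : ∀ h, ‖multiplier pB h‖ ≤ β * ‖h‖ := fun h =>
    (norm_multiplier_le hpB hqB h).trans (by gcongr)
  set a := multiplier pA (phaseSin (z.1 + z.2)) with ha
  set b := multiplier pA (phaseSin (w.1 + w.2)) with hb
  have hab : ‖a - b‖ ≤ ε * (2 * ‖z - w‖) := by
    rw [ha, hb, multiplier_sub hpA hqA]
    refine (hA _).trans ?_
    gcongr
    refine (norm_phaseSin_sub_le _ _).trans ?_
    rw [add_sub_add_comm]
    refine (norm_add_le _ _).trans ?_
    linarith
  have hbn : ‖b‖ ≤ ε := by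
    refine (hA _).trans ?_
    have := norm_phaseSin_le (w.1 + w.2)
    nlinarith
  have hsnd : ‖multiplier pB (phaseSin (a + z.2) - phaseSin z.2) -
      multiplier pB (phaseSin (b + w.2) - phaseSin w.2)‖ ≤ β * (3 * ε * ‖z - w‖) := by
    rw [multiplier_sub hpB hqB]
    refine (hB _).trans ?_
    gcongr
    have e : phaseSin (a + z.2) - phaseSin z.2 - (phaseSin (b + w.2) - phaseSin w.2) =
        (phaseSin (a + z.2) - phaseSin (b + z.2)) +
        (phaseSin (b + z.2) - phaseSin z.2 - (phaseSin (b + w.2) - phaseSin w.2)) := by abel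
    rw [e]
    refine (norm_add_le _ _).trans ?_
    have h1 := norm_phaseSin_sub_le (a + z.2) (b + z.2)
    rw [add_sub_add_right_eq_sub] at h1
    have h2 := norm_phaseSin_second_difference_le b z.2 w.2
    have h3 : ‖b‖ * ‖z.2 - w.2‖ ≤ ε * ‖z - w‖ := by gcongr
    linarith
  rw [dist_eq_norm, dist_eq_norm]
  have hn := norm_nonneg (z - w)
  refine max_le ?_ ?_
  · refine hab.trans ?_
    push_cast
    nlinarith
  · refine hsnd.trans ?_
    push_cast
    nlinarith

lemma exists_continuousOn_fixedPoint {pA pB : ℝ → ℤ → ℂ} {qA qB : ℤ → ℝ} {s : Set ℝ} {ε β : ℝ}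
    (hpA : ∀ v ∈ s, ∀ k, ‖pA v k‖ ^ 2 ≤ qA k) (hqA : Summable qA)
    (hpB : ∀ v ∈ s, ∀ k, ‖pB v k‖ ^ 2 ≤ qB k) (hqB : Summable qB)
    (hcA : ∀ k, ContinuousOn (fun v => pA v k) s) (hcB : ∀ k, ContinuousOn (fun v => pB v k) s)
    (hε : √(∑' k, qA k) ≤ ε) (hβ : √(∑' k, qB k) ≤ β)
    (hε4 : ε ≤ 1 / 4) (hβε : β * ε ≤ 1 / 6) :
    ∃ A B : ℝ → C(PhaseCircle, ℝ), ContinuousOn A s ∧ ContinuousOn B s ∧ ∀ v ∈ s,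
      A v = multiplier (pA v) (phaseSin (A v + B v)) ∧
      B v = multiplier (pB v) (phaseSin (A v + B v) - phaseSin (B v)) := by
  have hc : ∀ v ∈ s, ContractingWith (1 / 2) (iterationMap (pA v) (pB v)) := fun v hv =>
    contractingWith_iterationMap (hpA v hv) hqA (hpB v hv) hqB hε hβ hε4 hβε
  have hex : ∀ v, ∃ z, v ∈ s → iterationMap (pA v) (pB v) z = z := fun v => by
    by_cases hv : v ∈ s
    · exact ⟨(hc v hv).fixedPoint, fun _ => (hc v hv).fixedPoint_isFixedPt⟩
    · exact ⟨0, fun h => absurd h hv⟩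
  choose z hz using hex
  have hzc : ContinuousOn z s := by
    intro v hv
    have h1 : ContinuousOn (fun w => iterationMap (pA w) (pB w) (z v)) s := by
      have hA : ContinuousOn
          (fun w => multiplier (pA w) (phaseSin ((z v).1 + (z v).2))) s :=
        continuousOn_multiplier hpA hqA hcA _
      exact hA.prodMk (continuousOn_multiplier_comp hpB hqB hcB
        ((continuous_phaseSin.comp_continuousOn (hA.add continuousOn_const)).sub
          continuousOn_const))
    have h2 := h1 v hv
    rw [ContinuousWithinAt, hz v hv] at h2
    rw [ContinuousWithinAt, tendsto_iff_dist_tendsto_zero]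
    refine squeeze_zero' (g := fun w => dist (iterationMap (pA w) (pB w) (z v)) (z v) * 2)
      (.of_forall fun _ => dist_nonneg) ?_ ?_
    · filter_upwards [self_mem_nhdsWithin] with w hw
      have := (hc w hw).dist_le_of_fixedPoint (z v) (y := z w) (hz w hw)
      rw [dist_comm, dist_comm _ (z v)]
      refine this.trans (le_of_eq ?_)
      push_cast
      ring
    · simpa using (tendsto_iff_dist_tendsto_zero.1 h2).mul_const 2
  refine ⟨fun v => (z v).1, fun v => (z v).2, continuous_fst.comp_continuousOn hzc,
    continuous_snd.comp_continuousOn hzc, fun v hv => ?_⟩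
  have h1 : (z v).1 = multiplier (pA v) (phaseSin ((z v).1 + (z v).2)) :=
    (congrArg Prod.fst (hz v hv)).symm
  have h2 := (congrArg Prod.snd (hz v hv)).symm
  simp only [iterationMap, ← h1] at h2
  exact ⟨h1, h2⟩

lemma fourier_apply_add (k : ℤ) (x y : PhaseCircle) :
    fourier k (x + y) = fourier k x * fourier k y := by
  simp only [fourier_apply, smul_add, AddCircle.toCircle_add, Circle.coe_mul]

lemma fourierCoeff_eq_zero_of_shift {u : PhaseCircle → ℂ} {a : PhaseCircle} {μ : ℂ} {k : ℤ}
    (hu : ∀ x, u (x + a) = μ * u x) (hμ : μ ≠ 1) (hk : fourier k a = 1) :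
    fourierCoeff u k = 0 := by
  have hk' : fourier (-k) a = 1 := by rw [fourier_neg, hk, map_one]
  have h1 : fourierCoeff u k = μ * fourierCoeff u k := by
    calc fourierCoeff u k
        = ∫ x, fourier (-k) (x + a) • u (x + a) ∂(AddCircle.haarAddCircle (T := 2 * π)) :=
          (integral_add_right_eq_self (fun x => fourier (-k) x • u x) a).symm
      _ = ∫ x, μ * (fourier (-k) x • u x) ∂(AddCircle.haarAddCircle (T := 2 * π)) := by
          congr 1; ext x
          rw [fourier_apply_add, hk', hu, smul_eq_mul, smul_eq_mul]; ring
      _ = μ * fourierCoeff u k := integral_const_mul _ _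
  have h2 : (1 - μ) * fourierCoeff u k = 0 := by linear_combination h1
  exact (mul_eq_zero.1 h2).resolve_left (sub_ne_zero.2 hμ.symm)

lemma phaseSin_eq_complex (g : C(PhaseCircle, ℝ)) (x : PhaseCircle) :
    (phaseSin g x : ℂ) = -(Complex.I / 2) * (fourier 1 x * Complex.exp (Complex.I * g x)) +
      Complex.I / 2 * (fourier (-1) x * Complex.exp (-(Complex.I * g x))) := by
  induction x using QuotientAddGroup.induction_on with
  | H x =>
    rw [phaseSin_apply_coe, fourier_apply_coe, fourier_apply_coe, ← Complex.exp_add,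
      ← Complex.exp_add, Complex.ofReal_sin, Complex.sin]
    push_cast
    rw [show -((x : ℂ) + (g x : ℂ)) * Complex.I = Complex.I * -1 * x + -(Complex.I * g x) by ring,
      show ((x : ℂ) + (g x : ℂ)) * Complex.I = Complex.I * 1 * x + Complex.I * g x by ring]
    ring

lemma coeff_phaseSin_eq_zero {g : C(PhaseCircle, ℝ)} {a : PhaseCircle} {k : ℤ}
    (hg : ∀ x, g (x + a) = g x) (ha : fourier 1 a ≠ 1) (hk : fourier k a = 1) :
    coeff (phaseSin g) k = 0 := by
  set E : PhaseCircle → ℂ := fun x => fourier 1 x * Complex.exp (Complex.I * g x) with hE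
  set E' : PhaseCircle → ℂ := fun x => fourier (-1) x * Complex.exp (-(Complex.I * g x)) with hE'
  have ha' : fourier (-1) a ≠ 1 := by
    rw [fourier_neg]
    intro h
    exact ha (by simpa using congrArg (starRingEnd ℂ) h)
  have h1 : fourierCoeff E k = 0 := by
    refine fourierCoeff_eq_zero_of_shift (μ := fourier 1 a) (fun x => ?_) ha hk
    simp only [hE]
    rw [fourier_apply_add, hg]; ring
  have h2 : fourierCoeff E' k = 0 := by
    refine fourierCoeff_eq_zero_of_shift (μ := fourier (-1) a) (fun x => ?_) ha' hk
    simp only [hE']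
    rw [fourier_apply_add, hg]; ring
  have i1 : Integrable E (AddCircle.haarAddCircle (T := 2 * π)) := by
    have : Continuous E := by fun_prop
    exact this.integrable_of_hasCompactSupport (HasCompactSupport.of_compactSpace _)
  have i2 : Integrable E' (AddCircle.haarAddCircle (T := 2 * π)) := by
    have : Continuous E' := by fun_prop
    exact this.integrable_of_hasCompactSupport (HasCompactSupport.of_compactSpace _)
  have h3 : (fun x => (phaseSin g x : ℂ)) =
      (fun x => -(Complex.I / 2) * E x) + fun x => Complex.I / 2 * E' x := by
    ext x; exact phaseSin_eq_complex g x
  rw [coeff, h3, fourierCoeff.add (i1.const_mul _) (i2.const_mul _), Pi.add_apply,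
    fourierCoeff.const_mul, fourierCoeff.const_mul, h1, h2]
  simp

/-- The rotation angle `2πm/n` between neighbouring sites. -/
noncomputable def siteAngle (n m : ℕ) : ℝ := 2 * π * (m / n)

lemma cos_mul_siteAngle_eq_one_iff {n : ℕ} (hn : 1 ≤ n) (m : ℕ) (k : ℤ) :
    cos (k * siteAngle n m) = 1 ↔ (n : ℤ) ∣ k * m := by
  have hn0 : (n : ℝ) ≠ 0 := by positivity
  have hpi := Real.pi_ne_zero
  rw [Real.cos_eq_one_iff]
  constructor
  · rintro ⟨j, hj⟩
    refine ⟨j, ?_⟩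
    rw [siteAngle] at hj
    field_simp at hj
    have : (k * m : ℝ) = n * j := by linarith
    exact_mod_cast this
  · rintro ⟨j, hj⟩
    refine ⟨j, ?_⟩
    have : (k * m : ℝ) = n * j := by exact_mod_cast hj
    rw [siteAngle]
    field_simp
    linarith

lemma fourier_siteAngle_eq_one_iff {n : ℕ} (hn : 1 ≤ n) (m : ℕ) (k : ℤ) :
    fourier k (siteAngle n m : PhaseCircle) = 1 ↔ (n : ℤ) ∣ k * m := by
  rw [← cos_mul_siteAngle_eq_one_iff hn, fourier_apply_coe,
    show Complex.I * k * (siteAngle n m : ℂ) = ((k * siteAngle n m : ℝ) : ℂ) * Complex.I by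
      push_cast; ring]
  constructor
  · intro h
    rw [← Complex.exp_ofReal_mul_I_re, h, Complex.one_re]
  · intro h
    have hs : sin (k * siteAngle n m) = 0 := by
      have := Real.sin_sq_add_cos_sq (k * siteAngle n m)
      rw [h] at this
      nlinarith
    apply Complex.ext
    · rw [Complex.exp_ofReal_mul_I_re, h, Complex.one_re]
    · rw [Complex.exp_ofReal_mul_I_im, hs, Complex.one_im]

/-- The discrete Laplacian is bounded below on the non-resonant modes. -/
lemma exists_gap {n : ℕ} (hn : 1 ≤ n) (m : ℕ) :
    ∃ c : ℝ, 0 < c ∧ ∀ k : ℤ, ¬ (n : ℤ) ∣ k * m → c ≤ 2 - 2 * cos (k * siteAngle n m) := by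
  have hn0 : (n : ℤ) ≠ 0 := by positivity
  have hfin : ∃ c : ℝ, 0 < c ∧ ∀ r ∈ Finset.range n, ¬ (n : ℤ) ∣ (r : ℤ) * m →
      c ≤ 2 - 2 * cos (((r : ℤ) : ℝ) * siteAngle n m) := by
    induction Finset.range n using Finset.induction_on with
    | empty => exact ⟨1, one_pos, by simp⟩
    | insert r s _ ih =>
      obtain ⟨c, hc, h⟩ := ih
      by_cases hr : (n : ℤ) ∣ (r : ℤ) * m
      · refine ⟨c, hc, fun j hj hjn => ?_⟩
        rcases Finset.mem_insert.1 hj with rfl | hj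
        · exact absurd hr hjn
        · exact h j hj hjn
      · have hlt : cos (((r : ℤ) : ℝ) * siteAngle n m) < 1 :=
          lt_of_le_of_ne (cos_le_one _) (mt (cos_mul_siteAngle_eq_one_iff hn m r).1 hr)
        refine ⟨min c (2 - 2 * cos (((r : ℤ) : ℝ) * siteAngle n m)),
          lt_min hc (by linarith), fun j hj hjn => ?_⟩
        rcases Finset.mem_insert.1 hj with rfl | hj
        · exact min_le_right _ _
        · exact (min_le_left _ _).trans (h j hj hjn)
  obtain ⟨c, hc, h⟩ := hfin
  refine ⟨c, hc, fun k hk => ?_⟩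
  have hr0 := Int.emod_nonneg k hn0
  have hrn := Int.emod_lt_of_pos k (by positivity : (0 : ℤ) < n)
  obtain ⟨r, hr⟩ := Int.eq_ofNat_of_zero_le hr0
  have hkr : k = r + n * (k / n) := by rw [← hr]; exact (Int.emod_add_mul_ediv k n).symm
  have hcos : cos (k * siteAngle n m) = cos (((r : ℤ) : ℝ) * siteAngle n m) := by
    have e : (k : ℝ) * siteAngle n m =
        ((r : ℤ) : ℝ) * siteAngle n m + ((k / n * m : ℤ) : ℝ) * (2 * π) := by
      have hnR : (n : ℝ) ≠ 0 := by positivity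
      have : (k : ℝ) = r + n * ((k / n : ℤ) : ℝ) := by exact_mod_cast hkr
      rw [this, siteAngle]
      push_cast
      field_simp
    rw [e, Real.cos_add_int_mul_two_pi]
  rw [hcos]
  refine h r (Finset.mem_range.2 (by omega)) fun hd => hk ?_
  rw [hkr, add_mul, mul_assoc]
  exact dvd_add hd (dvd_mul_right _ _)

/-- The Fourier symbol of `v² ∂² + Γ v ∂ - K Δ`, where `Δ` is the second difference with step
`a`. -/
noncomputable def symbol (K Γ v a : ℝ) (k : ℤ) : ℂ :=
  ⟨K * (2 - 2 * cos (k * a)) - v ^ 2 * k ^ 2, Γ * v * k⟩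

lemma le_norm_symbol {Γ v b : ℝ} (hbv : b ≤ Γ * v) (K a : ℝ) (k : ℤ) :
    b * |(k : ℝ)| ≤ ‖symbol K Γ v a k‖ := by
  refine le_trans ?_ (Complex.abs_im_le_norm _)
  change _ ≤ |Γ * v * k|
  rw [abs_mul]
  gcongr
  exact hbv.trans (le_abs_self _)

lemma le_norm_symbol_of_gap {K Γ Γ₀ v a c lam : ℝ} {k : ℤ} (hK : 0 ≤ K) (hΓ₀ : 0 < Γ₀)
    (hΓ : Γ₀ ≤ Γ) (hv : 0 < v) (hlam : 0 < lam) (hc : c ≤ 2 - 2 * cos (k * a))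
    (hKc : 2 * (lam + (lam / Γ₀) ^ 2) ≤ K * c) : lam ≤ ‖symbol K Γ v a k‖ := by
  have hsq : 0 ≤ (lam / Γ₀) ^ 2 := by positivity
  rcases le_total ((v * |(k : ℝ)|) ^ 2) ((lam / Γ₀) ^ 2) with h | h
  · refine le_trans ?_ ((le_abs_self _).trans (Complex.abs_re_le_norm _))
    change _ ≤ K * (2 - 2 * cos (k * a)) - v ^ 2 * k ^ 2
    rw [mul_pow, sq_abs] at h
    have := mul_le_mul_of_nonneg_left hc hK
    linarith
  · have h1 : lam / Γ₀ ≤ v * |(k : ℝ)| := le_of_sq_le_sq h (by positivity)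
    rw [div_le_iff₀ hΓ₀] at h1
    have h2 := le_norm_symbol (b := Γ₀ * v) (by gcongr : Γ₀ * v ≤ Γ * v) K a k
    linarith

lemma sq_le_norm_symbol {K Γ v a : ℝ} {k : ℤ} (hK : 0 ≤ K) (hΓv : 0 < Γ * v) (hk : k ≠ 0) :
    v ^ 2 * (k : ℝ) ^ 2 ≤ (1 + 4 * K / (Γ * v)) * ‖symbol K Γ v a k‖ := by
  have h1 : -(K * (2 - 2 * cos (k * a)) - v ^ 2 * k ^ 2) ≤ ‖symbol K Γ v a k‖ :=
    (neg_le_abs _).trans (Complex.abs_re_le_norm (symbol K Γ v a k))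
  have h2 : Γ * v ≤ ‖symbol K Γ v a k‖ := by
    have hk1 : (1 : ℝ) ≤ |(k : ℝ)| := by exact_mod_cast Int.one_le_abs hk
    nlinarith [le_norm_symbol (Γ := Γ) (v := v) le_rfl K a k]
  have h3 : 4 * K ≤ 4 * K / (Γ * v) * ‖symbol K Γ v a k‖ := by
    rw [div_mul_eq_mul_div, le_div_iff₀ hΓv]
    gcongr
  have h4 : K * (2 - 2 * cos (k * a)) ≤ K * 4 := by
    gcongr
    linarith [neg_one_le_cos (k * a)]
  linarith

lemma symbol_ne_zero {K Γ v a : ℝ} {k : ℤ} (hΓv : 0 < Γ * v) (hk : k ≠ 0) :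
    symbol K Γ v a k ≠ 0 := by
  have h := le_norm_symbol (Γ := Γ) (v := v) le_rfl K a k
  have hk1 : (0 : ℝ) < |(k : ℝ)| := by positivity
  exact norm_pos_iff.1 (lt_of_lt_of_le (by positivity) h)

lemma symbol_zero (K Γ v a : ℝ) : symbol K Γ v a 0 = 0 := by
  apply Complex.ext <;> simp [symbol]

lemma continuous_symbol (K Γ a : ℝ) (k : ℤ) : Continuous fun v => symbol K Γ v a k := by
  have : (fun v => symbol K Γ v a k) = fun v : ℝ =>
      ((K * (2 - 2 * cos (k * a)) - v ^ 2 * k ^ 2 : ℝ) : ℂ) +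
        ((Γ * v * k : ℝ) : ℂ) * Complex.I := by
    ext v; exact Complex.mk_eq_add_mul_I _ _
  rw [this]
  fun_prop

lemma continuousOn_neg_inv_symbol {K Γ a : ℝ} {s : Set ℝ} (hs : ∀ v ∈ s, 0 < Γ * v) (k : ℤ) :
    ContinuousOn (fun v => -(symbol K Γ v a k)⁻¹) s := by
  rcases eq_or_ne k 0 with rfl | hk
  · simp only [symbol_zero]
    exact continuousOn_const
  · exact ((continuous_symbol K Γ a k).continuousOn.inv₀
      fun v hv => symbol_ne_zero (hs v hv) hk).neg

lemma norm_sq_neg_inv_symbol_le {Γ v b : ℝ} (hb : 0 < b) (hbv : b ≤ Γ * v) (K a : ℝ) (k : ℤ) :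
    ‖-(symbol K Γ v a k)⁻¹‖ ^ 2 ≤ (b ^ 2)⁻¹ * |(k : ℝ)| ^ (-2 : ℝ) := by
  rcases eq_or_ne k 0 with rfl | hk
  · simp [symbol_zero]
  · have hk1 : (0 : ℝ) < |(k : ℝ)| := by positivity
    rw [norm_neg, norm_inv, inv_pow, Real.rpow_neg hk1.le, Real.rpow_ofNat, ← mul_inv, ← mul_pow]
    gcongr
    exact le_norm_symbol hbv K a k

lemma norm_sq_neg_inv_symbol_le_of_le {K Γ v a b lam : ℝ} {k : ℤ} (hb : 0 < b)
    (hbv : b ≤ Γ * v) (hlam : 0 < lam) (hL : lam ≤ ‖symbol K Γ v a k‖) :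
    ‖-(symbol K Γ v a k)⁻¹‖ ^ 2 ≤
      lam ^ (-(1 / 2) : ℝ) * (b ^ (-(3 / 2) : ℝ) * |(k : ℝ)| ^ (-(3 / 2) : ℝ)) := by
  have hk : k ≠ 0 := by
    rintro rfl
    rw [symbol_zero, norm_zero] at hL
    linarith
  have hk1 : (0 : ℝ) < |(k : ℝ)| := by positivity
  have hX : 0 < ‖symbol K Γ v a k‖ := hlam.trans_le hL
  have e : ‖-(symbol K Γ v a k)⁻¹‖ ^ 2 =
      ‖symbol K Γ v a k‖ ^ (-(1 / 2) : ℝ) * ‖symbol K Γ v a k‖ ^ (-(3 / 2) : ℝ) := by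
    rw [← Real.rpow_add hX, norm_neg, norm_inv, inv_pow, ← Real.rpow_ofNat, ← Real.rpow_neg hX.le]
    norm_num
  rw [e, ← Real.mul_rpow hb.le hk1.le]
  gcongr ?_ * ?_
  · exact Real.rpow_le_rpow_of_nonpos hlam hL (by norm_num)
  · exact Real.rpow_le_rpow_of_nonpos (by positivity) (le_norm_symbol hbv K a k) (by norm_num)

lemma summable_abs_rpow_neg_two : Summable fun k : ℤ => |(k : ℝ)| ^ (-2 : ℝ) :=
  Real.summable_abs_int_rpow (by norm_num)

lemma hasDerivAt_fourier_re (c : ℂ) (k : ℤ) (x : ℝ) :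
    HasDerivAt (fun y : ℝ => (c * fourier k (y : PhaseCircle)).re)
      (Complex.I * k * c * fourier k (x : PhaseCircle)).re x := by
  simp only [fourier_apply_coe]
  have h1 : HasDerivAt (fun y : ℝ => Complex.I * k * (y : ℂ)) (Complex.I * k * 1) x :=
    (Complex.ofRealCLM.hasDerivAt (x := x)).const_mul _
  have h2 := (h1.cexp.const_mul c)
  have h3 := Complex.reCLM.hasFDerivAt.comp_hasDerivAt x h2
  refine h3.congr_deriv ?_
  rw [Complex.reCLM_apply]
  congr 1
  ring

lemma hasDerivAt_synth {c : ℤ → ℂ} (hc : Summable fun k => ‖c k‖)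
    (hc' : Summable fun k => ‖Complex.I * k * c k‖) (x : ℝ) :
    HasDerivAt (fun y : ℝ => synth c (y : PhaseCircle))
      (synth (fun k => Complex.I * k * c k) (x : PhaseCircle)) x := by
  have h1 := hasDerivAt_tsum hc' (fun k y => hasDerivAt_fourier_re (c k) k y) (fun k y => ?_)
    (hasSum_synth hc (0 : ℝ)).summable x
  · rw [(hasSum_synth hc' x).tsum_eq] at h1
    have e : (fun y : ℝ => synth c (y : PhaseCircle)) =
        fun y : ℝ => ∑' k, (c k * fourier k (y : PhaseCircle)).re :=
      funext fun y => (hasSum_synth hc y).tsum_eq.symm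
    rw [e]
    exact h1
  · refine (Complex.abs_re_le_norm _).trans ?_
    rw [norm_mul, norm_fourier_apply, mul_one]

lemma coeff_deriv {h h' : C(PhaseCircle, ℝ)}
    (hh : ∀ x : ℝ, HasDerivAt (fun y : ℝ => h (y : PhaseCircle)) (h' (x : PhaseCircle)) x)
    (k : ℤ) : coeff h' k = Complex.I * k * coeff h k := by
  have hc (u : C(PhaseCircle, ℝ)) :
      IntervalIntegrable (fun x : ℝ => fourier (-k) (x : PhaseCircle) • (u x : ℂ)) volume 0
        (0 + 2 * π) := by
    refine Continuous.intervalIntegrable ?_ _ _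
    have : Continuous fun x : PhaseCircle => fourier (-k) x • (u x : ℂ) := by fun_prop
    exact this.comp (AddCircle.continuous_mk' _)
  have hd : ∀ x : ℝ, HasDerivAt (fun y : ℝ => fourier (-k) (y : PhaseCircle) • (h y : ℂ))
      (fourier (-k) (x : PhaseCircle) • (h' x : ℂ) -
        Complex.I * k * (fourier (-k) (x : PhaseCircle) • (h x : ℂ))) x := by
    intro x
    have h1 : HasDerivAt (fun y : ℝ => Complex.I * ((-k : ℤ) : ℂ) * (y : ℂ))
        (Complex.I * ((-k : ℤ) : ℂ) * 1) x :=
      (Complex.ofRealCLM.hasDerivAt (x := x)).const_mul _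
    have h2 := h1.cexp.mul (hh x).ofReal_comp
    simp only [smul_eq_mul, fourier_apply_coe]
    refine h2.congr_deriv ?_
    push_cast
    ring
  have hintegral := intervalIntegral.integral_eq_sub_of_hasDerivAt (a := 0) (b := 0 + 2 * π)
    (fun x _ => hd x) ((hc h').sub ((hc h).const_mul _))
  rw [intervalIntegral.integral_sub (hc h') ((hc h).const_mul _),
    intervalIntegral.integral_const_mul, AddCircle.coe_add_period, sub_self, sub_eq_zero]
    at hintegral
  rw [coeff, coeff, fourierCoeff_eq_intervalIntegral _ _ 0, fourierCoeff_eq_intervalIntegral _ _ 0,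
    hintegral, mul_smul_comm]

lemma hasSum_coeff {h : C(PhaseCircle, ℝ)} (hs : Summable fun k => ‖coeff h k‖)
    (x : PhaseCircle) : HasSum (fun k => (coeff h k * fourier k x).re) (h x) := by
  let u : C(PhaseCircle, ℂ) := ⟨fun x => (h x : ℂ), by fun_prop⟩
  have h1 : Summable (fourierCoeff u) := Summable.of_norm hs
  exact Complex.hasSum_re (has_pointwise_sum_fourier_series_of_summable h1 x)

lemma exists_hasDerivAt_phaseSin {g g' : C(PhaseCircle, ℝ)}
    (hg : ∀ x : ℝ, HasDerivAt (fun y : ℝ => g (y : PhaseCircle)) (g' (x : PhaseCircle)) x) :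
    ∃ h' : C(PhaseCircle, ℝ), ∀ x : ℝ,
      HasDerivAt (fun y : ℝ => phaseSin g (y : PhaseCircle)) (h' (x : PhaseCircle)) x := by
  refine ⟨⟨fun x => ((fourier 1 x).re * cos (g x) - (fourier 1 x).im * sin (g x)) * (1 + g' x),
    by fun_prop⟩, fun x => ?_⟩
  have h1 := ((hasDerivAt_id x).add (hg x)).sin
  simp only [phaseSin_apply_coe]
  refine h1.congr_deriv ?_
  have e : fourier 1 (x : PhaseCircle) = Complex.exp (x * Complex.I) := by
    rw [fourier_apply_coe]; congr 1; push_cast; ring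
  change cos (x + g x) * (1 + g' x) = ((fourier 1 (x : PhaseCircle)).re * cos (g x) -
    (fourier 1 (x : PhaseCircle)).im * sin (g x)) * (1 + g' x)
  rw [e, Complex.exp_ofReal_mul_I_re, Complex.exp_ofReal_mul_I_im, cos_add]

lemma norm_sq_mul_inv_symbol_le {K Γ v : ℝ} (hK : 0 ≤ K) (hv : 0 < v) (hΓv : 0 < Γ * v) (a : ℝ)
    (k : ℤ) : ‖Complex.I * k * -(symbol K Γ v a k)⁻¹‖ ^ 2 ≤
      ((1 + 4 * K / (Γ * v)) / v ^ 2) ^ 2 * |(k : ℝ)| ^ (-2 : ℝ) := by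
  rcases eq_or_ne k 0 with rfl | hk
  · simp
  have hk1 : (0 : ℝ) < |(k : ℝ)| := by positivity
  have hL : 0 < ‖symbol K Γ v a k‖ := norm_pos_iff.2 (symbol_ne_zero hΓv hk)
  have h := sq_le_norm_symbol (a := a) hK hΓv hk
  rw [Real.rpow_neg hk1.le, Real.rpow_ofNat, ← inv_pow, ← mul_pow]
  gcongr
  rw [norm_mul, norm_mul, Complex.norm_I, one_mul, norm_neg, norm_inv, Complex.norm_intCast,
    ← div_eq_mul_inv, ← div_eq_mul_inv, div_div, div_le_div_iff₀ hL (by positivity)]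
  rw [← sq_abs (k : ℝ)] at h
  linarith

/-- The convolution inverse of `v² ∂² + Γ v ∂ - K Δ` gains one derivative on continuous
functions. -/
lemma hasDerivAt_multiplier {K Γ v : ℝ} (hK : 0 ≤ K) (hv : 0 < v) (hΓv : 0 < Γ * v) (a : ℝ)
    (h : C(PhaseCircle, ℝ)) (x : ℝ) :
    HasDerivAt
      (fun y : ℝ => multiplier (fun k => -(symbol K Γ v a k)⁻¹) h (y : PhaseCircle))
      (multiplier (fun k => Complex.I * k * -(symbol K Γ v a k)⁻¹) h (x : PhaseCircle)) x := by
  have h1 := summable_norm_mul_coeff (norm_sq_neg_inv_symbol_le hΓv le_rfl K a)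
    (summable_abs_rpow_neg_two.mul_left _) h
  have h2 := summable_norm_mul_coeff (norm_sq_mul_inv_symbol_le hK hv hΓv a)
    (summable_abs_rpow_neg_two.mul_left _) h
  have := hasDerivAt_synth h1 (by simpa only [mul_assoc] using h2) x
  simpa only [multiplier, mul_assoc] using this

lemma summable_norm_coeff_of_hasDerivAt {h h' : C(PhaseCircle, ℝ)}
    (hh : ∀ x : ℝ, HasDerivAt (fun y : ℝ => h (y : PhaseCircle)) (h' (x : PhaseCircle)) x) :
    Summable fun k => ‖coeff h k‖ := by
  have h1 := summable_norm_mul_coeff (p := fun k : ℤ => (k : ℂ)⁻¹)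
    (q := fun k => |(k : ℝ)| ^ (-2 : ℝ)) (fun k => ?_) summable_abs_rpow_neg_two h'
  · refine .of_nonneg_of_le (fun _ => norm_nonneg _) (fun k => ?_)
      (h1.add (hasSum_ite_eq (0 : ℤ) ‖coeff h 0‖).summable)
    rcases eq_or_ne k 0 with rfl | hk
    · simp
    · have hk' : (k : ℂ) ≠ 0 := by exact_mod_cast hk
      have e : (k : ℂ)⁻¹ * coeff h' k = Complex.I * coeff h k := by
        rw [coeff_deriv hh]; field_simp
      simp [e, hk]
  · rw [Real.rpow_neg (abs_nonneg _), Real.rpow_ofNat, norm_inv, Complex.norm_intCast, inv_pow]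

lemma hasSum_unique_of_eq {f g : ℤ → ℝ} {a b : ℝ} (hf : HasSum f a) (hg : HasSum g b)
    (h : ∀ k, f k = g k) : a = b :=
  hf.unique (funext h ▸ hg)

lemma exists_second_derivative {K Γ v : ℝ} (hK : 0 ≤ K) (hv : 0 < v) (hΓv : 0 < Γ * v) (a : ℝ)
    {g h h' : C(PhaseCircle, ℝ)} (hg : g = multiplier (fun k => -(symbol K Γ v a k)⁻¹) h)
    (hh : ∀ x : ℝ, HasDerivAt (fun y : ℝ => h (y : PhaseCircle)) (h' (x : PhaseCircle)) x) :
    ∃ g₁ g₂ : C(PhaseCircle, ℝ),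
      (∀ x : ℝ, HasDerivAt (fun y : ℝ => g (y : PhaseCircle)) (g₁ (x : PhaseCircle)) x) ∧
      (∀ x : ℝ, HasDerivAt (fun y : ℝ => g₁ (y : PhaseCircle)) (g₂ (x : PhaseCircle)) x) ∧
      ∀ x : ℝ, v ^ 2 * g₂ x + Γ * v * g₁ x + h x = (coeff h 0).re +
        K * (g ((x + a : ℝ) : PhaseCircle) - 2 * g x + g ((x - a : ℝ) : PhaseCircle)) := by
  set c : ℤ → ℂ := fun k => -(symbol K Γ v a k)⁻¹ * coeff h k with hc
  have s0 : Summable fun k => ‖c k‖ :=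
    summable_norm_mul_coeff (norm_sq_neg_inv_symbol_le hΓv le_rfl K a)
      (summable_abs_rpow_neg_two.mul_left _) h
  have s1 : Summable fun k => ‖Complex.I * k * c k‖ := by
    have := summable_norm_mul_coeff (norm_sq_mul_inv_symbol_le hK hv hΓv a)
      (summable_abs_rpow_neg_two.mul_left _) h
    simpa only [hc, mul_assoc] using this
  have s2 : Summable fun k => ‖Complex.I * k * (Complex.I * k * c k)‖ := by
    have := summable_norm_mul_coeff (norm_sq_mul_inv_symbol_le hK hv hΓv a)
      (summable_abs_rpow_neg_two.mul_left _) h'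
    refine this.congr fun k => ?_
    rw [coeff_deriv hh]
    congr 1
    simp only [hc]
    ring
  have hgc : g = synth c := hg
  refine ⟨synth fun k => Complex.I * k * c k, synth fun k => Complex.I * k * (Complex.I * k * c k),
    fun x => hgc ▸ hasDerivAt_synth s0 s1 x, hasDerivAt_synth s1 s2, fun x => ?_⟩
  rw [hgc]
  have t1 := ((hasSum_synth s2 x).mul_left (v ^ 2)).add ((hasSum_synth s1 x).mul_left (Γ * v))
  have t2 := (((hasSum_synth s0 ((x + a : ℝ) : PhaseCircle)).sub
    ((hasSum_synth s0 x).mul_left 2)).add (hasSum_synth s0 ((x - a : ℝ) : PhaseCircle))).mul_left K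
  have t3 := hasSum_coeff (summable_norm_coeff_of_hasDerivAt hh) x
  have t4 := hasSum_ite_eq (0 : ℤ) (coeff h 0).re
  refine hasSum_unique_of_eq (t1.add t3) (t4.add t2) fun k => ?_
  have key : -(v : ℂ) ^ 2 * k ^ 2 * c k + Complex.I * Γ * v * k * c k + coeff h k =
      (if k = 0 then coeff h 0 else 0) + K * (2 * Complex.cos (k * a) - 2) * c k := by
    have hsym : symbol K Γ v a k = K * (2 - 2 * Complex.cos (k * a)) - v ^ 2 * k ^ 2 +
        Γ * v * k * Complex.I := by
      rw [symbol, Complex.mk_eq_add_mul_I]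
      push_cast
      ring
    have hsc : symbol K Γ v a k * c k = -coeff h k + if k = 0 then coeff h 0 else 0 := by
      rcases eq_or_ne k 0 with rfl | hk
      · simp [symbol_zero]
      · have := symbol_ne_zero (K := K) (a := a) hΓv hk
        simp only [hc, hk, if_false]
        field_simp
        ring
    rw [hsym] at hsc
    linear_combination hsc
  have key2 := congrArg (fun z => (z * fourier k (x : PhaseCircle)).re) key
  have hite : ((if k = 0 then coeff h 0 else 0) * fourier k (x : PhaseCircle)).re =
      if k = 0 then (coeff h 0).re else 0 := by
    split_ifs with hk
    · rw [hk, fourier_zero, mul_one]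
    · simp
  have hshift : (c k * fourier k ((x + a : ℝ) : PhaseCircle)).re -
      2 * (c k * fourier k (x : PhaseCircle)).re +
      (c k * fourier k ((x - a : ℝ) : PhaseCircle)).re =
      ((2 * Complex.cos (k * a) - 2) * c k * fourier k (x : PhaseCircle)).re := by
    have : (2 * Complex.cos (k * a) - 2) * c k * fourier k (x : PhaseCircle) =
        c k * fourier k ((x + a : ℝ) : PhaseCircle) -
        ((2 : ℝ) : ℂ) * (c k * fourier k (x : PhaseCircle)) +
        c k * fourier k ((x - a : ℝ) : PhaseCircle) := by
      simp only [fourier_apply_coe, Complex.cos]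
      push_cast
      rw [mul_add, mul_sub, sub_eq_add_neg (Complex.I * k * (x : ℂ)), Complex.exp_add,
        Complex.exp_add, show (k : ℂ) * a * Complex.I = Complex.I * k * a by ring,
        show -((k : ℂ) * a) * Complex.I = -(Complex.I * k * a) by ring]
      ring
    rw [this, Complex.add_re, Complex.sub_re, Complex.re_ofReal_mul]
  rw [hshift, ← hite, ← Complex.re_ofReal_mul, ← Complex.re_ofReal_mul, ← Complex.re_ofReal_mul,
    ← Complex.add_re, ← Complex.add_re, ← Complex.add_re]
  convert key2 using 2
  · push_cast
    linear_combination (v : ℂ) ^ 2 * k ^ 2 * c k * fourier k (x : PhaseCircle) * Complex.I_sq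
  · ring

lemma continuous_coeff (k : ℤ) : Continuous fun h => coeff h k := by
  refine LipschitzWith.continuous (K := 1) (LipschitzWith.of_dist_le_mul fun g h => ?_)
  rw [dist_eq_norm, dist_eq_norm, ← coeff_sub, NNReal.coe_one, one_mul]
  exact norm_coeff_le _ _

lemma multiplier_apply_add {p : ℤ → ℂ} {q : ℤ → ℝ} (hp : ∀ k, ‖p k‖ ^ 2 ≤ q k)
    (hq : Summable q) {a : PhaseCircle} (ha : ∀ k, p k = 0 ∨ fourier k a = 1)
    (h : C(PhaseCircle, ℝ)) (x : PhaseCircle) : multiplier p h (x + a) = multiplier p h x := by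
  have hs := summable_norm_mul_coeff hp hq h
  refine hasSum_unique_of_eq (hasSum_synth hs (x + a)) (hasSum_synth hs x) fun k => ?_
  rcases ha k with h0 | h1
  · simp [h0]
  · rw [fourier_apply_add, h1, mul_one]

/-- A `2π`-periodic fixed point of the integral equation gives a waveform. -/
lemma isWaveform_of_multiplier {n m : ℕ} {K Γ F v : ℝ} (hK : 0 ≤ K) (hv : 0 < v)
    (hΓv : 0 < Γ * v) {g : C(PhaseCircle, ℝ)}
    (hg : g = multiplier (fun k => -(symbol K Γ v (siteAngle n m) k)⁻¹) (phaseSin g))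
    (hF : Γ * v + (coeff (phaseSin g) 0).re = F) :
    IsWaveform n m Γ K F v (fun t => v * t + g ((v * t : ℝ) : PhaseCircle)) := by
  have hg1 : ∀ x : ℝ, HasDerivAt (fun y : ℝ => g (y : PhaseCircle))
      (multiplier (fun k => Complex.I * k * -(symbol K Γ v (siteAngle n m) k)⁻¹) (phaseSin g)
        (x : PhaseCircle)) x := fun x => by
    have := hasDerivAt_multiplier hK hv hΓv (siteAngle n m) (phaseSin g) x
    rwa [← hg] at this
  obtain ⟨h', hh'⟩ := exists_hasDerivAt_phaseSin hg1
  obtain ⟨g₁, g₂, hd1, hd2, heq⟩ := exists_second_derivative hK hv hΓv (siteAngle n m) hg hh'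
  have hlin : ∀ t : ℝ, HasDerivAt (fun t : ℝ => v * t) v t := fun t => by
    simpa using (hasDerivAt_id t).const_mul v
  have hf1 : ∀ t : ℝ, HasDerivAt (fun t : ℝ => v * t + g ((v * t : ℝ) : PhaseCircle))
      (v + g₁ ((v * t : ℝ) : PhaseCircle) * v) t := fun t =>
    (hlin t).add ((hd1 (v * t)).comp t (hlin t))
  have hf2 : ∀ t : ℝ, HasDerivAt (fun t : ℝ => v + g₁ ((v * t : ℝ) : PhaseCircle) * v)
      (g₂ ((v * t : ℝ) : PhaseCircle) * v * v) t := fun t =>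
    (((hd2 (v * t)).comp t (hlin t)).mul_const v).const_add v
  have e1 := funext fun t => (hf1 t).deriv
  have e2 := funext fun t => (hf2 t).deriv
  refine ⟨?_, fun t => ?_, fun t => ?_⟩
  · have hc : Continuous fun t : ℝ => g₂ ((v * t : ℝ) : PhaseCircle) * v * v := by
      have : Continuous fun t : ℝ => ((v * t : ℝ) : PhaseCircle) :=
        (AddCircle.continuous_mk' _).comp (continuous_const.mul continuous_id)
      fun_prop
    rw [show (2 : WithTop ℕ∞) = 1 + 1 by norm_num, contDiff_succ_iff_deriv]
    refine ⟨fun t => (hf1 t).differentiableAt, by simp, ?_⟩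
    rw [e1, contDiff_one_iff_deriv, e2]
    exact ⟨fun t => (hf2 t).differentiableAt, hc⟩
  · have e : v * (t + 2 * π / v) = v * t + 2 * π := by field_simp
    simp only [e, AddCircle.coe_add_period]
    ring
  · rw [e1, e2]
    have e3 : v * (t + (m : ℝ) / n * (2 * π / v)) = v * t + siteAngle n m := by
      rw [siteAngle]; field_simp
    have e4 : v * (t - (m : ℝ) / n * (2 * π / v)) = v * t - siteAngle n m := by
      rw [siteAngle]; field_simp
    have h := heq (v * t)
    rw [phaseSin_apply_coe] at h
    simp only [e3, e4]
    linear_combination h + hF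

lemma exists_travellingWave {n m : ℕ} (hn : 1 ≤ n) (hnm : ¬ n ∣ m) {K Γ F b β ε lam : ℝ}
    (hK : 0 ≤ K) (hΓ : 0 < Γ) (hb : 0 < b) (hF : 2 * b ≤ F) (hlam : 0 < lam)
    (hgap : ∀ v, 0 < v → ∀ k : ℤ, ¬ (n : ℤ) ∣ k * m →
      lam ≤ ‖symbol K Γ v (siteAngle n m) k‖)
    (hε : √(∑' k : ℤ, lam ^ (-(1 / 2) : ℝ) * (b ^ (-(3 / 2) : ℝ) * |(k : ℝ)| ^ (-(3 / 2) : ℝ))) ≤ ε)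
    (hβ : √(∑' k : ℤ, (b ^ 2)⁻¹ * |(k : ℝ)| ^ (-2 : ℝ)) ≤ β)
    (hε4 : ε ≤ 1 / 4) (hβε : β * ε ≤ 1 / 6) (hεb : ε ≤ b) :
    ∃ v : ℝ, 0 < v ∧ ∃ f : ℝ → ℝ, IsWaveform n m Γ K F v f := by
  set a := siteAngle n m with ha
  set s : Set ℝ := {v | b ≤ Γ * v} with hs
  have hΓv : ∀ v ∈ s, 0 < Γ * v := fun v hv => hb.trans_le hv
  have hvpos : ∀ v ∈ s, 0 < v := fun v hv => pos_of_mul_pos_right (hΓv v hv) hΓ.le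
  set p : ℝ → ℤ → ℂ := fun v k => -(symbol K Γ v a k)⁻¹ with hp
  set pA : ℝ → ℤ → ℂ := fun v k => if (n : ℤ) ∣ k * m then 0 else p v k with hpA
  set pB : ℝ → ℤ → ℂ := fun v k => if (n : ℤ) ∣ k * m then p v k else 0 with hpB
  have hqA : Summable fun k : ℤ =>
      lam ^ (-(1 / 2) : ℝ) * (b ^ (-(3 / 2) : ℝ) * |(k : ℝ)| ^ (-(3 / 2) : ℝ)) :=
    ((Real.summable_abs_int_rpow (by norm_num)).mul_left _).mul_left _
  have hqB : Summable fun k : ℤ => (b ^ 2)⁻¹ * |(k : ℝ)| ^ (-2 : ℝ) :=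
    summable_abs_rpow_neg_two.mul_left _
  have hA : ∀ v ∈ s, ∀ k, ‖pA v k‖ ^ 2 ≤
      lam ^ (-(1 / 2) : ℝ) * (b ^ (-(3 / 2) : ℝ) * |(k : ℝ)| ^ (-(3 / 2) : ℝ)) := by
    intro v hv k
    simp only [hpA]
    split_ifs with hk
    · rw [norm_zero, zero_pow two_ne_zero]; positivity
    · exact norm_sq_neg_inv_symbol_le_of_le hb hv hlam (hgap v (hvpos v hv) k hk)
  have hB : ∀ v ∈ s, ∀ k, ‖pB v k‖ ^ 2 ≤ (b ^ 2)⁻¹ * |(k : ℝ)| ^ (-2 : ℝ) := by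
    intro v hv k
    simp only [hpB]
    split_ifs with hk
    · exact norm_sq_neg_inv_symbol_le hb hv K a k
    · rw [norm_zero, zero_pow two_ne_zero]; positivity
  have hcA : ∀ k, ContinuousOn (fun v => pA v k) s := fun k => by
    simp only [hpA]
    split_ifs
    · exact continuousOn_const
    · exact continuousOn_neg_inv_symbol hΓv k
  have hcB : ∀ k, ContinuousOn (fun v => pB v k) s := fun k => by
    simp only [hpB]
    split_ifs
    · exact continuousOn_neg_inv_symbol hΓv k
    · exact continuousOn_const
  obtain ⟨A, B, hAc, hBc, hfix⟩ :=
    exists_continuousOn_fixedPoint hA hqA hB hqB hcA hcB hε hβ hε4 hβε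
  have hres : ∀ v ∈ s, ∀ k : ℤ, (n : ℤ) ∣ k * m → coeff (phaseSin (B v)) k = 0 := by
    intro v hv k hk
    refine coeff_phaseSin_eq_zero (a := (a : PhaseCircle)) (fun x => ?_) ?_
      ((fourier_siteAngle_eq_one_iff hn m k).2 hk)
    · rw [(hfix v hv).2]
      refine multiplier_apply_add (hB v hv) hqB (fun j => ?_) _ x
      by_cases hj : (n : ℤ) ∣ j * m
      · exact Or.inr ((fourier_siteAngle_eq_one_iff hn m j).2 hj)
      · exact Or.inl (if_neg hj)
    · rw [ha, Ne, fourier_siteAngle_eq_one_iff hn m 1, one_mul]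
      exact_mod_cast hnm
  have hsol : ∀ v ∈ s, A v + B v = multiplier (p v) (phaseSin (A v + B v)) := by
    intro v hv
    have h1 : multiplier (p v) (phaseSin (A v + B v)) -
        multiplier (pB v) (phaseSin (A v + B v) - phaseSin (B v)) =
        multiplier (pA v) (phaseSin (A v + B v)) := by
      rw [multiplier, multiplier, synth_sub
        (summable_norm_mul_coeff (norm_sq_neg_inv_symbol_le hb hv K a) hqB _)
        (summable_norm_mul_coeff (hB v hv) hqB _), multiplier]
      congr 1
      ext k
      rw [coeff_sub]
      simp only [hpA, hpB]
      split_ifs with hk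
      · rw [hres v hv k hk]; ring
      · ring
    rw [← (hfix v hv).1, ← (hfix v hv).2] at h1
    exact (sub_eq_iff_eq_add.1 h1).symm
  have hmean : ∀ v ∈ s, |(coeff (phaseSin (A v + B v)) 0).re| ≤ b := by
    intro v hv
    refine (Complex.abs_re_le_norm _).trans ?_
    have h1 := coeff_sub (phaseSin (A v + B v)) (phaseSin (B v)) 0
    rw [hres v hv 0 (by simp), sub_zero] at h1
    rw [← h1]
    refine (norm_coeff_le _ _).trans ((norm_phaseSin_sub_le _ _).trans ?_)
    rw [add_sub_cancel_right, (hfix v hv).1]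
    refine (norm_multiplier_le (hA v hv) hqA _).trans (le_trans ?_ hεb)
    exact (mul_le_of_le_one_right (Real.sqrt_nonneg _) (norm_phaseSin_le _)).trans hε
  have hsub : Set.Icc ((F - b) / Γ) ((F + b) / Γ) ⊆ s := by
    intro v hv
    have := (div_le_iff₀ hΓ).1 hv.1
    change b ≤ Γ * v
    linarith
  have hle : (F - b) / Γ ≤ (F + b) / Γ := by gcongr; linarith
  have hcont : ContinuousOn (fun v => Γ * v + (coeff (phaseSin (A v + B v)) 0).re)
      (Set.Icc ((F - b) / Γ) ((F + b) / Γ)) := by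
    refine ContinuousOn.mono ?_ hsub
    refine (continuous_const.mul continuous_id).continuousOn.add ?_
    exact (Complex.continuous_re.comp
      ((continuous_coeff 0).comp continuous_phaseSin)).comp_continuousOn (hAc.add hBc)
  obtain ⟨v, hv, hvF⟩ := intermediate_value_Icc hle hcont (show F ∈ _ by
    have h0 := abs_le.1 (hmean _ (hsub (Set.left_mem_Icc.2 hle)))
    have h1 := abs_le.1 (hmean _ (hsub (Set.right_mem_Icc.2 hle)))
    constructor
    · simp only [mul_div_cancel₀ _ hΓ.ne']
      linarith
    · simp only [mul_div_cancel₀ _ hΓ.ne']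
      linarith)
  exact ⟨v, hvpos v (hsub hv), _, isWaveform_of_multiplier hK (hvpos v (hsub hv))
    (hΓv v (hsub hv)) (hsol v (hsub hv)) hvF⟩

end SineGordonRing

/-- Assume `n` does not divide `m`. Fixing any `F̃ > 0` and `Γ̃ > 0`, there exists
`K₀ > 0` such that for all `K ≥ K₀`, `F ≥ F̃` and `Γ ≥ Γ̃` the discrete sine-Gordon
ring admits a travelling wave. -/
theorem exists_travellingWave_of_large_coupling (n m : ℕ) (hn : 1 ≤ n) (hm : 1 ≤ m)
    (hnm : ¬ n ∣ m) (Ftil Γtil : ℝ) (hFtil : 0 < Ftil) (hΓtil : 0 < Γtil) :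
    ∃ K₀ : ℝ, 0 < K₀ ∧ ∀ K F Γ : ℝ, K₀ ≤ K → Ftil ≤ F → Γtil ≤ Γ →
      ∃ v : ℝ, 0 < v ∧ ∃ f : ℝ → ℝ, IsWaveform n m Γ K F v f := by
  obtain ⟨c, hc, hgap⟩ := SineGordonRing.exists_gap hn m
  set b := Ftil / 2 with hb
  have hb0 : 0 < b := by positivity
  set β := √(∑' k : ℤ, (b ^ 2)⁻¹ * |(k : ℝ)| ^ (-2 : ℝ)) with hβ
  have hβ0 : 0 ≤ β := Real.sqrt_nonneg _
  set ε := min (1 / 4) (min (1 / (6 * (β + 1))) b) with hε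
  have hε0 : 0 < ε := by positivity
  have hβε : β * ε ≤ 1 / 6 := by
    have h1 : ε ≤ 1 / (6 * (β + 1)) := (min_le_right _ _).trans (min_le_left _ _)
    rw [le_div_iff₀ (by positivity)] at h1
    nlinarith
  obtain ⟨lam, hlamD, hlam⟩ : ∃ lam : ℝ, lam ^ (-(1 / 2) : ℝ) *
      (∑' k : ℤ, b ^ (-(3 / 2) : ℝ) * |(k : ℝ)| ^ (-(3 / 2) : ℝ)) < ε ^ 2 ∧ 0 < lam := by
    have h1 := (tendsto_rpow_neg_atTop (y := 1 / 2) (by norm_num)).mul_const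
      (∑' k : ℤ, b ^ (-(3 / 2) : ℝ) * |(k : ℝ)| ^ (-(3 / 2) : ℝ))
    rw [zero_mul] at h1
    exact ((h1.eventually_lt_const (by positivity : 0 < ε ^ 2)).and
      (Filter.eventually_gt_atTop 0)).exists
  refine ⟨2 * (lam + (lam / Γtil) ^ 2) / c, by positivity, fun K F Γ hK hF hΓ => ?_⟩
  have hK0 : 0 ≤ K := le_trans (by positivity) hK
  rw [div_le_iff₀ hc] at hK
  refine SineGordonRing.exists_travellingWave hn hnm hK0 (hΓtil.trans_le hΓ) hb0
    (by rw [hb]; linarith) hlam (fun v hv k hk => ?_) ?_ hβ.ge (min_le_left _ _) hβε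
    ((min_le_right _ _).trans (min_le_right _ _))
  · exact SineGordonRing.le_norm_symbol_of_gap hK0 hΓtil hΓ hv hlam (hgap k hk) hK
  · rw [tsum_mul_left]
    exact Real.sqrt_le_iff.2 ⟨hε0.le, hlamD.le⟩
end
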